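/- arXiv:1811.12184 — 3 statements merged into one kernel-verified Lean document; each statement's English description precedes it below -/
import Mathlib

section
/- Let O₂ be the subring of ℍ[ℚ,−1,−1] generated by i, j and (1+i+j+k)/2 (the Hurwitz quaternions); let O₃ be the subring of ℍ[ℚ,−1,−3] generated by i, (1+j)/2 and (i+k)/2; and let O₅ be the subring of ℍ[ℚ,−2,−5] generated by (1+i+j)/2, (2+i−k)/4 and (2+3i+k)/4. Then the abelianization of GL₂(O₂) is cyclic of order 3, the abelianization of GL₂(O₃) is cyclic of order 4, and the abelianization of GL₂(O₅) is cyclic of order 6. -/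
open Quaternion

/-- The Hurwitz quaternions: the subring of `ℍ[ℚ,-1,-1]` generated by `i`, `j` and
`(1+i+j+k)/2`. -/
def O2 : Subring ℍ[ℚ, -1, -1] :=
  Subring.closure {(⟨0, 1, 0, 0⟩ : ℍ[ℚ, -1, -1]), ⟨0, 0, 1, 0⟩, ⟨1/2, 1/2, 1/2, 1/2⟩}

/-- The maximal order of `ℍ[ℚ,-1,-3]`: the subring generated by `i`, `(1+j)/2` and
`(i+k)/2`. -/
def O3 : Subring ℍ[ℚ, -1, -3] :=
  Subring.closure {(⟨0, 1, 0, 0⟩ : ℍ[ℚ, -1, -3]), ⟨1/2, 0, 1/2, 0⟩, ⟨0, 1/2, 0, 1/2⟩}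

/-- The maximal order of `ℍ[ℚ,-2,-5]`: the subring generated by `(1+i+j)/2`, `(2+i-k)/4`
and `(2+3i+k)/4`. -/
def O5 : Subring ℍ[ℚ, -2, -5] :=
  Subring.closure
    {(⟨1/2, 1/2, 1/2, 0⟩ : ℍ[ℚ, -2, -5]), ⟨1/2, 1/4, 0, -(1/4)⟩, ⟨1/2, 3/4, 0, 1/4⟩}

section GeneralLinear

variable {R : Type*} [Ring R]

/-- The elementary matrix with upper right entry `x`. -/
def upperTransvection (x : R) : (Matrix (Fin 2) (Fin 2) R)ˣ where
  val := !![1, x; 0, 1]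
  inv := !![1, -x; 0, 1]
  val_inv := by simp [Matrix.one_fin_two]
  inv_val := by simp [Matrix.one_fin_two]

/-- The elementary matrix with lower left entry `x`. -/
def lowerTransvection (x : R) : (Matrix (Fin 2) (Fin 2) R)ˣ where
  val := !![1, 0; x, 1]
  inv := !![1, 0; -x, 1]
  val_inv := by simp [Matrix.one_fin_two]
  inv_val := by simp [Matrix.one_fin_two]

/-- The invertible diagonal matrix with diagonal entries `u` and `v`. -/
def diagonalUnit : Rˣ × Rˣ →* (Matrix (Fin 2) (Fin 2) R)ˣ where
  toFun p :=
    { val := !![(p.1 : R), 0; 0, (p.2 : R)]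
      inv := !![(↑p.1⁻¹ : R), 0; 0, (↑p.2⁻¹ : R)]
      val_inv := by simp [Matrix.one_fin_two]
      inv_val := by simp [Matrix.one_fin_two] }
  map_one' := by ext1; simp [Matrix.one_fin_two]
  map_mul' p q := by ext1; simp

variable {A : Type*} [CommGroup A] (φ : (Matrix (Fin 2) (Fin 2) R)ˣ →* A)

theorem map_upperTransvection_eq_one {w : Rˣ} (hw : IsUnit (1 - (w : R))) (x : R) :
    φ (upperTransvection x) = 1 := by
  obtain ⟨t, ht⟩ := hw
  obtain ⟨y, rfl⟩ : ∃ y, x = (1 - (w : R)) * y :=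
    ⟨↑t⁻¹ * x, by rw [← ht, Units.mul_inv_cancel_left]⟩
  have hsum : upperTransvection y =
      upperTransvection ((1 - (w : R)) * y) * upperTransvection (w * y) := by
    ext1; simp [upperTransvection, sub_mul]
  have hconj : diagonalUnit (w, 1) * upperTransvection y =
      upperTransvection (w * y) * diagonalUnit (w, 1) := by
    ext1; simp [upperTransvection, diagonalUnit]
  have h₁ := congrArg φ hsum
  have h₂ := congrArg φ hconj
  rw [map_mul, map_mul, mul_comm, mul_left_inj] at h₂
  rwa [map_mul, ← h₂, right_eq_mul] at h₁

theorem map_lowerTransvection_eq_one {w : Rˣ} (hw : IsUnit (1 - (w : R))) (x : R) :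
    φ (lowerTransvection x) = 1 := by
  obtain ⟨t, ht⟩ := hw
  obtain ⟨y, rfl⟩ : ∃ y, x = (1 - (w : R)) * y :=
    ⟨↑t⁻¹ * x, by rw [← ht, Units.mul_inv_cancel_left]⟩
  have hsum : lowerTransvection y =
      lowerTransvection ((1 - (w : R)) * y) * lowerTransvection (w * y) := by
    ext1; simp [lowerTransvection, sub_mul]
  have hconj : diagonalUnit (1, w) * lowerTransvection y =
      lowerTransvection (w * y) * diagonalUnit (1, w) := by
    ext1; simp [lowerTransvection, diagonalUnit]
  have h₁ := congrArg φ hsum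
  have h₂ := congrArg φ hconj
  rw [map_mul, map_mul, mul_comm, mul_left_inj] at h₂
  rwa [map_mul, ← h₂, right_eq_mul] at h₁

/-- The product of elementary matrices equal to the rotation by a quarter turn. -/
def quarterTurn : (Matrix (Fin 2) (Fin 2) R)ˣ :=
  upperTransvection (-1) * lowerTransvection 1 * upperTransvection (-1)

theorem coe_quarterTurn :
    ((quarterTurn : (Matrix (Fin 2) (Fin 2) R)ˣ) : Matrix (Fin 2) (Fin 2) R) =
      !![0, -1; 1, 0] := by
  simp [quarterTurn, upperTransvection, lowerTransvection]

theorem map_quarterTurn_eq_one {w : Rˣ} (hw : IsUnit (1 - (w : R))) :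
    φ quarterTurn = 1 := by
  simp [quarterTurn, map_upperTransvection_eq_one φ hw, map_lowerTransvection_eq_one φ hw]

theorem map_diagonalUnit {w : Rˣ} (hw : IsUnit (1 - (w : R))) (u v : Rˣ) :
    φ (diagonalUnit (u, v)) = φ (diagonalUnit (u * v, 1)) := by
  have hconj : quarterTurn * diagonalUnit (v, 1) = diagonalUnit (1, v) * quarterTurn := by
    ext1; simp [coe_quarterTurn, diagonalUnit]
  have h := congrArg φ hconj
  rw [map_mul, map_mul, map_quarterTurn_eq_one φ hw, one_mul, mul_one] at h
  have hu : ((u, v) : Rˣ × Rˣ) = (u, 1) * (1, v) := by simp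
  have hv : ((u * v, 1) : Rˣ × Rˣ) = (u, 1) * (v, 1) := by simp
  rw [hu, hv, map_mul, map_mul, map_mul, map_mul, h]

/-- An invertible upper triangular matrix over a domain is a product of a diagonal and an
elementary matrix. -/
theorem eq_diagonalUnit_mul_upperTransvection [NoZeroDivisors R]
    (g : (Matrix (Fin 2) (Fin 2) R)ˣ) (hg : (g : Matrix (Fin 2) (Fin 2) R) 1 0 = 0) :
    ∃ (u v : Rˣ) (x : R), g = diagonalUnit (u, v) * upperTransvection x := by
  have h₁ := Matrix.ext_iff.mpr g.mul_inv
  have h₂ := Matrix.ext_iff.mpr g.inv_mul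
  generalize ((g⁻¹ : (Matrix (Fin 2) (Fin 2) R)ˣ) : Matrix (Fin 2) (Fin 2) R) = m at h₁ h₂
  simp only [Matrix.mul_apply, Fin.sum_univ_two, Fin.forall_fin_two, Matrix.one_apply_eq, hg,
    zero_mul, mul_zero, add_zero, zero_add, ne_eq, Fin.zero_eq_one_iff, OfNat.ofNat_ne_one,
    not_false_eq_true, Matrix.one_apply_ne, one_ne_zero] at h₁ h₂
  obtain ⟨⟨h₁₁, -⟩, h₁₂, h₁₃⟩ := h₁
  obtain ⟨⟨h₂₁, -⟩, -, h₂₂⟩ := h₂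
  have hm : m 1 0 = 0 := by
    rcases mul_eq_zero.mp h₁₂ with h | h
    · rw [h, zero_mul] at h₁₃
      rw [← mul_one (m 1 0), ← h₁₃, mul_zero]
    · exact h
  rw [hm, mul_zero, add_zero] at h₁₁
  rw [hm, zero_mul, zero_add] at h₂₂
  refine ⟨⟨_, _, h₁₁, h₂₁⟩, ⟨_, _, h₁₃, h₂₂⟩, m 0 0 * (g : Matrix (Fin 2) (Fin 2) R) 0 1, ?_⟩
  ext i j
  fin_cases i <;> fin_cases j <;>
    simp [diagonalUnit, upperTransvection, hg, ← mul_assoc, h₁₁]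

/-- Over a ring with a left Euclidean division and with an exceptional unit, every homomorphism
from `GL₂` to a commutative group is determined by its values on diagonal matrices. -/
theorem exists_map_eq_map_diagonalUnit [NoZeroDivisors R] (N : R → ℕ)
    (hN : ∀ a b : R, b ≠ 0 → ∃ q, N (a - q * b) < N b)
    {w : Rˣ} (hw : IsUnit (1 - (w : R))) (g : (Matrix (Fin 2) (Fin 2) R)ˣ) :
    ∃ u : Rˣ, φ g = φ (diagonalUnit (u, 1)) := by
  induction h : N ((g : Matrix (Fin 2) (Fin 2) R) 1 0) using Nat.strong_induction_on
    generalizing g with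
  | _ n ih =>
    by_cases hc : (g : Matrix (Fin 2) (Fin 2) R) 1 0 = 0
    · obtain ⟨u, v, x, rfl⟩ := eq_diagonalUnit_mul_upperTransvection g hc
      exact ⟨u * v, by
        rw [map_mul, map_upperTransvection_eq_one φ hw, mul_one, map_diagonalUnit φ hw]⟩
    · obtain ⟨q, hq⟩ := hN ((g : Matrix (Fin 2) (Fin 2) R) 0 0) _ hc
      obtain ⟨u, hu⟩ := ih _ (by
        rw [← h]
        convert hq using 2) (quarterTurn * (upperTransvection (-q) * g)) (by
        simp [coe_quarterTurn, upperTransvection, Matrix.vecMul, dotProduct, sub_eq_add_neg])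
      exact ⟨u, by
        rwa [map_mul, map_mul, map_quarterTurn_eq_one φ hw, map_upperTransvection_eq_one φ hw,
          one_mul, one_mul] at hu⟩

/-- The abelianization of `GL₂` of a left Euclidean domain `R` with an exceptional unit is cyclic
of order `n` as soon as a unit `g` of order dividing `n` generates the abelianization of `Rˣ` and
has an image of order `n` in some commutative ring. -/
theorem nonempty_abelianization_mulEquiv [NoZeroDivisors R] (N : R → ℕ)
    (hN : ∀ a b : R, b ≠ 0 → ∃ q, N (a - q * b) < N b)
    {w : Rˣ} (hw : IsUnit (1 - (w : R))) {n : ℕ} (g : Rˣ) (hgn : g ^ n = 1)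
    (hg : ∀ v : Rˣ, Abelianization.of v ∈ Subgroup.zpowers (Abelianization.of g))
    {S : Type*} [CommRing S] (f : R →+* S) (hf : orderOf (f g) = n) :
    Nonempty (Abelianization (Matrix (Fin 2) (Fin 2) R)ˣ ≃* Multiplicative (ZMod n)) := by
  let δ : Rˣ →* (Matrix (Fin 2) (Fin 2) R)ˣ := diagonalUnit.comp (MonoidHom.inl Rˣ Rˣ)
  let x : Abelianization (Matrix (Fin 2) (Fin 2) R)ˣ := Abelianization.of (δ g)
  let det : (Matrix (Fin 2) (Fin 2) R)ˣ →* Sˣ :=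
    Units.map (Matrix.detMonoidHom.comp (f.mapMatrix (m := Fin 2)).toMonoidHom)
  have hdet : orderOf (Abelianization.lift det x) = n := by
    rw [← hf, ← orderOf_units]
    congr 1
    simp [x, δ, det, diagonalUnit, Matrix.det_fin_two]
  have hx : orderOf x = n := by
    refine Nat.dvd_antisymm (orderOf_dvd_of_pow_eq_one ?_) ?_
    · rw [← map_pow, ← map_pow, hgn, map_one, map_one]
    · conv_lhs => rw [← hdet]
      exact orderOf_map_dvd _ _
  have hgen : ∀ y, y ∈ Subgroup.zpowers x := by
    intro y
    obtain ⟨m, rfl⟩ := QuotientGroup.mk_surjective y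
    obtain ⟨u, hu⟩ := exists_map_eq_map_diagonalUnit Abelianization.of N hN hw m
    obtain ⟨k, hk⟩ := hg u
    refine ⟨k, ?_⟩
    have := congrArg (Abelianization.map δ) hk
    simp only [map_zpow, Abelianization.map_of] at this
    exact this.trans hu.symm
  have : IsCyclic (Abelianization (Matrix (Fin 2) (Fin 2) R)ˣ) := ⟨x, hgen⟩
  have hcard : Nat.card (Abelianization (Matrix (Fin 2) (Fin 2) R)ˣ) = n := by
    rw [← hx, orderOf_eq_card_of_forall_mem_zpowers hgen]
  exact ⟨mulEquivOfCyclicCardEq (by rw [hcard, Nat.card_congr Multiplicative.toAdd, Nat.card_zmod])⟩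

end GeneralLinear

section QuaternionOrder

variable {u v : ℚ}

/-- The reduced norm on a quaternion algebra over `ℚ`. -/
def reducedNorm (x : ℍ[ℚ, u, v]) : ℚ :=
  x.re ^ 2 - u * x.imI ^ 2 - v * x.imJ ^ 2 + u * v * x.imK ^ 2

theorem reducedNorm_mul (x y : ℍ[ℚ, u, v]) :
    reducedNorm (x * y) = reducedNorm x * reducedNorm y := by
  simp only [reducedNorm, QuaternionAlgebra.re_mul, QuaternionAlgebra.imI_mul,
    QuaternionAlgebra.imJ_mul, QuaternionAlgebra.imK_mul]
  ring

theorem reducedNorm_one : reducedNorm (1 : ℍ[ℚ, u, v]) = 1 := by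
  simp [reducedNorm]

theorem star_mul_eq_reducedNorm (x : ℍ[ℚ, u, v]) : star x * x = ⟨reducedNorm x, 0, 0, 0⟩ := by
  ext <;> simp [reducedNorm] <;> ring

theorem reducedNorm_nonneg (hu : u < 0) (hv : v < 0) (x : ℍ[ℚ, u, v]) : 0 ≤ reducedNorm x := by
  have := mul_pos_of_neg_of_neg hu hv
  unfold reducedNorm
  nlinarith [sq_nonneg x.re, mul_nonneg (neg_pos.mpr hu).le (sq_nonneg x.imI),
    mul_nonneg (neg_pos.mpr hv).le (sq_nonneg x.imJ), mul_nonneg this.le (sq_nonneg x.imK)]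

theorem reducedNorm_eq_zero (hu : u < 0) (hv : v < 0) {x : ℍ[ℚ, u, v]} :
    reducedNorm x = 0 ↔ x = 0 := by
  refine ⟨fun h ↦ ?_, fun h ↦ by simp [h, reducedNorm]⟩
  have huv := mul_pos_of_neg_of_neg hu hv
  have h₁ := sq_nonneg x.re
  have h₂ := mul_nonneg (neg_pos.mpr hu).le (sq_nonneg x.imI)
  have h₃ := mul_nonneg (neg_pos.mpr hv).le (sq_nonneg x.imJ)
  have h₄ := mul_nonneg huv.le (sq_nonneg x.imK)
  unfold reducedNorm at h
  ext
  · exact pow_eq_zero_iff two_ne_zero |>.mp (by linarith)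
  · have : -u * x.imI ^ 2 = 0 := by linarith
    simpa [hu.ne] using this
  · have : -v * x.imJ ^ 2 = 0 := by linarith
    simpa [hv.ne] using this
  · have : u * v * x.imK ^ 2 = 0 := by linarith
    simpa [hu.ne, hv.ne] using this

theorem noZeroDivisors_of_definite (hu : u < 0) (hv : v < 0) (O : Subring ℍ[ℚ, u, v]) :
    NoZeroDivisors O where
  eq_zero_or_eq_zero_of_mul_eq_zero {a b} h := by
    have h' : reducedNorm ((a : ℍ[ℚ, u, v]) * (b : ℍ[ℚ, u, v])) = 0 := by
      rw [← Subring.coe_mul, h]; simp [reducedNorm]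
    rw [reducedNorm_mul, mul_eq_zero, reducedNorm_eq_zero hu hv, reducedNorm_eq_zero hu hv] at h'
    simpa using h'

/-- A subring of a definite quaternion algebra that has integral reduced norms and covers the
algebra by open unit balls is left Euclidean. -/
theorem exists_euclidean_quotient (hu : u < 0) (hv : v < 0) (O : Subring ℍ[ℚ, u, v])
    (hnorm : ∀ x ∈ O, ∃ n : ℤ, reducedNorm x = n)
    (hcov : ∀ x : ℍ[ℚ, u, v], ∃ q ∈ O, reducedNorm (x - q) < 1) (a b : O) (hb : b ≠ 0) :
    ∃ q : O, ⌊reducedNorm ((a - q * b : O) : ℍ[ℚ, u, v])⌋.toNat <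
      ⌊reducedNorm (b : ℍ[ℚ, u, v])⌋.toNat := by
  have hb' : (b : ℍ[ℚ, u, v]) ≠ 0 := by simpa using hb
  have hnb : reducedNorm (b : ℍ[ℚ, u, v]) ≠ 0 := (reducedNorm_eq_zero hu hv).not.mpr hb'
  have hpos := (reducedNorm_nonneg hu hv (b : ℍ[ℚ, u, v])).lt_of_ne' hnb
  let c : ℍ[ℚ, u, v] := (reducedNorm (b : ℍ[ℚ, u, v]))⁻¹ • star (b : ℍ[ℚ, u, v])
  have hc : c * b = 1 := by
    rw [smul_mul_assoc, star_mul_eq_reducedNorm]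
    ext <;> simp [hnb]
  obtain ⟨q, hq, hlt⟩ := hcov (a * c)
  have heq : (a - q * b : ℍ[ℚ, u, v]) = (a * c - q) * b := by
    rw [sub_mul, mul_assoc, hc, mul_one]
  have key : reducedNorm (a - q * b : ℍ[ℚ, u, v]) < reducedNorm (b : ℍ[ℚ, u, v]) := by
    rw [heq, reducedNorm_mul]
    exact mul_lt_of_lt_one_left hpos hlt
  refine ⟨⟨q, hq⟩, ?_⟩
  rw [AddSubgroupClass.coe_sub, Subring.coe_mul]
  obtain ⟨m, hm⟩ := hnorm _ (sub_mem a.2 (mul_mem hq b.2))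
  obtain ⟨n, hn⟩ := hnorm _ b.2
  rw [hm, hn] at key
  rw [hn] at hpos
  rw [hm, hn, Int.floor_intCast, Int.floor_intCast]
  have h₁ : m < n := by exact_mod_cast key
  have h₂ : 0 < n := by exact_mod_cast hpos
  lia

theorem reducedNorm_unit (hu : u < 0) (hv : v < 0) {O : Subring ℍ[ℚ, u, v]}
    (hnorm : ∀ x ∈ O, ∃ n : ℤ, reducedNorm x = n) (x : Oˣ) :
    reducedNorm ((x : O) : ℍ[ℚ, u, v]) = 1 := by
  obtain ⟨m, hm⟩ := hnorm _ (x : O).2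
  obtain ⟨n, hn⟩ := hnorm _ (↑x⁻¹ : O).2
  have h₁ := reducedNorm_nonneg hu hv ((x : O) : ℍ[ℚ, u, v])
  have h₂ : ((x : O) : ℍ[ℚ, u, v]) * ((↑x⁻¹ : O) : ℍ[ℚ, u, v]) = 1 := by
    rw [← Subring.coe_mul, Units.mul_inv, Subring.coe_one]
  have h₃ := congrArg reducedNorm h₂
  rw [reducedNorm_mul, reducedNorm_one, hm, hn] at h₃
  rw [hm] at h₁ ⊢
  norm_cast at h₁ h₃ ⊢
  exact Int.eq_one_of_mul_eq_one_right h₁ h₃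

/-- The unit of a subring given by a pair of mutually inverse elements. -/
def unitOfMem {A : Type*} [Ring A] {O : Subring A} (x y : A) (hx : x ∈ O) (hy : y ∈ O)
    (hxy : x * y = 1) (hyx : y * x = 1) : Oˣ :=
  ⟨⟨x, hx⟩, ⟨y, hy⟩, Subtype.ext hxy, Subtype.ext hyx⟩

theorem abelianization_GL2_quaternionOrder (hu : u < 0) (hv : v < 0) (O : Subring ℍ[ℚ, u, v])
    (hnorm : ∀ x ∈ O, ∃ n : ℤ, reducedNorm x = n)
    (hcov : ∀ x : ℍ[ℚ, u, v], ∃ q ∈ O, reducedNorm (x - q) < 1)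
    {w : Oˣ} (hw : IsUnit (1 - (w : O))) {n : ℕ} (g : Oˣ) (hgn : g ^ n = 1)
    (hg : ∀ v : Oˣ, Abelianization.of v ∈ Subgroup.zpowers (Abelianization.of g))
    {S : Type*} [CommRing S] (f : O →+* S) (hf : orderOf (f g) = n) :
    Nonempty (Abelianization (Matrix (Fin 2) (Fin 2) O)ˣ ≃* Multiplicative (ZMod n)) := by
  have := noZeroDivisors_of_definite hu hv O
  exact nonempty_abelianization_mulEquiv (fun x : O ↦ ⌊reducedNorm (x : ℍ[ℚ, u, v])⌋.toNat)
    (exists_euclidean_quotient hu hv O hnorm hcov) hw g hgn hg f hf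

end QuaternionOrder

theorem abelianization_of_eq_of_semiconj {G : Type*} [Group G] {w x y : G} (h : w * x = y * w) :
    Abelianization.of x = Abelianization.of y := by
  have h' := congrArg Abelianization.of h
  rw [map_mul, map_mul, mul_comm] at h'
  exact mul_right_cancel h'

theorem exists_int_abs_sub_le_half (x : ℚ) : ∃ n : ℤ, |x - n| ≤ 1 / 2 :=
  ⟨round x, abs_sub_round x⟩

section Hurwitz

/-- The quaternion with coordinates `a, b, c, d` in the basis `1, i, j, (1+i+j+k)/2`. -/
def hurwitz (a b c d : ℤ) : ℍ[ℚ, -1, -1] := ⟨a + d / 2, b + d / 2, c + d / 2, d / 2⟩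

theorem hurwitz_mul (a b c d a' b' c' d' : ℤ) :
    hurwitz a b c d * hurwitz a' b' c' d' = hurwitz
      (a * a' - b * b' - b * c' - b * d' + c * b' - c * c' - d * c' - d * d')
      (a * b' + b * a' - b * c' + c * b' + c * d' + d * b' - d * c')
      (a * c' - b * c' - b * d' + c * a' + c * b' + c * d' + d * b')
      (a * d' + 2 * b * c' + b * d' - 2 * c * b' - c * d' + d * a' - d * b' + d * c' + d * d') := by
  ext <;> simp [hurwitz] <;> ring

theorem hurwitz_one : 1 = hurwitz 1 0 0 0 := by
  ext <;> simp [hurwitz]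

theorem hurwitz_add (a b c d a' b' c' d' : ℤ) :
    hurwitz a b c d + hurwitz a' b' c' d' = hurwitz (a + a') (b + b') (c + c') (d + d') := by
  ext <;> simp [hurwitz] <;> ring

theorem hurwitz_mem (a b c d : ℤ) : hurwitz a b c d ∈ O2 := by
  have h₁ : (⟨0, 1, 0, 0⟩ : ℍ[ℚ, -1, -1]) ∈ O2 := Subring.subset_closure (by simp)
  have h₂ : (⟨0, 0, 1, 0⟩ : ℍ[ℚ, -1, -1]) ∈ O2 := Subring.subset_closure (by simp)
  have h₃ : (⟨1/2, 1/2, 1/2, 1/2⟩ : ℍ[ℚ, -1, -1]) ∈ O2 := Subring.subset_closure (by simp)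
  have h := add_mem (add_mem (add_mem (zsmul_mem (one_mem O2) a) (zsmul_mem h₁ b))
    (zsmul_mem h₂ c)) (zsmul_mem h₃ d)
  convert h using 1
  ext <;> simp [hurwitz] <;> ring

theorem exists_eq_hurwitz {x : ℍ[ℚ, -1, -1]} (hx : x ∈ O2) :
    ∃ a b c d : ℤ, x = hurwitz a b c d := by
  induction hx using Subring.closure_induction with
  | mem x hx =>
    rcases hx with rfl | rfl | rfl
    · exact ⟨0, 1, 0, 0, by ext <;> simp [hurwitz]⟩
    · exact ⟨0, 0, 1, 0, by ext <;> simp [hurwitz]⟩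
    · exact ⟨0, 0, 0, 1, by ext <;> simp [hurwitz]⟩
  | zero => exact ⟨0, 0, 0, 0, by ext <;> simp [hurwitz]⟩
  | one => exact ⟨1, 0, 0, 0, by ext <;> simp [hurwitz]⟩
  | add x y _ _ hx hy =>
    obtain ⟨a, b, c, d, rfl⟩ := hx
    obtain ⟨a', b', c', d', rfl⟩ := hy
    exact ⟨_, _, _, _, hurwitz_add ..⟩
  | neg x _ hx =>
    obtain ⟨a, b, c, d, rfl⟩ := hx
    exact ⟨-a, -b, -c, -d, by ext <;> simp [hurwitz] <;> ring⟩
  | mul x y _ _ hx hy =>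
    obtain ⟨a, b, c, d, rfl⟩ := hx
    obtain ⟨a', b', c', d', rfl⟩ := hy
    exact ⟨_, _, _, _, hurwitz_mul ..⟩

theorem reducedNorm_hurwitz (a b c d : ℤ) : reducedNorm (hurwitz a b c d) =
    ((a ^ 2 + b ^ 2 + c ^ 2 + d ^ 2 + (a + b + c) * d : ℤ) : ℚ) := by
  simp [reducedNorm, hurwitz]; ring

theorem exists_int_reducedNorm_O2 (x : ℍ[ℚ, -1, -1]) (hx : x ∈ O2) :
    ∃ n : ℤ, reducedNorm x = n := by
  obtain ⟨a, b, c, d, rfl⟩ := exists_eq_hurwitz hx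
  exact ⟨_, reducedNorm_hurwitz a b c d⟩

theorem exists_reducedNorm_sub_lt_O2 (x : ℍ[ℚ, -1, -1]) :
    ∃ q ∈ O2, reducedNorm (x - q) < 1 := by
  obtain ⟨d, hd⟩ : ∃ d : ℤ, |2 * x.imK - d| ≤ 1 / 2 := exists_int_abs_sub_le_half _
  obtain ⟨a, ha⟩ := exists_int_abs_sub_le_half (x.re - d / 2)
  obtain ⟨b, hb⟩ := exists_int_abs_sub_le_half (x.imI - d / 2)
  obtain ⟨c, hc⟩ := exists_int_abs_sub_le_half (x.imJ - d / 2)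
  refine ⟨hurwitz a b c d, hurwitz_mem a b c d, ?_⟩
  have ha' := sq_le_sq' (abs_le.mp ha).1 (abs_le.mp ha).2
  have hb' := sq_le_sq' (abs_le.mp hb).1 (abs_le.mp hb).2
  have hc' := sq_le_sq' (abs_le.mp hc).1 (abs_le.mp hc).2
  have hd' := sq_le_sq' (abs_le.mp hd).1 (abs_le.mp hd).2
  simp only [reducedNorm, hurwitz, QuaternionAlgebra.re_sub, QuaternionAlgebra.imI_sub,
    QuaternionAlgebra.imJ_sub, QuaternionAlgebra.imK_sub]
  linarith

/-- The function on quaternions inducing the reduction of the Hurwitz quaternions modulo `1 + i`,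
with values in `𝔽₄ = 𝔽₂[ω]`, `ω ^ 2 = 1 + ω`. -/
def residueO2 (x : ℍ[ℚ, -1, -1]) : QuadraticAlgebra (ZMod 2) 1 1 :=
  ⟨(⌊x.re + x.imI + x.imJ - 3 * x.imK⌋ : ℤ), (⌊2 * x.imK⌋ : ℤ)⟩

theorem residueO2_hurwitz (a b c d : ℤ) :
    residueO2 (hurwitz a b c d) = ⟨((a + b + c : ℤ) : ZMod 2), (d : ZMod 2)⟩ := by
  have h₁ : (hurwitz a b c d).re + (hurwitz a b c d).imI + (hurwitz a b c d).imJ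
      - 3 * (hurwitz a b c d).imK = ((a + b + c : ℤ) : ℚ) := by
    simp only [hurwitz]; push_cast; ring
  have h₂ : 2 * (hurwitz a b c d).imK = (d : ℚ) := by
    simp only [hurwitz]; ring
  rw [residueO2, h₁, h₂, Int.floor_intCast, Int.floor_intCast]

theorem residueO2_mul {x y : ℍ[ℚ, -1, -1]} (hx : x ∈ O2) (hy : y ∈ O2) :
    residueO2 (x * y) = residueO2 x * residueO2 y := by
  obtain ⟨a, b, c, d, rfl⟩ := exists_eq_hurwitz hx
  obtain ⟨a', b', c', d', rfl⟩ := exists_eq_hurwitz hy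
  rw [hurwitz_mul, residueO2_hurwitz, residueO2_hurwitz, residueO2_hurwitz]
  ext <;> (simp; grind)

theorem residueO2_add {x y : ℍ[ℚ, -1, -1]} (hx : x ∈ O2) (hy : y ∈ O2) :
    residueO2 (x + y) = residueO2 x + residueO2 y := by
  obtain ⟨a, b, c, d, rfl⟩ := exists_eq_hurwitz hx
  obtain ⟨a', b', c', d', rfl⟩ := exists_eq_hurwitz hy
  rw [hurwitz_add, residueO2_hurwitz, residueO2_hurwitz, residueO2_hurwitz]
  ext <;> (simp; try ring)

theorem residueO2_one : residueO2 1 = 1 := by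
  rw [hurwitz_one, residueO2_hurwitz]
  rfl

/-- The reduction of the Hurwitz quaternions modulo `1 + i`. -/
def reductionO2 : O2 →+* QuadraticAlgebra (ZMod 2) 1 1 :=
  RingHom.mk' ⟨⟨fun x ↦ residueO2 x, residueO2_one⟩, fun x y ↦ residueO2_mul x.2 y.2⟩
    fun x y ↦ residueO2_add x.2 y.2

/-- The Hurwitz unit `i`. -/
def hurwitzI : O2ˣ := unitOfMem (hurwitz 0 1 0 0) (hurwitz 0 (-1) 0 0)
  (hurwitz_mem _ _ _ _) (hurwitz_mem _ _ _ _) (by simp [hurwitz_mul, hurwitz_one])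
  (by simp [hurwitz_mul, hurwitz_one])

/-- The Hurwitz unit `j`. -/
def hurwitzJ : O2ˣ := unitOfMem (hurwitz 0 0 1 0) (hurwitz 0 0 (-1) 0)
  (hurwitz_mem _ _ _ _) (hurwitz_mem _ _ _ _) (by simp [hurwitz_mul, hurwitz_one])
  (by simp [hurwitz_mul, hurwitz_one])

/-- The Hurwitz unit `(1+i+j+k)/2`, of order `6`. -/
def hurwitzW : O2ˣ := unitOfMem (hurwitz 0 0 0 1) (hurwitz 1 0 0 (-1))
  (hurwitz_mem _ _ _ _) (hurwitz_mem _ _ _ _) (by simp [hurwitz_mul, hurwitz_one])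
  (by simp [hurwitz_mul, hurwitz_one])

theorem coe_hurwitzI : ((hurwitzI : O2) : ℍ[ℚ, -1, -1]) = hurwitz 0 1 0 0 := rfl

theorem coe_hurwitzJ : ((hurwitzJ : O2) : ℍ[ℚ, -1, -1]) = hurwitz 0 0 1 0 := rfl

theorem coe_hurwitzW : ((hurwitzW : O2) : ℍ[ℚ, -1, -1]) = hurwitz 0 0 0 1 := rfl

theorem abelianization_of_hurwitzI_eq_one : Abelianization.of hurwitzI = 1 := by
  have h₁ : hurwitzW * hurwitzI = hurwitzJ * hurwitzW := by
    ext1; ext1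
    simp [coe_hurwitzI, coe_hurwitzJ, coe_hurwitzW, hurwitz_mul]
  have h₂ : hurwitzW * hurwitzJ = (hurwitzI * hurwitzJ) * hurwitzW := by
    ext1; ext1
    simp [coe_hurwitzI, coe_hurwitzJ, coe_hurwitzW, hurwitz_mul]
  have h₃ := abelianization_of_eq_of_semiconj h₂
  rwa [map_mul, right_eq_mul] at h₃

theorem abelianization_of_hurwitzJ_eq_one : Abelianization.of hurwitzJ = 1 := by
  rw [← abelianization_of_hurwitzI_eq_one, eq_comm]
  refine abelianization_of_eq_of_semiconj (w := hurwitzW) ?_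
  ext1; ext1
  simp [coe_hurwitzI, coe_hurwitzJ, coe_hurwitzW, hurwitz_mul]

theorem abelianization_of_eq_one_of_even {v : O2ˣ} {a b c e : ℤ}
    (hv : ((v : O2) : ℍ[ℚ, -1, -1]) = hurwitz a b c (2 * e)) : Abelianization.of v = 1 := by
  have hN := reducedNorm_unit (by norm_num) (by norm_num) exists_int_reducedNorm_O2 v
  rw [hv, reducedNorm_hurwitz] at hN
  have hN' : (a + e) ^ 2 + (b + e) ^ 2 + (c + e) ^ 2 + e ^ 2 = 1 := by
    have : a ^ 2 + b ^ 2 + c ^ 2 + (2 * e) ^ 2 + (a + b + c) * (2 * e) = 1 := by exact_mod_cast hN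
    linarith
  obtain ⟨x, rfl⟩ : ∃ x, a = x - e := ⟨a + e, by ring⟩
  obtain ⟨y, rfl⟩ : ∃ y, b = y - e := ⟨b + e, by ring⟩
  obtain ⟨z, rfl⟩ : ∃ z, c = z - e := ⟨c + e, by ring⟩
  simp only [sub_add_cancel] at hN'
  have hx₁ : -1 ≤ x := by nlinarith
  have hx₂ : x ≤ 1 := by nlinarith
  have hy₁ : -1 ≤ y := by nlinarith
  have hy₂ : y ≤ 1 := by nlinarith
  have hz₁ : -1 ≤ z := by nlinarith
  have hz₂ : z ≤ 1 := by nlinarith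
  have he₁ : -1 ≤ e := by nlinarith
  have he₂ : e ≤ 1 := by nlinarith
  have key (p : O2ˣ) (hp : Abelianization.of p = 1)
      (h : ((v : O2) : ℍ[ℚ, -1, -1]) = ((p : O2) : ℍ[ℚ, -1, -1])) : Abelianization.of v = 1 := by
    rwa [show v = p from Units.ext (Subtype.ext h)]
  have hI := abelianization_of_hurwitzI_eq_one
  have hJ := abelianization_of_hurwitzJ_eq_one
  interval_cases x <;> interval_cases y <;> interval_cases z <;> interval_cases e <;>
    first
    | (exfalso; revert hN'; norm_num; done)
    | (refine key 1 ?_ ?_ <;> simp [hv, hurwitz_one]; done)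
    | (refine key hurwitzI hI ?_; simp [hv, coe_hurwitzI]; done)
    | (refine key hurwitzJ hJ ?_; simp [hv, coe_hurwitzJ]; done)
    | (refine key (hurwitzI * hurwitzJ) ?_ ?_ <;>
        simp [hI, hJ, hv, coe_hurwitzI, coe_hurwitzJ, hurwitz_mul]; done)
    | (refine key (hurwitzI * hurwitzI) ?_ ?_ <;>
        simp [hI, hv, coe_hurwitzI, hurwitz_mul]; done)
    | (refine key hurwitzI⁻¹ ?_ hv; simp [hI]; done)
    | (refine key hurwitzJ⁻¹ ?_ hv; simp [hJ]; done)
    | (refine key (hurwitzJ * hurwitzI) ?_ ?_ <;>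
        simp [hI, hJ, hv, coe_hurwitzI, coe_hurwitzJ, hurwitz_mul]; done)

theorem abelianization_of_mem_zpowers_O2 (v : O2ˣ) :
    Abelianization.of v ∈ Subgroup.zpowers (Abelianization.of (hurwitzW ^ 2)) := by
  obtain ⟨a, b, c, d, hv⟩ := exists_eq_hurwitz (v : O2).2
  suffices h : ∃ n : ℕ, ∃ a b c e : ℤ,
      ((v * (hurwitzW ^ 2) ^ n : O2) : ℍ[ℚ, -1, -1]) = hurwitz a b c (2 * e) by
    obtain ⟨n, a, b, c, e, h⟩ := h
    have h' := abelianization_of_eq_one_of_even (v := v * (hurwitzW ^ 2) ^ n)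
      (by simpa using h)
    rw [map_mul, map_pow, mul_eq_one_iff_eq_inv] at h'
    rw [h']
    exact inv_mem (pow_mem (Subgroup.mem_zpowers _) n)
  have hW : ((hurwitzW ^ 2 : O2) : ℍ[ℚ, -1, -1]) = hurwitz (-1) 0 0 1 := by
    simp [pow_two, coe_hurwitzW, hurwitz_mul]
  rcases Int.even_or_odd' d with ⟨e, rfl | rfl⟩
  · exact ⟨0, a, b, c, e, by simpa using hv⟩
  · rcases Int.even_or_odd' (a + b + c) with ⟨f, hf | hf⟩
    · refine ⟨1, -a - b - (2 * e + 1), c - b, -b, f - c, ?_⟩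
      rw [pow_one, Subring.coe_mul, hv, hW, hurwitz_mul]
      congr 1 <;> linarith
    · refine ⟨2, b + (2 * e + 1), -c, b - c, c - f - e - 1, ?_⟩
      rw [pow_two, Subring.coe_mul, Subring.coe_mul, hv, hW, hurwitz_mul, hurwitz_mul]
      congr 1 <;> linarith

theorem abelianization_GL2_O2 :
    Nonempty (Abelianization (Matrix (Fin 2) (Fin 2) O2)ˣ ≃* Multiplicative (ZMod 3)) := by
  refine abelianization_GL2_quaternionOrder (by norm_num) (by norm_num) O2
    exists_int_reducedNorm_O2 exists_reducedNorm_sub_lt_O2 (w := hurwitzW) ?_ (hurwitzW ^ 2) ?_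
    abelianization_of_mem_zpowers_O2 reductionO2 ?_
  · refine ⟨hurwitzW⁻¹, Subtype.ext ?_⟩
    rw [AddSubgroupClass.coe_sub, Subring.coe_one, coe_hurwitzW]
    change hurwitz 1 0 0 (-1) = _
    ext <;> simp [hurwitz] <;> norm_num
  · ext1; ext1
    simp [pow_succ, coe_hurwitzW, hurwitz_mul, hurwitz_one]
  · have : reductionO2 ((hurwitzW : O2)) = ⟨0, 1⟩ := residueO2_hurwitz 0 0 0 1
    rw [Units.val_pow_eq_pow_val, map_pow, this]
    refine orderOf_eq_prime ?_ ?_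
    · decide
    · decide

end Hurwitz

section DiscriminantThree

/-- The quaternion with coordinates `a, b, c, d` in the basis `1, i, (1+j)/2, (i+k)/2`. -/
def quatThree (a b c d : ℤ) : ℍ[ℚ, -1, -3] := ⟨a + c / 2, b + d / 2, c / 2, d / 2⟩

theorem quatThree_mul (a b c d a' b' c' d' : ℤ) :
    quatThree a b c d * quatThree a' b' c' d' = quatThree
      (a * a' - b * b' - c * c' - d * b' - d * d')
      (a * b' + b * a' + c * b' + c * d' - d * c')
      (a * c' - b * d' + c * a' + c * c' + d * b')
      (a * d' + b * c' - c * b' + d * a' + d * c') := by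
  ext <;> simp [quatThree] <;> ring

theorem quatThree_one : 1 = quatThree 1 0 0 0 := by
  ext <;> simp [quatThree]

theorem quatThree_add (a b c d a' b' c' d' : ℤ) :
    quatThree a b c d + quatThree a' b' c' d' = quatThree (a + a') (b + b') (c + c') (d + d') := by
  ext <;> simp [quatThree] <;> ring

theorem quatThree_mem (a b c d : ℤ) : quatThree a b c d ∈ O3 := by
  have h₁ : (⟨0, 1, 0, 0⟩ : ℍ[ℚ, -1, -3]) ∈ O3 := Subring.subset_closure (by simp)
  have h₂ : (⟨1/2, 0, 1/2, 0⟩ : ℍ[ℚ, -1, -3]) ∈ O3 := Subring.subset_closure (by simp)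
  have h₃ : (⟨0, 1/2, 0, 1/2⟩ : ℍ[ℚ, -1, -3]) ∈ O3 := Subring.subset_closure (by simp)
  have h := add_mem (add_mem (add_mem (zsmul_mem (one_mem O3) a) (zsmul_mem h₁ b))
    (zsmul_mem h₂ c)) (zsmul_mem h₃ d)
  convert h using 1
  ext <;> simp [quatThree] <;> ring

theorem exists_eq_quatThree {x : ℍ[ℚ, -1, -3]} (hx : x ∈ O3) :
    ∃ a b c d : ℤ, x = quatThree a b c d := by
  induction hx using Subring.closure_induction with
  | mem x hx =>
    rcases hx with rfl | rfl | rfl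
    · exact ⟨0, 1, 0, 0, by ext <;> simp [quatThree]⟩
    · exact ⟨0, 0, 1, 0, by ext <;> simp [quatThree]⟩
    · exact ⟨0, 0, 0, 1, by ext <;> simp [quatThree]⟩
  | zero => exact ⟨0, 0, 0, 0, by ext <;> simp [quatThree]⟩
  | one => exact ⟨1, 0, 0, 0, quatThree_one⟩
  | add x y _ _ hx hy =>
    obtain ⟨a, b, c, d, rfl⟩ := hx
    obtain ⟨a', b', c', d', rfl⟩ := hy
    exact ⟨_, _, _, _, quatThree_add ..⟩
  | neg x _ hx =>
    obtain ⟨a, b, c, d, rfl⟩ := hx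
    exact ⟨-a, -b, -c, -d, by ext <;> simp [quatThree] <;> ring⟩
  | mul x y _ _ hx hy =>
    obtain ⟨a, b, c, d, rfl⟩ := hx
    obtain ⟨a', b', c', d', rfl⟩ := hy
    exact ⟨_, _, _, _, quatThree_mul ..⟩

theorem reducedNorm_quatThree (a b c d : ℤ) : reducedNorm (quatThree a b c d) =
    ((a ^ 2 + a * c + c ^ 2 + b ^ 2 + b * d + d ^ 2 : ℤ) : ℚ) := by
  simp [reducedNorm, quatThree]; ring

theorem exists_int_reducedNorm_O3 (x : ℍ[ℚ, -1, -3]) (hx : x ∈ O3) :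
    ∃ n : ℤ, reducedNorm x = n := by
  obtain ⟨a, b, c, d, rfl⟩ := exists_eq_quatThree hx
  exact ⟨_, reducedNorm_quatThree a b c d⟩

theorem exists_reducedNorm_sub_lt_O3 (x : ℍ[ℚ, -1, -3]) :
    ∃ q ∈ O3, reducedNorm (x - q) < 1 := by
  obtain ⟨c, hc⟩ := exists_int_abs_sub_le_half (2 * x.imJ)
  obtain ⟨d, hd⟩ := exists_int_abs_sub_le_half (2 * x.imK)
  obtain ⟨a, ha⟩ := exists_int_abs_sub_le_half (x.re - c / 2)
  obtain ⟨b, hb⟩ := exists_int_abs_sub_le_half (x.imI - d / 2)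
  refine ⟨quatThree a b c d, quatThree_mem a b c d, ?_⟩
  have ha' := sq_le_sq' (abs_le.mp ha).1 (abs_le.mp ha).2
  have hb' := sq_le_sq' (abs_le.mp hb).1 (abs_le.mp hb).2
  have hc' := sq_le_sq' (abs_le.mp hc).1 (abs_le.mp hc).2
  have hd' := sq_le_sq' (abs_le.mp hd).1 (abs_le.mp hd).2
  simp only [reducedNorm, quatThree, QuaternionAlgebra.re_sub, QuaternionAlgebra.imI_sub,
    QuaternionAlgebra.imJ_sub, QuaternionAlgebra.imK_sub]
  linarith

/-- The function on quaternions inducing the reduction of `O3` modulo its maximal two-sided ideal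
over `3`, with values in `𝔽₉ = 𝔽₃[√-1]`. -/
def residueO3 (x : ℍ[ℚ, -1, -3]) : QuadraticAlgebra (ZMod 3) (-1) 0 :=
  ⟨(⌊x.re - 3 * x.imJ⌋ : ℤ), (⌊x.imI - 3 * x.imK⌋ : ℤ)⟩

theorem residueO3_quatThree (a b c d : ℤ) :
    residueO3 (quatThree a b c d) = ⟨((a - c : ℤ) : ZMod 3), ((b - d : ℤ) : ZMod 3)⟩ := by
  have h₁ : (quatThree a b c d).re - 3 * (quatThree a b c d).imJ = ((a - c : ℤ) : ℚ) := by
    simp only [quatThree]; push_cast; ring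
  have h₂ : (quatThree a b c d).imI - 3 * (quatThree a b c d).imK = ((b - d : ℤ) : ℚ) := by
    simp only [quatThree]; push_cast; ring
  rw [residueO3, h₁, h₂, Int.floor_intCast, Int.floor_intCast]

theorem residueO3_mul {x y : ℍ[ℚ, -1, -3]} (hx : x ∈ O3) (hy : y ∈ O3) :
    residueO3 (x * y) = residueO3 x * residueO3 y := by
  obtain ⟨a, b, c, d, rfl⟩ := exists_eq_quatThree hx
  obtain ⟨a', b', c', d', rfl⟩ := exists_eq_quatThree hy
  rw [quatThree_mul, residueO3_quatThree, residueO3_quatThree, residueO3_quatThree]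
  ext <;> (simp; grind)

theorem residueO3_add {x y : ℍ[ℚ, -1, -3]} (hx : x ∈ O3) (hy : y ∈ O3) :
    residueO3 (x + y) = residueO3 x + residueO3 y := by
  obtain ⟨a, b, c, d, rfl⟩ := exists_eq_quatThree hx
  obtain ⟨a', b', c', d', rfl⟩ := exists_eq_quatThree hy
  rw [quatThree_add, residueO3_quatThree, residueO3_quatThree, residueO3_quatThree]
  ext <;> (simp; ring)

theorem residueO3_one : residueO3 1 = 1 := by
  rw [quatThree_one, residueO3_quatThree]
  rfl

/-- The reduction of `O3` modulo its maximal two-sided ideal over `3`. -/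
def reductionO3 : O3 →+* QuadraticAlgebra (ZMod 3) (-1) 0 :=
  RingHom.mk' ⟨⟨fun x ↦ residueO3 x, residueO3_one⟩, fun x y ↦ residueO3_mul x.2 y.2⟩
    fun x y ↦ residueO3_add x.2 y.2

/-- The unit `i` of `O3`, of order `4`. -/
def quatThreeI : O3ˣ := unitOfMem (quatThree 0 1 0 0) (quatThree 0 (-1) 0 0)
  (quatThree_mem _ _ _ _) (quatThree_mem _ _ _ _) (by simp [quatThree_mul, quatThree_one])
  (by simp [quatThree_mul, quatThree_one])

/-- The unit `(1+j)/2` of `O3`, of order `6`. -/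
def quatThreeW : O3ˣ := unitOfMem (quatThree 0 0 1 0) (quatThree 1 0 (-1) 0)
  (quatThree_mem _ _ _ _) (quatThree_mem _ _ _ _) (by simp [quatThree_mul, quatThree_one])
  (by simp [quatThree_mul, quatThree_one])

theorem coe_quatThreeI : ((quatThreeI : O3) : ℍ[ℚ, -1, -3]) = quatThree 0 1 0 0 := rfl

theorem coe_quatThreeW : ((quatThreeW : O3) : ℍ[ℚ, -1, -3]) = quatThree 0 0 1 0 := rfl

theorem coe_quatThreeW_inv :
    ((↑quatThreeW⁻¹ : O3) : ℍ[ℚ, -1, -3]) = quatThree 1 0 (-1) 0 := rfl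

theorem abelianization_of_quatThreeW :
    Abelianization.of quatThreeW = Abelianization.of quatThreeI ^ 2 := by
  have h₁ : quatThreeI * quatThreeW = quatThreeW⁻¹ * quatThreeI := by
    ext1; ext1
    rw [Units.val_mul, Units.val_mul, Subring.coe_mul, Subring.coe_mul]
    simp [coe_quatThreeI, coe_quatThreeW, coe_quatThreeW_inv, quatThree_mul]
  have h₂ := abelianization_of_eq_of_semiconj h₁
  have h₃ : quatThreeW ^ 3 = quatThreeI ^ 2 := by
    ext1; ext1
    simp [pow_succ, coe_quatThreeI, coe_quatThreeW, quatThree_mul]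
  rw [← map_pow, ← h₃, map_pow, pow_succ, pow_two]
  nth_rewrite 3 [h₂]
  rw [map_inv, mul_inv_cancel, one_mul]

theorem exists_eq_quatThreeI_pow_mul (v : O3ˣ) :
    ∃ m n : ℕ, v = quatThreeI ^ m * quatThreeW ^ n := by
  obtain ⟨a, b, c, d, hv⟩ := exists_eq_quatThree (v : O3).2
  have hN := reducedNorm_unit (by norm_num) (by norm_num) exists_int_reducedNorm_O3 v
  rw [hv, reducedNorm_quatThree] at hN
  have hN' : a ^ 2 + a * c + c ^ 2 + b ^ 2 + b * d + d ^ 2 = 1 := by exact_mod_cast hN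
  have ha₁ : -1 ≤ a := by nlinarith [sq_nonneg (a + 2 * c), sq_nonneg (b + 2 * d)]
  have ha₂ : a ≤ 1 := by nlinarith [sq_nonneg (a + 2 * c), sq_nonneg (b + 2 * d)]
  have hb₁ : -1 ≤ b := by nlinarith [sq_nonneg (a + 2 * c), sq_nonneg (b + 2 * d)]
  have hb₂ : b ≤ 1 := by nlinarith [sq_nonneg (a + 2 * c), sq_nonneg (b + 2 * d)]
  have hc₁ : -1 ≤ c := by nlinarith [sq_nonneg (2 * a + c), sq_nonneg (2 * b + d)]
  have hc₂ : c ≤ 1 := by nlinarith [sq_nonneg (2 * a + c), sq_nonneg (2 * b + d)]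
  have hd₁ : -1 ≤ d := by nlinarith [sq_nonneg (2 * a + c), sq_nonneg (2 * b + d)]
  have hd₂ : d ≤ 1 := by nlinarith [sq_nonneg (2 * a + c), sq_nonneg (2 * b + d)]
  have key (m n : ℕ) (h : ((v : O3) : ℍ[ℚ, -1, -3]) =
      ((quatThreeI : O3) : ℍ[ℚ, -1, -3]) ^ m * ((quatThreeW : O3) : ℍ[ℚ, -1, -3]) ^ n) :
      ∃ m n : ℕ, v = quatThreeI ^ m * quatThreeW ^ n := by
    refine ⟨m, n, ?_⟩
    ext1; ext1
    simpa using h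
  rw [coe_quatThreeI, coe_quatThreeW, hv] at key
  clear hN
  interval_cases a <;> interval_cases b <;> interval_cases c <;> interval_cases d <;>
    first
    | (exfalso; revert hN'; norm_num; done)
    | (refine key 0 0 ?_; rw [pow_zero, pow_zero, mul_one, quatThree_one]; done)
    | (refine key 0 1 ?_; simp; done)
    | (refine key 0 2 ?_; simp [pow_succ, quatThree_mul]; done)
    | (refine key 0 3 ?_; simp [pow_succ, quatThree_mul]; done)
    | (refine key 0 4 ?_; simp [pow_succ, quatThree_mul]; done)
    | (refine key 0 5 ?_; simp [pow_succ, quatThree_mul]; done)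
    | (refine key 1 0 ?_; simp; done)
    | (refine key 1 1 ?_; simp [quatThree_mul]; done)
    | (refine key 1 2 ?_; simp [pow_succ, quatThree_mul]; done)
    | (refine key 1 3 ?_; simp [pow_succ, quatThree_mul]; done)
    | (refine key 1 4 ?_; simp [pow_succ, quatThree_mul]; done)
    | (refine key 1 5 ?_; simp [pow_succ, quatThree_mul]; done)

theorem abelianization_of_mem_zpowers_O3 (v : O3ˣ) :
    Abelianization.of v ∈ Subgroup.zpowers (Abelianization.of quatThreeI) := by
  obtain ⟨m, n, rfl⟩ := exists_eq_quatThreeI_pow_mul v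
  have h := Subgroup.mem_zpowers (Abelianization.of quatThreeI)
  rw [map_mul, map_pow, map_pow, abelianization_of_quatThreeW]
  exact mul_mem (pow_mem h m) (pow_mem (pow_mem h 2) n)

theorem abelianization_GL2_O3 :
    Nonempty (Abelianization (Matrix (Fin 2) (Fin 2) O3)ˣ ≃* Multiplicative (ZMod 4)) := by
  refine abelianization_GL2_quaternionOrder (by norm_num) (by norm_num) O3
    exists_int_reducedNorm_O3 exists_reducedNorm_sub_lt_O3 (w := quatThreeW) ?_ quatThreeI ?_
    abelianization_of_mem_zpowers_O3 reductionO3 ?_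
  · refine ⟨quatThreeW⁻¹, Subtype.ext ?_⟩
    rw [AddSubgroupClass.coe_sub, Subring.coe_one, coe_quatThreeW, coe_quatThreeW_inv]
    ext <;> simp [quatThree] <;> norm_num
  · ext1; ext1
    simp [pow_succ, coe_quatThreeI, quatThree_mul, quatThree_one]
  · have : reductionO3 (quatThreeI : O3) = ⟨0, 1⟩ := residueO3_quatThree 0 1 0 0
    rw [this, orderOf_eq_iff (by norm_num)]
    refine ⟨by decide, fun m hm hpos ↦ ?_⟩
    interval_cases m <;> decide

end DiscriminantThree

section DiscriminantFive

/-- The quaternion with coordinates `a, b, c, d` in the basis `1, i, (1+i+j)/2, (2+i-k)/4`. -/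
def quatFive (a b c d : ℤ) : ℍ[ℚ, -2, -5] :=
  ⟨a + c / 2 + d / 2, b + c / 2 + d / 4, c / 2, -(d / 4)⟩

theorem quatFive_mul (a b c d a' b' c' d' : ℤ) :
    quatFive a b c d * quatFive a' b' c' d' = quatFive
      (a * a' - 2 * b * b' - b * d' - 2 * c * b' - 2 * c * c' - c * d' - d * d')
      (a * b' + b * a' + b * c' - c * d' + d * b' + d * c')
      (a * c' + b * d' + c * a' + c * c' + c * d' - d * b')
      (a * d' - 2 * b * c' + 2 * c * b' + c * d' + d * a' + d * d') := by
  ext <;> simp [quatFive] <;> ring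

theorem quatFive_one : 1 = quatFive 1 0 0 0 := by
  ext <;> simp [quatFive]

theorem quatFive_add (a b c d a' b' c' d' : ℤ) :
    quatFive a b c d + quatFive a' b' c' d' = quatFive (a + a') (b + b') (c + c') (d + d') := by
  ext <;> simp [quatFive] <;> ring

theorem quatFive_mem (a b c d : ℤ) : quatFive a b c d ∈ O5 := by
  have h₁ : (⟨1/2, 1/2, 1/2, 0⟩ : ℍ[ℚ, -2, -5]) ∈ O5 := Subring.subset_closure (by simp)
  have h₂ : (⟨1/2, 1/4, 0, -(1/4)⟩ : ℍ[ℚ, -2, -5]) ∈ O5 := Subring.subset_closure (by simp)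
  have h₃ : (⟨1/2, 3/4, 0, 1/4⟩ : ℍ[ℚ, -2, -5]) ∈ O5 := Subring.subset_closure (by simp)
  have h := add_mem (add_mem (add_mem (zsmul_mem (one_mem O5) (a - b)) (zsmul_mem h₁ c))
    (zsmul_mem h₂ (b + d))) (zsmul_mem h₃ b)
  convert h using 1
  ext <;> simp [quatFive] <;> ring

theorem exists_eq_quatFive {x : ℍ[ℚ, -2, -5]} (hx : x ∈ O5) :
    ∃ a b c d : ℤ, x = quatFive a b c d := by
  induction hx using Subring.closure_induction with
  | mem x hx =>
    rcases hx with rfl | rfl | rfl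
    · exact ⟨0, 0, 1, 0, by ext <;> simp [quatFive]⟩
    · exact ⟨0, 0, 0, 1, by ext <;> simp [quatFive]⟩
    · exact ⟨1, 1, 0, -1, by ext <;> simp [quatFive] <;> norm_num⟩
  | zero => exact ⟨0, 0, 0, 0, by ext <;> simp [quatFive]⟩
  | one => exact ⟨1, 0, 0, 0, quatFive_one⟩
  | add x y _ _ hx hy =>
    obtain ⟨a, b, c, d, rfl⟩ := hx
    obtain ⟨a', b', c', d', rfl⟩ := hy
    exact ⟨_, _, _, _, quatFive_add ..⟩
  | neg x _ hx =>
    obtain ⟨a, b, c, d, rfl⟩ := hx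
    exact ⟨-a, -b, -c, -d, by ext <;> simp [quatFive] <;> ring⟩
  | mul x y _ _ hx hy =>
    obtain ⟨a, b, c, d, rfl⟩ := hx
    obtain ⟨a', b', c', d', rfl⟩ := hy
    exact ⟨_, _, _, _, quatFive_mul ..⟩

theorem reducedNorm_quatFive (a b c d : ℤ) : reducedNorm (quatFive a b c d) =
    ((a ^ 2 + a * c + a * d + 2 * b ^ 2 + 2 * b * c + b * d + 2 * c ^ 2 + c * d + d ^ 2 : ℤ) :
      ℚ) := by
  simp [reducedNorm, quatFive]; ring

theorem exists_int_reducedNorm_O5 (x : ℍ[ℚ, -2, -5]) (hx : x ∈ O5) :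
    ∃ n : ℤ, reducedNorm x = n := by
  obtain ⟨a, b, c, d, rfl⟩ := exists_eq_quatFive hx
  exact ⟨_, reducedNorm_quatFive a b c d⟩

theorem exists_int_sq_half_sub_eq {x : ℚ} :
    ∃ n : ℤ, (x - 1 / 2 - n) ^ 2 = (1 / 2 - |x|) ^ 2 := by
  rcases le_total 0 x with h | h
  · exact ⟨0, by rw [abs_of_nonneg h]; push_cast; ring⟩
  · exact ⟨-1, by rw [abs_of_nonpos h]; push_cast; ring⟩

/-- A point of the box `[0, 1/2]³` is close to one of two opposite vertices, for the quadratic form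
`5t² + r² + 2s²`. -/
theorem lt_or_lt_of_mem_box {t r s : ℚ} (ht₀ : 0 ≤ t) (ht₁ : t ≤ 1 / 2) (hr₀ : 0 ≤ r)
    (hr₁ : r ≤ 1 / 2) (hs₀ : 0 ≤ s) (hs₁ : s ≤ 1 / 2) :
    5 * t ^ 2 + r ^ 2 + 2 * s ^ 2 < 27 / 32 ∨
      5 * (1 / 2 - t) ^ 2 + (1 / 2 - r) ^ 2 + 2 * (1 / 2 - s) ^ 2 < 27 / 32 := by
  by_contra! h
  obtain ⟨h₁, h₂⟩ := h
  have hr : r ^ 2 ≤ r / 2 := by nlinarith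
  have hs : s ^ 2 ≤ s / 2 := by nlinarith
  have ht : 0 ≤ t ^ 2 - t / 2 + 1 / 32 := by nlinarith
  rcases le_total t (1 / 4) with h | h
  · have : t ≤ 1 / 10 := by nlinarith
    nlinarith
  · have : 4 / 10 ≤ t := by nlinarith
    nlinarith

theorem exists_reducedNorm_sub_lt_O5 (x : ℍ[ℚ, -2, -5]) :
    ∃ q ∈ O5, reducedNorm (x - q) < 1 := by
  obtain ⟨d, hd⟩ := exists_int_abs_sub_le_half (-4 * x.imK)
  have hd' := sq_le_sq' (abs_le.mp hd).1 (abs_le.mp hd).2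
  suffices h : ∃ a b c : ℤ, 5 * (x.imJ - c / 2) ^ 2 + (x.re - d / 2 - c / 2 - a) ^ 2 +
      2 * (x.imI - d / 4 - c / 2 - b) ^ 2 < 27 / 32 by
    obtain ⟨a, b, c, h⟩ := h
    refine ⟨quatFive a b c d, quatFive_mem a b c d, ?_⟩
    simp only [reducedNorm, quatFive, QuaternionAlgebra.re_sub, QuaternionAlgebra.imI_sub,
      QuaternionAlgebra.imJ_sub, QuaternionAlgebra.imK_sub]
    linarith
  let c : ℤ := ⌊2 * x.imJ⌋
  have hc₀ : (c : ℚ) ≤ 2 * x.imJ := Int.floor_le _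
  have hc₁ : 2 * x.imJ < c + 1 := Int.lt_floor_add_one _
  obtain ⟨a, ha⟩ := exists_int_abs_sub_le_half (x.re - d / 2 - c / 2)
  obtain ⟨b, hb⟩ := exists_int_abs_sub_le_half (x.imI - d / 4 - c / 2)
  rcases lt_or_lt_of_mem_box (t := x.imJ - c / 2) (by linarith) (by linarith) (abs_nonneg _) ha
    (abs_nonneg _) hb with h | h
  · rw [sq_abs, sq_abs] at h
    exact ⟨a, b, c, h⟩
  · obtain ⟨m, hm⟩ := exists_int_sq_half_sub_eq (x := x.re - d / 2 - c / 2 - a)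
    obtain ⟨n, hn⟩ := exists_int_sq_half_sub_eq (x := x.imI - d / 4 - c / 2 - b)
    refine ⟨a + m, b + n, c + 1, ?_⟩
    rw [← hm, ← hn] at h
    push_cast
    linarith

/-- The function on quaternions inducing the reduction of `O5` modulo its maximal two-sided ideal
over `5`, with values in `𝔽₂₅ = 𝔽₅[√-2]`. -/
def residueO5 (x : ℍ[ℚ, -2, -5]) : QuadraticAlgebra (ZMod 5) (-2) 0 :=
  ⟨(⌊x.re + 5 * x.imJ - 10 * x.imK⌋ : ℤ), (⌊x.imI + 5 * x.imJ - 15 * x.imK⌋ : ℤ)⟩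

theorem residueO5_quatFive (a b c d : ℤ) :
    residueO5 (quatFive a b c d) =
      ⟨((a + 3 * c + 3 * d : ℤ) : ZMod 5), ((b + 3 * c + 4 * d : ℤ) : ZMod 5)⟩ := by
  have h₁ : (quatFive a b c d).re + 5 * (quatFive a b c d).imJ - 10 * (quatFive a b c d).imK =
      ((a + 3 * c + 3 * d : ℤ) : ℚ) := by
    simp only [quatFive]; push_cast; ring
  have h₂ : (quatFive a b c d).imI + 5 * (quatFive a b c d).imJ - 15 * (quatFive a b c d).imK =
      ((b + 3 * c + 4 * d : ℤ) : ℚ) := by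
    simp only [quatFive]; push_cast; ring
  rw [residueO5, h₁, h₂, Int.floor_intCast, Int.floor_intCast]

theorem residueO5_mul {x y : ℍ[ℚ, -2, -5]} (hx : x ∈ O5) (hy : y ∈ O5) :
    residueO5 (x * y) = residueO5 x * residueO5 y := by
  obtain ⟨a, b, c, d, rfl⟩ := exists_eq_quatFive hx
  obtain ⟨a', b', c', d', rfl⟩ := exists_eq_quatFive hy
  rw [quatFive_mul, residueO5_quatFive, residueO5_quatFive, residueO5_quatFive]
  ext <;> (simp; grind)

theorem residueO5_add {x y : ℍ[ℚ, -2, -5]} (hx : x ∈ O5) (hy : y ∈ O5) :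
    residueO5 (x + y) = residueO5 x + residueO5 y := by
  obtain ⟨a, b, c, d, rfl⟩ := exists_eq_quatFive hx
  obtain ⟨a', b', c', d', rfl⟩ := exists_eq_quatFive hy
  rw [quatFive_add, residueO5_quatFive, residueO5_quatFive, residueO5_quatFive]
  ext <;> (simp; ring)

theorem residueO5_one : residueO5 1 = 1 := by
  rw [quatFive_one, residueO5_quatFive]
  rfl

/-- The reduction of `O5` modulo its maximal two-sided ideal over `5`. -/
def reductionO5 : O5 →+* QuadraticAlgebra (ZMod 5) (-2) 0 :=
  RingHom.mk' ⟨⟨fun x ↦ residueO5 x, residueO5_one⟩, fun x y ↦ residueO5_mul x.2 y.2⟩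
    fun x y ↦ residueO5_add x.2 y.2

/-- The unit `(2+i-k)/4` of `O5`, of order `6`. -/
def quatFiveW : O5ˣ := unitOfMem (quatFive 0 0 0 1) (quatFive 1 0 0 (-1))
  (quatFive_mem _ _ _ _) (quatFive_mem _ _ _ _) (by simp [quatFive_mul, quatFive_one])
  (by simp [quatFive_mul, quatFive_one])

theorem coe_quatFiveW : ((quatFiveW : O5) : ℍ[ℚ, -2, -5]) = quatFive 0 0 0 1 := rfl

theorem coe_quatFiveW_inv :
    ((↑quatFiveW⁻¹ : O5) : ℍ[ℚ, -2, -5]) = quatFive 1 0 0 (-1) := rfl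

theorem exists_eq_quatFiveW_pow (v : O5ˣ) : ∃ n : ℕ, v = quatFiveW ^ n := by
  obtain ⟨a, b, c, d, hv⟩ := exists_eq_quatFive (v : O5).2
  have hN := reducedNorm_unit (by norm_num) (by norm_num) exists_int_reducedNorm_O5 v
  rw [hv, reducedNorm_quatFive] at hN
  have hN' : (4 * a + 2 * c + 2 * d) ^ 2 + 2 * (4 * b + 2 * c + d) ^ 2 + 20 * c ^ 2 +
      10 * d ^ 2 = 16 := by
    have : a ^ 2 + a * c + a * d + 2 * b ^ 2 + 2 * b * c + b * d + 2 * c ^ 2 + c * d + d ^ 2 =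
      1 := by exact_mod_cast hN
    linarith
  have h₁ := sq_nonneg (4 * a + 2 * c + 2 * d)
  have h₂ := sq_nonneg (4 * b + 2 * c + d)
  have hc₁ : -1 < c := by nlinarith
  have hc₂ : c < 1 := by nlinarith
  have hd₁ : -1 ≤ d := by nlinarith
  have hd₂ : d ≤ 1 := by nlinarith
  obtain rfl : c = 0 := by lia
  have ha := abs_le_of_sq_le_sq' (show (4 * a + 2 * 0 + 2 * d) ^ 2 ≤ 4 ^ 2 by nlinarith)
    (by norm_num)
  have hb := abs_le_of_sq_le_sq' (show (4 * b + 2 * 0 + d) ^ 2 ≤ 3 ^ 2 by nlinarith)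
    (by norm_num)
  have ha₁ : -1 ≤ a := by lia
  have ha₂ : a ≤ 1 := by lia
  have hb₁ : -1 ≤ b := by lia
  have hb₂ : b ≤ 1 := by lia
  have key (n : ℕ) (h : ((v : O5) : ℍ[ℚ, -2, -5]) =
      ((quatFiveW : O5) : ℍ[ℚ, -2, -5]) ^ n) : ∃ n : ℕ, v = quatFiveW ^ n := by
    refine ⟨n, ?_⟩
    ext1; ext1
    simpa using h
  rw [coe_quatFiveW, hv] at key
  clear hN ha hb h₁ h₂
  interval_cases a <;> interval_cases b <;> interval_cases d <;>
    first
    | (exfalso; revert hN'; norm_num; done)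
    | (refine key 0 ?_; simp [quatFive_one]; done)
    | (refine key 1 ?_; simp; done)
    | (refine key 2 ?_; simp [pow_succ, quatFive_mul]; done)
    | (refine key 3 ?_; simp [pow_succ, quatFive_mul]; done)
    | (refine key 4 ?_; simp [pow_succ, quatFive_mul]; done)
    | (refine key 5 ?_; simp [pow_succ, quatFive_mul]; done)

theorem abelianization_GL2_O5 :
    Nonempty (Abelianization (Matrix (Fin 2) (Fin 2) O5)ˣ ≃* Multiplicative (ZMod 6)) := by
  refine abelianization_GL2_quaternionOrder (by norm_num) (by norm_num) O5
    exists_int_reducedNorm_O5 exists_reducedNorm_sub_lt_O5 (w := quatFiveW) ?_ quatFiveW ?_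
    (fun v ↦ ?_) reductionO5 ?_
  · refine ⟨quatFiveW⁻¹, Subtype.ext ?_⟩
    rw [AddSubgroupClass.coe_sub, Subring.coe_one, coe_quatFiveW, coe_quatFiveW_inv]
    ext <;> simp [quatFive] <;> norm_num
  · ext1; ext1
    simp [pow_succ, coe_quatFiveW, quatFive_mul, quatFive_one]
  · obtain ⟨n, rfl⟩ := exists_eq_quatFiveW_pow v
    rw [map_pow]
    exact pow_mem (Subgroup.mem_zpowers _) n
  · have : reductionO5 (quatFiveW : O5) = ⟨3, 4⟩ := residueO5_quatFive 0 0 0 1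
    rw [this, orderOf_eq_iff (by norm_num)]
    refine ⟨by decide, fun m hm hpos ↦ ?_⟩
    interval_cases m <;> decide

end DiscriminantFive

/-- The abelianizations of `GL₂(O₂)`, `GL₂(O₃)` and `GL₂(O₅)` are cyclic
of orders `3`, `4` and `6` respectively. -/
theorem abelianization_GL2_maximal_quaternion_orders :
    Nonempty (Abelianization (Matrix (Fin 2) (Fin 2) ↥O2)ˣ ≃* Multiplicative (ZMod 3)) ∧
    Nonempty (Abelianization (Matrix (Fin 2) (Fin 2) ↥O3)ˣ ≃* Multiplicative (ZMod 4)) ∧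
    Nonempty (Abelianization (Matrix (Fin 2) (Fin 2) ↥O5)ˣ ≃* Multiplicative (ZMod 6)) :=
  ⟨abelianization_GL2_O2, abelianization_GL2_O3, abelianization_GL2_O5⟩
end

section
/- Let O be an order in a finite-dimensional semisimple ℚ-algebra A. Then the torsion-free rank (ℤ-module rank) of the abelianization of the unit group Oˣ is at least the torsion-free rank of the unit group of the center of O, i.e. rank_ℤ((Oˣ)^{ab}) ≥ rank_ℤ((Z(O))ˣ). -/
set_option synthInstance.maxHeartbeats 400000
set_option maxHeartbeats 800000

open scoped TensorProduct

theorem eq_zero_of_sq_eq_zero_of_forall_commute {A : Type*} [Ring A] [IsSemisimpleRing A]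
    {z : A} (hz : ∀ x, Commute z x) (h : z ^ 2 = 0) : z = 0 := by
  obtain ⟨J, hJ⟩ := exists_isCompl (Ideal.span {z})
  obtain ⟨y, hy, j, hj, hyj⟩ : ∃ y ∈ Ideal.span {z}, ∃ j ∈ J, y + j = 1 :=
    Submodule.mem_sup.1 (hJ.sup_eq_top ▸ Submodule.mem_top)
  obtain ⟨a, rfl⟩ := Ideal.mem_span_singleton'.1 hy
  have hzj : z * j = 0 := by
    refine (Submodule.disjoint_def.1 hJ.disjoint) _ ?_ (J.smul_mem z hj)
    rw [(hz j).eq]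
    exact Ideal.mul_mem_left _ _ (Ideal.mem_span_singleton_self z)
  calc z = z * (a * z + j) := by rw [hyj, mul_one]
    _ = a * z ^ 2 := by rw [mul_add, hzj, add_zero, ← mul_assoc, (hz a).eq, mul_assoc, sq]
    _ = 0 := by rw [h, mul_zero]

theorem Subalgebra.isReduced_center (k A : Type*) [CommRing k] [Ring A] [Algebra k A]
    [IsSemisimpleRing A] : IsReduced (Subalgebra.center k A) := by
  refine (isReduced_iff_pow_one_lt 2 one_lt_two).2 fun z hz ↦ Subtype.ext ?_
  exact eq_zero_of_sq_eq_zero_of_forall_commute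
    (fun x ↦ ((Subalgebra.mem_center_iff.1 z.2 x).symm : (z : A) * x = x * z))
    (by simpa using congrArg Subtype.val hz)

section

variable {R A : Type*} [CommRing R] [Ring A] [Algebra R A]

/-- The determinant of left multiplication modulo a maximal ideal of the base ring. -/
noncomputable def Ideal.detLeftMul (A : Type*) [Ring A] [Algebra R A] (m : Ideal R) :
    A →* R ⧸ m :=
  LinearMap.det.comp <|
    ((Module.End.baseChangeHom R (R ⧸ m) A).comp (Algebra.lmul R A)).toRingHom.toMonoidHom

theorem Ideal.detLeftMul_algebraMap (m : Ideal R) [hm : m.IsMaximal] (z : R) :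
    m.detLeftMul A (algebraMap R A z) =
      (Ideal.Quotient.mk m z) ^ Module.finrank (R ⧸ m) ((R ⧸ m) ⊗[R] A) := by
  let _ := Ideal.Quotient.field m
  have : (Algebra.lmul R A (algebraMap R A z)).baseChange (R ⧸ m) =
      (Ideal.Quotient.mk m z) • LinearMap.id := by
    rw [AlgHom.commutes, Algebra.algebraMap_eq_smul_one, LinearMap.baseChange_smul,
      Module.End.one_eq_id, LinearMap.baseChange_id]
    ext
    simp [Algebra.smul_def]
  change LinearMap.det ((Algebra.lmul R A (algebraMap R A z)).baseChange (R ⧸ m)) = _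
  rw [this, LinearMap.det_smul, LinearMap.det_id, mul_one]

variable [Module.Finite R A] [FaithfulSMul R A]

variable (A) in
theorem Ideal.nontrivial_quotient_tensorProduct (m : Ideal R) [hm : m.IsMaximal] :
    Nontrivial ((R ⧸ m) ⊗[R] A) := by
  have : Nontrivial (A ⧸ (m • (⊤ : Submodule R A))) := by
    refine Submodule.Quotient.nontrivial_iff.2 fun h ↦ hm.ne_top ?_
    obtain ⟨r, hr, hr0⟩ := Submodule.exists_sub_one_mem_and_smul_eq_zero_of_fg_of_le_smul m
      (⊤ : Submodule R A) Module.Finite.fg_top h.ge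
    have : r = 0 := FaithfulSMul.eq_of_smul_eq_smul (α := A) fun a ↦ by
      rw [hr0 a trivial, zero_smul]
    rw [Ideal.eq_top_iff_one]
    simpa [this] using hr
  exact (TensorProduct.quotTensorEquivQuotSMul A m).toEquiv.nontrivial

theorem exists_pow_eq_one_of_mem_commutator [IsArtinianRing R] [IsReduced R] {u : Aˣ}
    (hu : u ∈ commutator Aˣ) {z : R} (hz : algebraMap R A z = u) :
    ∃ n : ℕ, 0 < n ∧ z ^ n = 1 := by
  classical
  have := Fintype.ofFinite (MaximalSpectrum R)
  let d (m : MaximalSpectrum R) : ℕ :=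
    Module.finrank (R ⧸ m.asIdeal) ((R ⧸ m.asIdeal) ⊗[R] A)
  have hd m : 0 < d m := by
    have := m.isMaximal
    let _ := Ideal.Quotient.field m.asIdeal
    have := m.asIdeal.nontrivial_quotient_tensorProduct A
    exact Module.finrank_pos
  have hpow m : z ^ d m - 1 ∈ m.asIdeal := by
    have := m.isMaximal
    have h1 : Units.map (m.asIdeal.detLeftMul A) u = 1 :=
      MonoidHom.mem_ker.1 (Abelianization.commutator_subset_ker _ hu)
    have h2 := congrArg Units.val h1
    rw [Units.coe_map, ← hz] at h2
    have h3 := m.asIdeal.detLeftMul_algebraMap (A := A) z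
    rw [← Ideal.Quotient.eq_zero_iff_mem, map_sub, map_pow, map_one, sub_eq_zero]
    exact h3.symm.trans h2
  refine ⟨∏ m, d m, Finset.prod_pos fun m _ ↦ hd m, sub_eq_zero.1 ?_⟩
  have h : z ^ (∏ m, d m) - 1 ∈ nilradical R := by
    rw [nilradical_eq_sInf, Ideal.mem_sInf]
    intro p (hp : p.IsPrime)
    let m : MaximalSpectrum R := ⟨p, inferInstance⟩
    obtain ⟨k, hk⟩ := Finset.dvd_prod_of_mem d (Finset.mem_univ m)
    rw [hk]
    exact p.mem_of_dvd (pow_one_sub_dvd_pow_mul_sub_one z (d m) k) (hpow m)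
  rwa [nilradical_eq_zero, Ideal.zero_eq_bot, Ideal.mem_bot] at h

end

theorem AddMonoidHom.rank_le_of_ker_le_torsion.{u} {M N : Type u} [AddCommGroup M] [AddCommGroup N]
    {f : M →+ N} (hf : ∀ x, f x = 0 → ∃ n : ℕ, 0 < n ∧ n • x = 0) :
    Module.rank ℤ M ≤ Module.rank ℤ N := by
  let g := f.toIntLinearMap
  have hg : LinearMap.ker g ≤ Submodule.torsion ℤ M := fun x hx ↦ by
    obtain ⟨n, hn, hnx⟩ := hf x hx
    exact ⟨⟨n, mem_nonZeroDivisors_of_ne_zero (by exact_mod_cast hn.ne')⟩, by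
      simpa [Submonoid.smul_def] using hnx⟩
  rw [← rank_quotient_eq_of_le_torsion hg]
  exact LinearMap.rank_le_of_injective ((LinearMap.ker g).liftQ g le_rfl)
    (LinearMap.ker_eq_bot.1 (Submodule.ker_liftQ_eq_bot _ _ _ le_rfl))

/-- Let `O` be an order in a finite-dimensional semisimple `ℚ`-algebra
`A`. Then the torsion-free rank of `(Oˣ)ᵃᵇ` is at least the torsion-free rank of the unit
group of the center of `O`. -/
theorem rank_abelianization_units_ge_rank_center_units
    (A : Type*) [Ring A] [Algebra ℚ A] [FiniteDimensional ℚ A] [IsSemisimpleRing A]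
    (O : Subring A) (hfg : Module.Finite ℤ ↥O)
    (hspan : Submodule.span ℚ (O : Set A) = ⊤) :
    Module.rank ℤ (Additive (↥(Subring.center ↥O))ˣ) ≤
      Module.rank ℤ (Additive (Abelianization (↥O)ˣ)) := by
  have hcenter (z : Subring.center O) : ((z : O) : A) ∈ Subalgebra.center ℚ A := by
    have hle : Submodule.span ℚ (O : Set A) ≤
        Subalgebra.toSubmodule (Subalgebra.centralizer ℚ {((z : O) : A)}) :=
      Submodule.span_le.2 fun x hx ↦ (Subalgebra.mem_centralizer_iff ℚ).2 fun y hy ↦ by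
        rw [Set.mem_singleton_iff.1 hy]
        exact congrArg Subtype.val (Subring.mem_center_iff.1 z.2 ⟨x, hx⟩).symm
    refine Subalgebra.mem_center_iff.2 fun x ↦ ?_
    have hx := hle (hspan ▸ Submodule.mem_top : x ∈ _)
    exact ((Subalgebra.mem_centralizer_iff ℚ).1 hx _ rfl).symm
  have := Subalgebra.isReduced_center ℚ A
  have : IsArtinianRing (Subalgebra.center ℚ A) := IsArtinianRing.of_finite ℚ _
  let _ : Algebra (Subalgebra.center ℚ A) A :=
    (Subalgebra.center ℚ A).val.toRingHom.toAlgebra' fun z x ↦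
      (Subalgebra.mem_center_iff.1 z.2 x).symm
  have : @IsScalarTower ℚ (Subalgebra.center ℚ A) A _ Algebra.toSMul _ :=
    .of_algebraMap_eq fun _ ↦ rfl
  have : @FaithfulSMul (Subalgebra.center ℚ A) A Algebra.toSMul :=
    (faithfulSMul_iff_algebraMap_injective _ _).2 Subtype.val_injective
  have : @Module.Finite (Subalgebra.center ℚ A) A _ _ Algebra.toModule :=
    Module.Finite.of_restrictScalars_finite ℚ _ _
  let f : (Subring.center O)ˣ →* Abelianization Oˣ :=
    Abelianization.of.comp (Units.map (Subring.center O).subtype)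
  refine AddMonoidHom.rank_le_of_ker_le_torsion (f := f.toAdditive) ?_
  intro u hu
  have hmem : Units.map (Subring.center O).subtype u.toMul ∈ commutator Oˣ :=
    (QuotientGroup.eq_one_iff _).1 hu
  have hmem' : Units.map (O.subtype : O →* A) (Units.map (Subring.center O).subtype u.toMul) ∈
      commutator Aˣ := by
    have : commutator Oˣ ≤ (commutator Aˣ).comap (Units.map (O.subtype : O →* A)) := by
      rw [← Subgroup.map_le_iff_le_comap, map_commutator_eq]
      exact Subgroup.commutator_mono le_top le_top
    exact this hmem
  obtain ⟨n, hn, h⟩ := exists_pow_eq_one_of_mem_commutator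
    (z := (⟨_, hcenter u.toMul.val⟩ : Subalgebra.center ℚ A)) hmem' rfl
  refine ⟨n, hn, ?_⟩
  have h' : u.toMul ^ n = 1 := by
    ext
    simpa using congrArg Subtype.val h
  exact congrArg Additive.ofMul h'
end

section
/- Let G be a finite group. Then G is a cut group and admits an injective group homomorphism into the unit group of some finite-dimensional division ℚ-algebra if and only if G is isomorphic to one of the following groups: the trivial group, the cyclic groups C₂, C₃, C₄, C₆, the dicyclic group of order 12 (C₃ ⋊ C₄ with the C₄-action by inversion), the quaternion group Q₈ of order 8, or SL(2,3) (the group of 2×2 matrices of determinant 1 over the field with 3 elements). -/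
section CommRing

variable {R : Type*} [CommRing R] {K : Type} [Field K] [CharZero K]

omit [CharZero K] in
/-- In a reduced ring, every element `r` of the kernel of `φ` which is integral over `ℤ` is killed
by an element with nonzero integer image. -/
theorem exists_mul_eq_zero_of_map_eq_zero [IsReduced R] (φ : R →+* K) {r : R}
    (hr : IsIntegral ℤ r) (h : φ r = 0) :
    ∃ (s : R) (m : ℤ), m ≠ 0 ∧ φ s = m ∧ s * r = 0 := by
  obtain ⟨f, hf, hfr⟩ := hr
  obtain ⟨q, hq, hnd⟩ := f.exists_eq_pow_rootMultiplicity_mul_and_not_dvd hf.ne_zero 0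
  simp only [map_zero, sub_zero] at hq hnd
  set a := f.rootMultiplicity 0
  rw [Polynomial.X_dvd_iff] at hnd
  refine ⟨Polynomial.aeval r q, q.coeff 0, hnd, ?_, ?_⟩
  · have : φ (Polynomial.aeval r q) = q.eval₂ (Int.castRingHom K) (φ r) := by
      rw [Polynomial.aeval_def, Polynomial.hom_eval₂]
      congr 1
      exact RingHom.ext_int _ _
    rw [this, h]
    simp [Polynomial.eval₂_at_zero]
  · have h1 : r ^ a * Polynomial.aeval r q = 0 := by
      have h2 : Polynomial.aeval r f = 0 := hfr
      rw [hq] at h2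
      simpa using h2
    refine (IsNilpotent.eq_zero ⟨a + 1, ?_⟩ : Polynomial.aeval r q * r = 0)
    rw [mul_pow, pow_succ _ a, pow_succ r a]
    linear_combination (Polynomial.aeval r q ^ a * r) * h1

omit [CharZero K] in
theorem exists_mul_eq_zero_of_mem_ker [Module.Finite ℤ R] [IsReduced R] (φ : R →+* K) :
    ∃ (s : R) (m : ℤ), m ≠ 0 ∧ φ s = m ∧ ∀ r, φ r = 0 → s * r = 0 := by
  classical
  have : IsNoetherianRing R := IsNoetherianRing.of_finite ℤ R
  obtain ⟨t, ht⟩ := (isNoetherianRing_iff_ideal_fg R).1 this (RingHom.ker φ)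
  have h : ∀ r : t, ∃ (s : R) (m : ℤ), m ≠ 0 ∧ φ s = m ∧ s * r = 0 := fun r =>
    exists_mul_eq_zero_of_map_eq_zero φ (Algebra.IsIntegral.isIntegral _)
      (by
        have : (r : R) ∈ RingHom.ker φ := ht ▸ Ideal.subset_span r.2
        exact this)
  choose s m hm hs hsr using h
  refine ⟨∏ i, s i, ∏ i, m i, Finset.prod_ne_zero_iff.2 fun i _ => hm i, by simp [hs], ?_⟩
  intro r hr
  have hle : RingHom.ker φ ≤ (Ideal.span {∏ i, s i}).annihilator := by
    rw [← ht, Ideal.span_le]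
    intro x hx
    rw [SetLike.mem_coe, Submodule.mem_annihilator_span_singleton, smul_eq_mul, mul_comm]
    rw [← Finset.prod_erase_mul _ _ (Finset.mem_univ ⟨x, hx⟩), mul_assoc, hsr, mul_zero]
  have := hle (show r ∈ RingHom.ker φ from hr)
  rwa [Submodule.mem_annihilator_span_singleton, smul_eq_mul, mul_comm] at this

variable [Module.Finite ℤ R]

omit [CharZero K] in
theorem isIntegral_of_mem_range (φ : R →+* K) (r : R) : IsIntegral ℤ (φ r) :=
  (Algebra.IsIntegral.isIntegral (R := ℤ) r).map φ.toIntAlgHom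

theorem numberField_adjoin_range (φ : R →+* K) :
    NumberField (IntermediateField.adjoin ℚ (Set.range φ)) := by
  classical
  obtain ⟨t, ht⟩ := (inferInstance : Module.Finite ℤ R)
  have : IntermediateField.adjoin ℚ (Set.range φ) =
      IntermediateField.adjoin ℚ ((t.image φ : Finset K) : Set K) := by
    apply le_antisymm
    · rw [IntermediateField.adjoin_le_iff]
      rintro _ ⟨r, rfl⟩
      have hr : r ∈ Submodule.span ℤ (t : Set R) := ht ▸ Submodule.mem_top
      induction hr using Submodule.span_induction with
      | mem x hx =>
        exact IntermediateField.subset_adjoin _ _ (by simpa using ⟨x, hx, rfl⟩)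
      | zero => simp
      | add x y _ _ hx hy => rw [map_add]; exact add_mem hx hy
      | smul a x _ hx => rw [map_zsmul]; exact zsmul_mem hx a
    · exact IntermediateField.adjoin.mono _ _ _ (by simp)
  rw [this]
  have := IntermediateField.finiteDimensional_adjoin (K := ℚ)
    (S := ((t.image φ : Finset K) : Set K)) (fun x hx => by
      simp only [Finset.coe_image, Set.mem_image] at hx
      obtain ⟨r, _, rfl⟩ := hx
      exact (isIntegral_of_mem_range φ r).tower_top)
  exact { }

theorem exists_den (φ : R →+* K) {x : K} (hx : x ∈ IntermediateField.adjoin ℚ (Set.range φ)) :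
    ∃ d : ℤ, d ≠ 0 ∧ ∃ r, φ r = d * x := by
  have halg : ∀ x ∈ Set.range φ, IsAlgebraic ℚ x := by
    rintro _ ⟨r, rfl⟩
    exact (isIntegral_of_mem_range φ r).tower_top.isAlgebraic
  rw [← IntermediateField.mem_toSubalgebra,
    IntermediateField.adjoin_toSubalgebra_of_isAlgebraic halg] at hx
  induction hx using Algebra.adjoin_induction with
  | mem x hx => obtain ⟨r, rfl⟩ := hx; exact ⟨1, one_ne_zero, r, by simp⟩
  | algebraMap q =>
    refine ⟨q.den, by exact_mod_cast q.den_nz, (q.num : R), ?_⟩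
    rw [map_intCast, eq_ratCast]
    have := q.den_mul_eq_num
    exact_mod_cast (congrArg (Rat.cast : ℚ → K) this).symm
  | add x y _ _ hx hy =>
    obtain ⟨d, hd, r, hr⟩ := hx
    obtain ⟨e, he, s, hs⟩ := hy
    refine ⟨d * e, mul_ne_zero hd he, e * r + d * s, ?_⟩
    simp [hr, hs]; ring
  | mul x y _ _ hx hy =>
    obtain ⟨d, hd, r, hr⟩ := hx
    obtain ⟨e, he, s, hs⟩ := hy
    refine ⟨d * e, mul_ne_zero hd he, r * s, ?_⟩
    simp [hr, hs]; ring

open NumberField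

theorem exists_den_ringOfIntegers (φ : R →+* K) {F : IntermediateField ℚ K} [NumberField F]
    (hF : F ≤ IntermediateField.adjoin ℚ (Set.range φ)) :
    ∃ d : ℤ, d ≠ 0 ∧ ∀ x : 𝓞 F, ∃ r, φ r = d * ((x : F) : K) := by
  classical
  obtain ⟨t, ht⟩ := (inferInstance : Module.Finite ℤ (𝓞 F))
  choose d hd r hr using fun x : t => exists_den φ (hF ((x : 𝓞 F) : F).2)
  refine ⟨∏ i, d i, Finset.prod_ne_zero_iff.2 fun i _ => hd i, fun x => ?_⟩
  have hx : x ∈ Submodule.span ℤ (t : Set (𝓞 F)) := ht ▸ Submodule.mem_top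
  induction hx using Submodule.span_induction with
  | mem x hx =>
    refine ⟨(∏ i ∈ Finset.univ.erase ⟨x, hx⟩, d i : ℤ) * r ⟨x, hx⟩, ?_⟩
    rw [map_mul, hr, map_intCast, ← mul_assoc]
    congr 1
    rw [← Int.cast_mul, Finset.prod_erase_mul _ _ (Finset.mem_univ _)]
  | zero => exact ⟨0, by simp⟩
  | add x y _ _ hx hy =>
    obtain ⟨a, ha⟩ := hx
    obtain ⟨b, hb⟩ := hy
    exact ⟨a + b, by simp [ha, hb, mul_add]⟩
  | smul a x _ hx =>
    obtain ⟨b, hb⟩ := hx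
    exact ⟨a * b, by simp [hb]; ring⟩

theorem exists_unit_map_eq_pow [IsReduced R] (φ : R →+* K) {F : IntermediateField ℚ K}
    [NumberField F] (hF : F ≤ IntermediateField.adjoin ℚ (Set.range φ)) (w : (𝓞 F)ˣ) :
    ∃ N : ℕ, 0 < N ∧ ∃ u : Rˣ, φ u = (((w ^ N : (𝓞 F)ˣ) : 𝓞 F) : F) := by
  obtain ⟨s, m, hm, hs, hsr⟩ := exists_mul_eq_zero_of_mem_ker φ
  obtain ⟨d, hd, hden⟩ := exists_den_ringOfIntegers φ hF
  have hmd : ((m * d : ℤ) : 𝓞 F) ≠ 0 := by exact_mod_cast mul_ne_zero hm hd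
  set I : Ideal (𝓞 F) := Ideal.span {((m * d : ℤ) : 𝓞 F)} with hI
  have : Finite (𝓞 F ⧸ I) := Ideal.finiteQuotientOfFreeOfNeBot I (by simpa [hI] using hmd)
  set N := Nat.card (𝓞 F ⧸ I)ˣ
  have key : ∀ v : (𝓞 F)ˣ, ∃ z, (((v ^ N : (𝓞 F)ˣ) : 𝓞 F) : F) = (1 : K) + m * φ z := by
    intro v
    have h1 : (Units.map (Ideal.Quotient.mk I).toMonoidHom v) ^ N = 1 := pow_card_eq_one'
    rw [← map_pow] at h1
    have h2 : Ideal.Quotient.mk I ((v ^ N : (𝓞 F)ˣ) : 𝓞 F) = Ideal.Quotient.mk I 1 := by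
      rw [map_one]
      exact congrArg Units.val h1
    rw [Ideal.Quotient.eq, hI, Ideal.mem_span_singleton] at h2
    obtain ⟨a, ha⟩ := h2
    obtain ⟨z, hz⟩ := hden a
    refine ⟨z, ?_⟩
    rw [sub_eq_iff_eq_add'] at ha
    rw [hz, ha]
    simp only [map_add, map_mul, map_one, map_intCast, Int.cast_mul, AddMemClass.coe_add,
      MulMemClass.coe_mul, OneMemClass.coe_one, SubringClass.coe_intCast]
    ring
  obtain ⟨z, hz⟩ := key w
  obtain ⟨z', hz'⟩ := key w⁻¹
  have hmul : (1 + m * φ z) * (1 + m * φ z') = 1 := by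
    rw [← hz, ← hz', inv_pow]
    exact_mod_cast congrArg (fun x : 𝓞 F => ((x : F) : K)) (Units.mul_inv (w ^ N))
  have hm' : (m : K) ≠ 0 := by exact_mod_cast hm
  have hker : φ (z + z' + s * z * z') = 0 := by
    simp only [map_add, map_mul, hs]
    apply mul_left_cancel₀ hm'
    linear_combination hmul
  have hinv : (1 + s * z) * (1 + s * z') = 1 := by
    linear_combination hsr _ hker
  refine ⟨N, Nat.card_pos, Units.mkOfMulEqOne _ _ hinv, ?_⟩
  rw [hz]
  simp [hs]

theorem subsingleton_infinitePlace_of_isOfFinOrder {F : Type} [Field F] [NumberField F]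
    (h : ∀ w : (𝓞 F)ˣ, IsOfFinOrder w) : Subsingleton (InfinitePlace F) := by
  have hr : NumberField.Units.rank F = 0 := by
    rw [← NumberField.Units.unitLattice_rank]
    have htop : NumberField.Units.torsion F = ⊤ := (eq_top_iff).2 fun w _ => h w
    have : Subsingleton (Additive ((𝓞 F)ˣ ⧸ NumberField.Units.torsion F)) := by
      refine ⟨fun a b => ?_⟩
      induction a using QuotientGroup.induction_on with | H a => ?_
      induction b using QuotientGroup.induction_on with | H b => ?_
      exact QuotientGroup.eq.2 (htop ▸ Subgroup.mem_top _)
    have : Subsingleton (NumberField.Units.unitLattice F) :=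
      (NumberField.Units.logEmbeddingEquiv F).symm.toEquiv.subsingleton
    exact Module.finrank_zero_of_subsingleton
  rw [← Fintype.card_le_one_iff_subsingleton]
  rw [NumberField.Units.rank] at hr
  omega

/-- If a reduced commutative ring, finite over `ℤ`, has finitely many units, then the images of
its complex embeddings lie in fields with a single infinite place. -/
theorem eq_or_conj_eq_of_finite_units [IsReduced R] [Finite Rˣ] (φ : R →+* K) (α β : K →+* ℂ) :
    (∀ r, α (φ r) = β (φ r)) ∨ ∀ r, starRingEnd ℂ (α (φ r)) = β (φ r) := by
  have := numberField_adjoin_range φ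
  set F := IntermediateField.adjoin ℚ (Set.range φ) with hF
  have hfin : ∀ w : (𝓞 F)ˣ, IsOfFinOrder w := by
    intro w
    obtain ⟨N, hN, u, hu⟩ := exists_unit_map_eq_pow φ hF.le w
    obtain ⟨k, hk, huk⟩ := (isOfFinOrder_iff_pow_eq_one).1 (isOfFinOrder_of_finite u)
    refine isOfFinOrder_iff_pow_eq_one.2 ⟨N * k, Nat.mul_pos hN hk, ?_⟩
    have h1 : φ ((u ^ k : Rˣ) : R) = 1 := by rw [huk]; simp
    rw [Units.val_pow_eq_pow_val, map_pow, hu] at h1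
    rw [pow_mul]
    ext
    push_cast
    exact_mod_cast h1
  have hsub := subsingleton_infinitePlace_of_isOfFinOrder hfin
  have hmem : ∀ r, φ r ∈ F := fun r => IntermediateField.subset_adjoin _ _ ⟨r, rfl⟩
  have := InfinitePlace.mk_eq_iff.1
    (Subsingleton.elim (InfinitePlace.mk (α.comp F.val.toRingHom))
      (InfinitePlace.mk (β.comp F.val.toRingHom)))
  refine this.imp (fun h r => ?_) fun h r => ?_
  · exact RingHom.congr_fun h ⟨φ r, hmem r⟩
  · exact RingHom.congr_fun h ⟨φ r, hmem r⟩

end CommRing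

/-- The powers of a finite order matrix over an algebraically closed field of characteristic zero
have as traces the power sums of its eigenvalues, which are roots of unity. -/
theorem Matrix.exists_trace_pow_eq_sum {K : Type} [Field K] [IsAlgClosed K] [CharZero K] {d n : ℕ}
    (hn : n ≠ 0) (M : Matrix (Fin d) (Fin d) K) (hM : M ^ n = 1) :
    ∃ (ι : Type) (_ : Fintype ι) (ξ : ι → K), (∀ i, ξ i ^ n = 1) ∧
      ∀ k : ℕ, (M ^ k).trace = ∑ i, ξ i ^ k := by
  classical
  set f : Module.End K (Fin d → K) := Matrix.toLin' M with hf
  have hfn : f ^ n = 1 := by rw [hf, ← Matrix.toLin'_pow, hM, Matrix.toLin'_one]; rfl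
  have hss : f.IsSemisimple := by
    refine Module.End.isSemisimple_of_squarefree_aeval_eq_zero
      (p := (Polynomial.X ^ n - 1 : Polynomial K)) ?_ (by simp [hfn])
    exact ((Polynomial.X_pow_sub_one_separable_iff).2 (by exact_mod_cast hn)).squarefree
  have hintg : DirectSum.IsInternal (fun μ : K => f.eigenspace μ) :=
    DirectSum.isInternal_submodule_of_iSupIndep_of_iSup_eq_top f.eigenspaces_iSupIndep
      hss.iSup_eigenspace_eq_top
  let b := hintg.collectedBasis (fun μ => Module.finBasis K (f.eigenspace μ))
  let _ : Fintype _ := Module.Basis.fintypeIndexOfRankLtAleph0 b (Module.rank_lt_aleph0 K _)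
  have hb : ∀ i k, (f ^ k) (b i) = i.1 ^ k • b i := by
    intro i k
    have hmem : b i ∈ f.eigenspace i.1 := hintg.collectedBasis_mem _ i
    induction k with
    | zero => simp
    | succ k ih =>
      rw [pow_succ', Module.End.mul_apply, ih, map_smul, Module.End.mem_eigenspace_iff.1 hmem,
        smul_smul, pow_succ]
  refine ⟨(μ : K) × Fin (Module.finrank K (f.eigenspace μ)), ‹_›, Sigma.fst, fun i => ?_,
    fun k => ?_⟩
  · have h := hb i n
    rw [hfn, Module.End.one_apply] at h
    have h2 : (i.1 ^ n - 1) • b i = 0 := by rw [sub_smul, ← h, one_smul, sub_self]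
    rcases smul_eq_zero.1 h2 with h3 | h3
    · exact sub_eq_zero.1 h3
    · exact absurd h3 (b.ne_zero i)
  · have h1 : (M ^ k).trace = LinearMap.trace K _ (f ^ k) := by
      rw [hf, ← Matrix.toLin'_pow, Matrix.trace_toLin'_eq]
    rw [h1, LinearMap.trace_eq_matrix_trace K b, Matrix.trace]
    refine Finset.sum_congr rfl fun i _ => ?_
    simp [LinearMap.toMatrix_apply, hb]

open MonoidAlgebra in
/-- A nonzero element of the group algebra over an algebraically closed field is nonzero in some
full matrix algebra quotient. -/
theorem MonoidAlgebra.exists_surjective_matrix_ne_zero {K : Type} [Field K] [IsAlgClosed K]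
    [CharZero K] {G : Type*} [Group G] [Finite G] (z : MonoidAlgebra K G) (hz : z ≠ 0) :
    ∃ (d : ℕ) (_ : NeZero d) (ρ : MonoidAlgebra K G →ₐ[K] Matrix (Fin d) (Fin d) K),
      Function.Surjective ρ ∧ ρ z ≠ 0 := by
  have : NeZero (Nat.card G : K) := ⟨by exact_mod_cast Nat.card_pos.ne'⟩
  obtain ⟨n, d, hd, ⟨e⟩⟩ :=
    IsSemisimpleRing.exists_algEquiv_pi_matrix_of_isAlgClosed K (MonoidAlgebra K G)
  have h : e z ≠ 0 := by simpa using hz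
  obtain ⟨i, hi⟩ := Function.ne_iff.1 h
  refine ⟨d i, hd i, (Pi.evalAlgHom K _ i).comp e.toAlgHom, ?_, hi⟩
  exact (Function.surjective_eval i).comp e.surjective

theorem Matrix.exists_scalar_of_surjective {K : Type} [Field K] {A : Type*} [Ring A] [Algebra K A]
    {d : ℕ} [NeZero d] (ρ : A →ₐ[K] Matrix (Fin d) (Fin d) K) (hρ : Function.Surjective ρ)
    (z : A) (hz : ∀ a, z * a = a * z) : ∃ c : K, ρ z = algebraMap K _ c := by
  have : ρ z ∈ Set.range (Matrix.scalar (Fin d)) := by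
    refine Matrix.mem_range_scalar_of_commute_single fun i j _ => ?_
    obtain ⟨a, ha⟩ := hρ (Matrix.single i j 1)
    rw [← ha]
    change _ * _ = _ * _
    rw [← map_mul, ← map_mul, hz]
  obtain ⟨c, hc⟩ := this
  exact ⟨c, hc.symm⟩

section GroupRing

variable (K : Type) [Field K] {G : Type*} [Group G]

/-- The base change homomorphism from the integral group ring to the group algebra. -/
noncomputable abbrev intGroupRingMap : MonoidAlgebra ℤ G →+* MonoidAlgebra K G :=
  MonoidAlgebra.mapRingHom G (Int.castRingHom K)

theorem intGroupRingMap_injective [CharZero K] :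
    Function.Injective (intGroupRingMap K (G := G)) := by
  intro a b h
  ext g
  have := congrArg (fun x => MonoidAlgebra.coeff x g) h
  simpa [MonoidAlgebra.coeff_mapRingHom] using this

theorem intGroupRingMap_mul_comm {r : MonoidAlgebra ℤ G}
    (hr : r ∈ Subring.center (MonoidAlgebra ℤ G)) (a : MonoidAlgebra K G) :
    intGroupRingMap K r * a = a * intGroupRingMap K r := by
  induction a using MonoidAlgebra.induction_linear with
  | zero => simp
  | add a b ha hb => rw [mul_add, add_mul, ha, hb]
  | single g c =>
    have h1 : MonoidAlgebra.single g c = c • intGroupRingMap K (MonoidAlgebra.single g 1) := by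
      simp
    rw [h1, mul_smul_comm, smul_mul_assoc, ← map_mul, ← map_mul, Subring.mem_center_iff.1 hr]

variable {K} in
theorem exists_centralCharacter {d : ℕ} [NeZero d]
    (ρ : MonoidAlgebra K G →ₐ[K] Matrix (Fin d) (Fin d) K) (hρ : Function.Surjective ρ) :
    ∃ φ : Subring.center (MonoidAlgebra ℤ G) →+* K,
      ∀ r : Subring.center (MonoidAlgebra ℤ G), ρ (intGroupRingMap K r) =
        algebraMap K _ (φ r) := by
  choose c hc using fun r : Subring.center (MonoidAlgebra ℤ G) =>
    Matrix.exists_scalar_of_surjective ρ hρ _ (intGroupRingMap_mul_comm K r.2)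
  have hinj := (algebraMap K (Matrix (Fin d) (Fin d) K)).injective
  refine ⟨⟨⟨⟨c, ?_⟩, ?_⟩, ?_, ?_⟩, hc⟩
  · apply hinj; rw [← hc]; simp
  · intro x y; apply hinj; rw [map_mul, ← hc, ← hc, ← hc]; simp
  · apply hinj; rw [← hc]; simp
  · intro x y; apply hinj; rw [map_add, ← hc, ← hc, ← hc]; simp

theorem eq_zero_of_centralCharacter_eq_zero [IsAlgClosed K] [CharZero K] [Finite G]
    (r : Subring.center (MonoidAlgebra ℤ G))
    (h : ∀ (d : ℕ) (_ : NeZero d) (ρ : MonoidAlgebra K G →ₐ[K] Matrix (Fin d) (Fin d) K)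
      (φ : Subring.center (MonoidAlgebra ℤ G) →+* K),
      (∀ r : Subring.center (MonoidAlgebra ℤ G), ρ (intGroupRingMap K r) =
        algebraMap K _ (φ r)) → φ r = 0) : r = 0 := by
  by_contra h0
  have : intGroupRingMap K (r : MonoidAlgebra ℤ G) ≠ 0 := by
    rw [Ne, map_eq_zero_iff _ (intGroupRingMap_injective K)]
    simpa using h0
  obtain ⟨d, hd, ρ, hρ, hr⟩ := MonoidAlgebra.exists_surjective_matrix_ne_zero _ this
  obtain ⟨φ, hφ⟩ := exists_centralCharacter ρ hρ
  exact hr (by rw [hφ, h d hd ρ φ hφ, map_zero])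

instance [Finite G] : Module.Finite ℤ (Subring.center (MonoidAlgebra ℤ G)) :=
  Module.Finite.of_injective
    (Subring.center (MonoidAlgebra ℤ G)).subtype.toIntAlgHom.toLinearMap Subtype.val_injective

instance [Finite G] : IsReduced (Subring.center (MonoidAlgebra ℤ G)) := by
  refine ⟨fun r ⟨n, hn⟩ => eq_zero_of_centralCharacter_eq_zero (AlgebraicClosure ℚ) r ?_⟩
  intro d _ ρ φ _
  have h1 := congrArg φ hn
  rw [map_pow, map_zero] at h1
  exact eq_zero_of_pow_eq_zero h1

end GroupRing

section ConjSum

variable {G : Type*} [Group G] [Fintype G]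

open MonoidAlgebra

/-- The sum of all conjugates of `g`, counted with multiplicity, in the integral group ring. -/
noncomputable def conjSum (g : G) : MonoidAlgebra ℤ G := ∑ x : G, single (x * g * x⁻¹) 1

theorem conjSum_mem_center (g : G) : conjSum g ∈ Subring.center (MonoidAlgebra ℤ G) := by
  rw [Subring.mem_center_iff]
  intro a
  induction a using MonoidAlgebra.induction_linear with
  | zero => simp
  | add a b ha hb => rw [mul_add, add_mul, ha, hb]
  | single h c =>
    simp only [conjSum, Finset.mul_sum, Finset.sum_mul, single_mul_single, mul_one, one_mul]
    refine Fintype.sum_equiv (Equiv.mulLeft h) _ _ fun x => ?_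
    congr 1
    simp [mul_assoc]

/-- The sum of all conjugates of `g`, counted with multiplicity, as a central element. -/
noncomputable def centralConjSum (g : G) : Subring.center (MonoidAlgebra ℤ G) :=
  ⟨conjSum g, conjSum_mem_center g⟩

theorem coeff_one_conjSum_mul (a b : G) [DecidableEq G] :
    (conjSum a * conjSum b).coeff 1 =
      ∑ x : G, ∑ y : G, if x * a * x⁻¹ * (y * b * y⁻¹) = 1 then 1 else 0 := by
  simp only [conjSum, Finset.sum_mul_sum, single_mul_single, mul_one, coeff_sum,
    Finsupp.coe_finsetSum, Finset.sum_apply, coeff_single, Finsupp.single_apply]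

theorem coeff_one_conjSum_mul_nonneg (a b : G) : 0 ≤ (conjSum a * conjSum b).coeff 1 := by
  classical
  rw [coeff_one_conjSum_mul]
  exact Finset.sum_nonneg fun _ _ => Finset.sum_nonneg fun _ _ => by split_ifs <;> simp

theorem coeff_one_conjSum_mul_inv_pos (a : G) : 0 < (conjSum a * conjSum a⁻¹).coeff 1 := by
  classical
  rw [coeff_one_conjSum_mul]
  refine Finset.sum_pos (fun x _ => Finset.sum_pos' (fun _ _ => by split_ifs <;> simp)
    ⟨x, Finset.mem_univ _, ?_⟩) Finset.univ_nonempty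
  simp

theorem exists_conj_eq_of_coeff_one_ne_zero {a b : G} (h : (conjSum a * conjSum b).coeff 1 ≠ 0) :
    ∃ x : G, x * a * x⁻¹ = b⁻¹ := by
  classical
  rw [coeff_one_conjSum_mul] at h
  obtain ⟨x, -, hx⟩ := Finset.exists_ne_zero_of_sum_ne_zero h
  obtain ⟨y, -, hy⟩ := Finset.exists_ne_zero_of_sum_ne_zero hx
  have h1 : x * a * x⁻¹ * (y * b * y⁻¹) = 1 := by by_contra h0; simp [h0] at hy
  refine ⟨y⁻¹ * x, ?_⟩
  rw [mul_eq_one_iff_eq_inv] at h1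
  calc y⁻¹ * x * a * (y⁻¹ * x)⁻¹ = y⁻¹ * (x * a * x⁻¹) * y := by group
    _ = b⁻¹ := by rw [h1]; group

variable {K : Type} [Field K]

theorem mul_centralCharacter_centralConjSum {d : ℕ}
    (ρ : MonoidAlgebra K G →ₐ[K] Matrix (Fin d) (Fin d) K)
    {φ : Subring.center (MonoidAlgebra ℤ G) →+* K}
    (hφ : ∀ r : Subring.center (MonoidAlgebra ℤ G),
      ρ (intGroupRingMap K r) = algebraMap K _ (φ r)) (g : G) :
    (d : K) * φ (centralConjSum g) = Nat.card G * (ρ (single g 1)).trace := by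
  have h1 := congrArg Matrix.trace (hφ (centralConjSum g))
  have h2 : ∀ x : G, (ρ (single (x * g * x⁻¹) 1)).trace = (ρ (single g 1)).trace := by
    intro x
    have : (single (x * g * x⁻¹) 1 : MonoidAlgebra K G) =
      single x 1 * single g 1 * single x⁻¹ 1 := by simp [single_mul_single]
    rw [this, map_mul, map_mul, Matrix.trace_mul_comm, ← mul_assoc, ← map_mul, single_mul_single]
    simp [← one_def]
  rw [show (centralConjSum g : MonoidAlgebra ℤ G) = ∑ x : G, single (x * g * x⁻¹) 1 from rfl] at h1
  simp only [map_sum, MonoidAlgebra.mapRingHom_single, map_one, Matrix.trace_sum, h2,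
    Finset.sum_const, Finset.card_univ, nsmul_eq_mul] at h1
  rw [Nat.card_eq_fintype_card, h1, Algebra.algebraMap_eq_smul_one, Matrix.trace_smul,
    Matrix.trace_one]
  simp [mul_comm]

omit [Fintype G] in
theorem map_trace_eq_map_trace_pow [IsAlgClosed K] [CharZero K] {L : Type*} [Field L] {d n k : ℕ}
    (hn : n ≠ 0) (α β : K →+* L) (hαβ : ∀ ξ : K, ξ ^ n = 1 → α ξ = β (ξ ^ k))
    (ρ : MonoidAlgebra K G →ₐ[K] Matrix (Fin d) (Fin d) K) {g : G} (hg : g ^ n = 1) :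
    α (ρ (single g 1)).trace = β (ρ (single (g ^ k) 1)).trace := by
  have hpow : ∀ m, ρ (single (g ^ m) 1) = ρ (single g 1) ^ m := by
    intro m; rw [← map_pow, single_pow, one_pow]
  obtain ⟨ι, _, ξ, hξ, htr⟩ := Matrix.exists_trace_pow_eq_sum hn (ρ (single g 1)) (by
    rw [← hpow, hg, ← one_def, map_one])
  rw [hpow, htr, ← pow_one (ρ (single g 1)), htr, map_sum, map_sum]
  refine Finset.sum_congr rfl fun i _ => ?_
  rw [pow_one, hαβ _ (hξ i)]

theorem map_trace_inv_eq_conj [IsAlgClosed K] [CharZero K] {d : ℕ} (β : K →+* ℂ)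
    (ρ : MonoidAlgebra K G →ₐ[K] Matrix (Fin d) (Fin d) K) (g : G) :
    β (ρ (single g⁻¹ 1)).trace = starRingEnd ℂ (β (ρ (single g 1)).trace) := by
  have hn := (orderOf_pos g).ne'
  have h := map_trace_eq_map_trace_pow (k := orderOf g - 1) hn ((starRingEnd ℂ).comp β) β
    (fun ξ hξ => ?_) ρ (pow_orderOf_eq_one g)
  · rw [RingHom.comp_apply] at h
    rw [h, pow_sub _ (orderOf_pos g), pow_orderOf_eq_one, pow_one, one_mul]
  · have h1 : β ξ ^ orderOf g = 1 := by rw [← map_pow, hξ, map_one]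
    have h2 : ‖β ξ‖ = 1 := Complex.norm_eq_one_of_pow_eq_one h1 hn
    rw [RingHom.comp_apply, ← Complex.inv_eq_conj h2, map_pow]
    refine inv_eq_of_mul_eq_one_left ?_
    rw [pow_sub_one_mul hn, h1]

variable (K) in
theorem exists_algEquiv_eq_pow [IsAlgClosed K] [CharZero K] [Algebra.IsAlgebraic ℚ K] {n k : ℕ}
    (hn : n ≠ 0) (hk : k.Coprime n) :
    ∃ σ : K ≃ₐ[ℚ] K,
      ∀ ξ : K, ξ ^ n = 1 → σ ξ = ξ ^ k := by
  have : NeZero (n : K) := ⟨by exact_mod_cast hn⟩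
  obtain ⟨ζ, hζ⟩ := HasEnoughRootsOfUnity.exists_primitiveRoot K n
  have h1 : minpoly ℚ ζ = minpoly ℚ (ζ ^ k) := by
    rw [← Polynomial.cyclotomic_eq_minpoly_rat hζ (Nat.pos_of_ne_zero hn),
      ← Polynomial.cyclotomic_eq_minpoly_rat (hζ.pow_of_coprime k hk) (Nat.pos_of_ne_zero hn)]
  have h2 : IsConjRoot ℚ (ζ ^ k) ζ := h1.symm
  have : IsAlgClosure ℚ K := ⟨inferInstance, inferInstance⟩
  have : Normal ℚ K := IsAlgClosure.normal ℚ K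
  obtain ⟨σ, hσ⟩ := isConjRoot_iff_exists_algEquiv.1 h2
  refine ⟨σ, fun ξ hξ => ?_⟩
  have : NeZero n := ⟨hn⟩
  obtain ⟨i, -, rfl⟩ := hζ.eq_pow_of_pow_eq_one hξ
  rw [map_pow, hσ, ← pow_mul, ← pow_mul, mul_comm]

variable (K) in
/-- In a finite cut group, every element is conjugate to each of its coprime powers or to its
inverse. -/
theorem exists_conj_eq_pow_of_finite_units_aux [IsAlgClosed K] [CharZero K]
    [Algebra.IsAlgebraic ℚ K] {G : Type*} [Group G] [Finite G]
    [Finite (Subring.center (MonoidAlgebra ℤ G))ˣ] {g : G} {k : ℕ} (hk : k.Coprime (orderOf g)) :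
    ∃ h : G, h * g * h⁻¹ = g ^ k ∨ h * g * h⁻¹ = (g ^ k)⁻¹ := by
  have := Fintype.ofFinite G
  have hn := (orderOf_pos g).ne'
  obtain ⟨σ, hσ⟩ := exists_algEquiv_eq_pow K hn hk
  let β : K →+* ℂ := (IsAlgClosed.lift (R := ℚ) : K →ₐ[ℚ] ℂ)
  have hprod : (centralConjSum (g ^ k) - centralConjSum g) *
      (centralConjSum (g ^ k)⁻¹ - centralConjSum g) = 0 := by
    refine eq_zero_of_centralCharacter_eq_zero K _ fun d hd ρ φ hφ => ?_
    have hd0 : (d : K) ≠ 0 := by exact_mod_cast hd.out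
    have htr := mul_centralCharacter_centralConjSum ρ hφ
    have hσg := map_trace_eq_map_trace_pow hn (β.comp σ.toRingHom) β (k := k)
      (fun ξ hξ => congrArg β (hσ ξ hξ)) ρ (pow_orderOf_eq_one g)
    have hg : β d * β (σ (φ (centralConjSum g))) = β d * β (φ (centralConjSum (g ^ k))) := by
      rw [← map_mul β (d : K) (φ _), htr, map_mul, ← hσg, map_natCast, map_natCast]
      have := congrArg (fun x => β (σ x)) (htr g)
      simpa using this
    have hgk : β d * β (φ (centralConjSum (g ^ k)⁻¹)) =
        β d * starRingEnd ℂ (β (φ (centralConjSum (g ^ k)))) := by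
      have := congrArg (fun x => starRingEnd ℂ (β x)) (htr (g ^ k))
      rw [← map_mul, htr, map_mul, map_trace_inv_eq_conj]
      simpa using this.symm
    have hβd : β d ≠ 0 := by rwa [Ne, map_eq_zero_iff _ β.injective]
    have hg := mul_left_cancel₀ hβd hg
    have hgk := mul_left_cancel₀ hβd hgk
    rw [map_mul, map_sub, map_sub, mul_eq_zero, sub_eq_zero, sub_eq_zero]
    rcases eq_or_conj_eq_of_finite_units φ (β.comp σ.toRingHom) β with h | h
    · left
      apply β.injective
      rw [← hg, ← h]; rfl
    · right
      apply β.injective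
      rw [hgk, ← hg, ← h]; rfl
  have h1 := congrArg (fun x => (Subring.subtype _ x).coeff 1) hprod
  simp only [map_mul, map_sub, map_zero, sub_mul, mul_sub, coeff_sub, coeff_zero, Finsupp.coe_sub,
    Pi.sub_apply, Finsupp.coe_zero, Pi.zero_apply, Subring.subtype_apply, centralConjSum] at h1
  have h2 := coeff_one_conjSum_mul_inv_pos (g ^ k)
  have h3 := coeff_one_conjSum_mul_nonneg g g
  by_cases h4 : (conjSum g * conjSum (g ^ k)⁻¹).coeff 1 = 0
  · by_cases h5 : (conjSum (g ^ k) * conjSum g).coeff 1 = 0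
    · omega
    · obtain ⟨x, hx⟩ := exists_conj_eq_of_coeff_one_ne_zero h5
      refine ⟨x⁻¹, Or.inr ?_⟩
      have hx' : g = (x * g ^ k * x⁻¹)⁻¹ := by rw [hx, inv_inv]
      nth_rewrite 1 [hx']
      group
  · obtain ⟨x, hx⟩ := exists_conj_eq_of_coeff_one_ne_zero h4
    exact ⟨x, Or.inl (by rw [hx, inv_inv])⟩

theorem exists_conj_eq_pow_of_finite_units {G : Type*} [Group G] [Finite G]
    (hG : Finite (Subring.center (MonoidAlgebra ℤ G))ˣ) (g : G) {k : ℕ}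
    (hk : k.Coprime (orderOf g)) : ∃ h : G, h * g * h⁻¹ = g ^ k ∨ h * g * h⁻¹ = (g ^ k)⁻¹ := by
  have : Algebra.IsAlgebraic ℚ (AlgebraicClosure ℚ) := by
    convert AlgebraicClosure.isAlgebraic ℚ
    · rfl
    · exact Subsingleton.elim _ _
  exact exists_conj_eq_pow_of_finite_units_aux (AlgebraicClosure ℚ) hk

end ConjSum

section CutCriterion

open MonoidAlgebra

variable {G : Type*} [Group G] [Fintype G]

omit [Group G] in
theorem eq_sum_single (u : MonoidAlgebra ℤ G) : u = ∑ g : G, single g (u.coeff g) := by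
  classical
  ext h
  simp [coeff_sum, coeff_single]

omit [Fintype G] in
theorem coeff_conj_of_mem_center {u : MonoidAlgebra ℤ G}
    (hu : u ∈ Subring.center (MonoidAlgebra ℤ G)) (x g : G) :
    u.coeff (x * g * x⁻¹) = u.coeff g := by
  have h := congrArg (fun a => MonoidAlgebra.coeff a (x * g))
    (Subring.mem_center_iff.1 hu (single x 1))
  simpa [coeff_single_mul_apply, coeff_mul_single_apply] using h.symm

/-- The involution of the integral group ring induced by inversion. -/
noncomputable def invMap (u : MonoidAlgebra ℤ G) : MonoidAlgebra ℤ G :=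
  ∑ g : G, single g⁻¹ (u.coeff g)

theorem invMap_mem_center {u : MonoidAlgebra ℤ G}
    (hu : u ∈ Subring.center (MonoidAlgebra ℤ G)) :
    invMap u ∈ Subring.center (MonoidAlgebra ℤ G) := by
  rw [Subring.mem_center_iff]
  intro a
  induction a using MonoidAlgebra.induction_linear with
  | zero => simp
  | add a b ha hb => rw [mul_add, add_mul, ha, hb]
  | single x c =>
    simp only [invMap, Finset.mul_sum, Finset.sum_mul, single_mul_single]
    refine Fintype.sum_equiv (MulAut.conj x).toEquiv _ _ fun g => ?_
    simp only [MulEquiv.toEquiv_eq_coe, EquivLike.coe_coe, MulAut.conj_apply,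
      coeff_conj_of_mem_center hu, mul_comm c]
    congr 1
    group

theorem coeff_one_mul_invMap (u : MonoidAlgebra ℤ G) :
    (u * invMap u).coeff 1 = ∑ g : G, u.coeff g ^ 2 := by
  classical
  nth_rewrite 1 [eq_sum_single u]
  simp only [invMap, Finset.sum_mul_sum, single_mul_single, coeff_sum,
    Finsupp.coe_finsetSum, Finset.sum_apply, coeff_single, Finsupp.single_apply,
    mul_inv_eq_one, Finset.sum_ite_eq, Finset.mem_univ, if_true, sq]

variable {d : ℕ} (ρ : MonoidAlgebra ℂ G →ₐ[ℂ] Matrix (Fin d) (Fin d) ℂ)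
    {φ : Subring.center (MonoidAlgebra ℤ G) →+* ℂ}
    (hφ : ∀ r : Subring.center (MonoidAlgebra ℤ G),
      ρ (intGroupRingMap ℂ r) = algebraMap ℂ _ (φ r))

include hφ

theorem mul_centralCharacter_eq_sum (u : Subring.center (MonoidAlgebra ℤ G)) :
    (d : ℂ) * φ u = ∑ g : G, (u : MonoidAlgebra ℤ G).coeff g * (ρ (single g 1)).trace := by
  have h := congrArg Matrix.trace (hφ u)
  rw [eq_sum_single (u : MonoidAlgebra ℤ G)] at h
  have h2 : ∀ (g : G) (c : ℂ), ρ (single g c) = c • ρ (single g 1) := by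
    intro g c; rw [← map_smul, smul_single, smul_eq_mul, mul_one]
  simp only [map_sum, mapRingHom_single, Matrix.trace_sum, eq_intCast, h2 _ (Int.cast _),
    Matrix.trace_smul, smul_eq_mul] at h
  rw [h, Algebra.algebraMap_eq_smul_one, Matrix.trace_smul, Matrix.trace_one]
  simp [mul_comm]

theorem mul_centralCharacter_invMap_eq_sum (u : Subring.center (MonoidAlgebra ℤ G)) :
    (d : ℂ) * φ ⟨invMap u, invMap_mem_center u.2⟩ =
      ∑ g : G, (u : MonoidAlgebra ℤ G).coeff g * (ρ (single g⁻¹ 1)).trace := by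
  have h := congrArg Matrix.trace (hφ ⟨invMap u, invMap_mem_center u.2⟩)
  have h2 : ∀ (g : G) (c : ℂ), ρ (single g c) = c • ρ (single g 1) := by
    intro g c; rw [← map_smul, smul_single, smul_eq_mul, mul_one]
  simp only [invMap, map_sum, mapRingHom_single, Matrix.trace_sum, eq_intCast, h2 _ (Int.cast _),
    Matrix.trace_smul, smul_eq_mul] at h
  rw [h, Algebra.algebraMap_eq_smul_one, Matrix.trace_smul, Matrix.trace_one]
  simp [mul_comm, invMap]

theorem centralCharacter_invMap [NeZero d] (u : Subring.center (MonoidAlgebra ℤ G)) :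
    φ ⟨invMap u, invMap_mem_center u.2⟩ = starRingEnd ℂ (φ u) := by
  have hd : (d : ℂ) ≠ 0 := by exact_mod_cast NeZero.ne d
  apply mul_left_cancel₀ hd
  rw [mul_centralCharacter_invMap_eq_sum ρ hφ]
  have h := congrArg (starRingEnd ℂ) (mul_centralCharacter_eq_sum ρ hφ u)
  rw [map_mul, map_natCast] at h
  rw [h, map_sum]
  refine Finset.sum_congr rfl fun g _ => ?_
  have := map_trace_inv_eq_conj (RingHom.id ℂ) ρ g
  simp only [RingHom.id_apply] at this
  rw [map_mul, this, map_intCast]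

omit hφ [Fintype G] in
theorem exists_int_trace_add_trace_inv {g : G} (hg : g ^ 4 = 1 ∨ g ^ 6 = 1) :
    ∃ m : ℤ, (ρ (single g 1)).trace + (ρ (single g⁻¹ 1)).trace = m := by
  have hpow : ∀ m, ρ (single (g ^ m) 1) = ρ (single g 1) ^ m := by
    intro m; rw [← map_pow, single_pow, one_pow]
  have key : ∀ n : ℕ, n ≠ 0 → g ^ n = 1 →
      (∀ ξ : ℂ, ξ ^ n = 1 → ∃ m : ℤ, ξ + ξ ^ (n - 1) = m) →
      ∃ m : ℤ, (ρ (single g 1)).trace + (ρ (single g⁻¹ 1)).trace = m := by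
    intro n hn hgn hm
    obtain ⟨ι, _, ξ, hξ, htr⟩ := Matrix.exists_trace_pow_eq_sum hn (ρ (single g 1)) (by
      rw [← hpow, hgn, ← one_def, map_one])
    choose m hm using fun i => hm (ξ i) (hξ i)
    have hinv : g⁻¹ = g ^ (n - 1) :=
      inv_eq_of_mul_eq_one_left (by rw [pow_sub_one_mul hn, hgn])
    refine ⟨∑ i, m i, ?_⟩
    rw [hinv, hpow, htr, ← pow_one (ρ (single g 1)), htr, ← Finset.sum_add_distrib]
    simp [hm]
  rcases hg with hg | hg
  · refine key 4 (by norm_num) hg fun ξ hξ => ?_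
    have : (ξ - 1) * ((ξ + 1) * (ξ ^ 2 + 1)) = 0 := by linear_combination hξ
    rcases mul_eq_zero.1 this with h | h
    · exact ⟨2, by rw [sub_eq_zero.1 h]; norm_num⟩
    rcases mul_eq_zero.1 h with h | h
    · exact ⟨-2, by rw [eq_neg_of_add_eq_zero_left h]; norm_num⟩
    · exact ⟨0, by push_cast; linear_combination ξ * h⟩
  · refine key 6 (by norm_num) hg fun ξ hξ => ?_
    have : (ξ - 1) * ((ξ + 1) * ((ξ ^ 2 + ξ + 1) * (ξ ^ 2 - ξ + 1))) = 0 := by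
      linear_combination hξ
    rcases mul_eq_zero.1 this with h | h
    · exact ⟨2, by rw [sub_eq_zero.1 h]; norm_num⟩
    rcases mul_eq_zero.1 h with h | h
    · exact ⟨-2, by rw [eq_neg_of_add_eq_zero_left h]; norm_num⟩
    rcases mul_eq_zero.1 h with h | h
    · exact ⟨-1, by push_cast; linear_combination (ξ ^ 3 - ξ ^ 2 + 1) * h⟩
    · exact ⟨1, by push_cast; linear_combination (ξ ^ 3 + ξ ^ 2 - 1) * h⟩

theorem exists_int_centralCharacter_mul_invMap [NeZero d] (hG : ∀ g : G, g ^ 4 = 1 ∨ g ^ 6 = 1)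
    (u : Subring.center (MonoidAlgebra ℤ G)) :
    ∃ m : ℤ, 0 ≤ m ∧ φ (u * ⟨invMap u, invMap_mem_center u.2⟩) = m := by
  have hd : (d : ℂ) ≠ 0 := by exact_mod_cast NeZero.ne d
  set v := u * ⟨invMap u, invMap_mem_center u.2⟩ with hv
  have h1 : φ v = (Complex.normSq (φ u) : ℂ) := by
    rw [hv, map_mul, centralCharacter_invMap ρ hφ, Complex.mul_conj]
  have h2 : starRingEnd ℂ (φ v) = φ v := by rw [h1, Complex.conj_ofReal]
  choose m hm using fun g => exists_int_trace_add_trace_inv ρ (hG g)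
  have h3 : 2 * (d : ℂ) * φ v = ((∑ g : G, (v : MonoidAlgebra ℤ G).coeff g * m g : ℤ) : ℂ) := by
    have h4 := mul_centralCharacter_eq_sum ρ hφ v
    have h5 := mul_centralCharacter_invMap_eq_sum ρ hφ v
    rw [centralCharacter_invMap ρ hφ, h2] at h5
    rw [mul_assoc, two_mul]
    nth_rewrite 1 [h4]
    rw [h5, ← Finset.sum_add_distrib]
    push_cast
    refine Finset.sum_congr rfl fun g _ => ?_
    rw [← hm]; ring
  have h4 : φ v = algebraMap ℚ ℂ
      ((∑ g : G, (v : MonoidAlgebra ℤ G).coeff g * m g : ℤ) / (2 * d : ℚ)) := by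
    rw [map_div₀, eq_div_iff (by simpa using hd)]
    rw [map_intCast, ← h3]
    simp; ring
  have h5 : IsIntegral ℤ (φ v) := isIntegral_of_mem_range φ v
  rw [h4, isIntegral_algebraMap_iff (algebraMap ℚ ℂ).injective,
    IsIntegrallyClosed.isIntegral_iff] at h5
  obtain ⟨z, hz⟩ := h5
  rw [← hz] at h4
  refine ⟨z, ?_, by simpa using h4⟩
  have h6 : (Complex.normSq (φ u) : ℂ) = ((z : ℝ) : ℂ) := by rw [← h1, h4]; simp
  have h7 := Complex.ofReal_injective h6
  have h8 := Complex.normSq_nonneg (φ u)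
  rw [h7] at h8
  exact_mod_cast h8

omit hφ in
theorem mul_invMap_eq_one (hG : ∀ g : G, g ^ 4 = 1 ∨ g ^ 6 = 1)
    (u : (Subring.center (MonoidAlgebra ℤ G))ˣ) :
    (u : Subring.center (MonoidAlgebra ℤ G)) * ⟨invMap u, invMap_mem_center u.1.2⟩ = 1 := by
  rw [← sub_eq_zero]
  refine eq_zero_of_centralCharacter_eq_zero ℂ _ fun d hd ρ φ hφ => ?_
  obtain ⟨m, hm, hm'⟩ := exists_int_centralCharacter_mul_invMap ρ hφ hG u
  obtain ⟨n, hn, hn'⟩ := exists_int_centralCharacter_mul_invMap ρ hφ hG (u⁻¹ : _ˣ)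
  have h : m * n = 1 := by
    have : (m : ℂ) * n = 1 := by
      rw [← hm', ← hn', map_mul, map_mul, centralCharacter_invMap ρ hφ,
        centralCharacter_invMap ρ hφ]
      have h1 : φ u * φ (u⁻¹ : _ˣ) = 1 := by rw [← map_mul, Units.mul_inv, map_one]
      calc _ = (φ u * φ (u⁻¹ : _ˣ)) * starRingEnd ℂ (φ u * φ (u⁻¹ : _ˣ)) := by
            rw [map_mul]; ring
        _ = 1 := by rw [h1, map_one, one_mul]
    exact_mod_cast this
  have := Int.eq_one_or_neg_one_of_mul_eq_one h
  have hm1 : m = 1 := by omega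
  rw [map_sub, hm', hm1, map_one]
  simp

omit hφ [Fintype G] in
/-- A finite group all of whose elements have order dividing four or six is a cut group. -/
theorem finite_units_center_of_pow_eq_one [Finite G] (hG : ∀ g : G, g ^ 4 = 1 ∨ g ^ 6 = 1) :
    Finite (Subring.center (MonoidAlgebra ℤ G))ˣ := by
  have := Fintype.ofFinite G
  have hsum : ∀ u : (Subring.center (MonoidAlgebra ℤ G))ˣ,
      ∑ g : G, (u : MonoidAlgebra ℤ G).coeff g ^ 2 = 1 := by
    intro u
    rw [← coeff_one_mul_invMap]
    have := congrArg (fun x => (Subring.subtype _ x).coeff 1) (mul_invMap_eq_one hG u)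
    simpa using this
  have hmem : ∀ (u : (Subring.center (MonoidAlgebra ℤ G))ˣ) (g : G),
      (u : MonoidAlgebra ℤ G).coeff g ∈ Set.Icc (-1 : ℤ) 1 := by
    intro u g
    have h := hsum u
    have h1 : (u : MonoidAlgebra ℤ G).coeff g ^ 2 ≤ 1 := by
      rw [← h]
      exact Finset.single_le_sum (f := fun g => (u : MonoidAlgebra ℤ G).coeff g ^ 2)
        (fun _ _ => sq_nonneg _) (Finset.mem_univ g)
    rw [sq_le_one_iff_abs_le_one, abs_le] at h1
    exact h1
  refine Finite.of_injective (fun u (g : G) => (⟨_, hmem u g⟩ : Set.Icc (-1 : ℤ) 1)) ?_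
  intro u v h
  ext g
  exact congrArg Subtype.val (congrFun h g)

end CutCriterion

section SpecialLinear

open Matrix Quaternion

/-- The element of `SL(2,3)` mapped to the quaternion unit `i` by `slQuaternion`. -/
def slI : SpecialLinearGroup (Fin 2) (ZMod 3) := ⟨!![0, 2; 1, 0], by decide⟩

/-- The element of `SL(2,3)` mapped to the quaternion unit `j` by `slQuaternion`. -/
def slJ : SpecialLinearGroup (Fin 2) (ZMod 3) := ⟨!![1, 1; 1, 2], by decide⟩

/-- An element of order three of `SL(2,3)`, which permutes `slI`, `slJ` and `slI * slJ`
cyclically by conjugation. -/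
def slW : SpecialLinearGroup (Fin 2) (ZMod 3) := ⟨!![1, 1; 0, 1], by decide⟩

/-- The rational character of `SL(2,3)` afforded by twice its faithful quaternionic representation
of reduced degree two. -/
def slChar (s : SpecialLinearGroup (Fin 2) (ZMod 3)) : ℤ :=
  if s = 1 then 2 else if s = -1 then -2
  else if s 0 0 + s 1 1 = 0 then 0 else if s 0 0 + s 1 1 = 1 then 1 else -1

theorem slChar_mul (s t : SpecialLinearGroup (Fin 2) (ZMod 3)) :
    2 * slChar (s * t) = slChar s * slChar t - slChar (s * slI⁻¹) * slChar (t * slI⁻¹)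
      - slChar (s * slJ⁻¹) * slChar (t * slJ⁻¹)
      - slChar (s * (slI * slJ)⁻¹) * slChar (t * (slI * slJ)⁻¹) := by
  revert s t
  decide +kernel

theorem slChar_mul_slI (s t : SpecialLinearGroup (Fin 2) (ZMod 3)) :
    2 * slChar (s * t * slI⁻¹) = slChar s * slChar (t * slI⁻¹) + slChar (s * slI⁻¹) * slChar t
      + slChar (s * slJ⁻¹) * slChar (t * (slI * slJ)⁻¹)
      - slChar (s * (slI * slJ)⁻¹) * slChar (t * slJ⁻¹) := by
  revert s t
  decide +kernel

theorem slChar_mul_slJ (s t : SpecialLinearGroup (Fin 2) (ZMod 3)) :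
    2 * slChar (s * t * slJ⁻¹) = slChar s * slChar (t * slJ⁻¹)
      - slChar (s * slI⁻¹) * slChar (t * (slI * slJ)⁻¹) + slChar (s * slJ⁻¹) * slChar t
      + slChar (s * (slI * slJ)⁻¹) * slChar (t * slI⁻¹) := by
  revert s t
  decide +kernel

theorem slChar_mul_slI_mul_slJ (s t : SpecialLinearGroup (Fin 2) (ZMod 3)) :
    2 * slChar (s * t * (slI * slJ)⁻¹) = slChar s * slChar (t * (slI * slJ)⁻¹)
      + slChar (s * slI⁻¹) * slChar (t * slJ⁻¹) - slChar (s * slJ⁻¹) * slChar (t * slI⁻¹)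
      + slChar (s * (slI * slJ)⁻¹) * slChar t := by
  revert s t
  decide +kernel

/-- The embedding of `SL(2,3)` into the rational quaternions. -/
def slQuaternion : SpecialLinearGroup (Fin 2) (ZMod 3) →* ℍ[ℚ] where
  toFun s := ⟨slChar s / 2, slChar (s * slI⁻¹) / 2, slChar (s * slJ⁻¹) / 2,
    slChar (s * (slI * slJ)⁻¹) / 2⟩
  map_one' := by
    rw [show slChar 1 = 2 by decide +kernel, show slChar (1 * slI⁻¹) = 0 by decide +kernel,
      show slChar (1 * slJ⁻¹) = 0 by decide +kernel,
      show slChar (1 * (slI * slJ)⁻¹) = 0 by decide +kernel]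
    ext <;> simp
  map_mul' s t := by
    have h0 := congrArg (Int.cast : ℤ → ℚ) (slChar_mul s t)
    have h1 := congrArg (Int.cast : ℤ → ℚ) (slChar_mul_slI s t)
    have h2 := congrArg (Int.cast : ℤ → ℚ) (slChar_mul_slJ s t)
    have h3 := congrArg (Int.cast : ℤ → ℚ) (slChar_mul_slI_mul_slJ s t)
    push_cast at h0 h1 h2 h3
    ext
    · refine Eq.trans ?_ (Quaternion.re_mul _ _).symm; dsimp only; linear_combination h0 / 4
    · refine Eq.trans ?_ (Quaternion.imI_mul _ _).symm; dsimp only; linear_combination h1 / 4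
    · refine Eq.trans ?_ (Quaternion.imJ_mul _ _).symm; dsimp only; linear_combination h2 / 4
    · refine Eq.trans ?_ (Quaternion.imK_mul _ _).symm; dsimp only; linear_combination h3 / 4

theorem slQuaternion_injective : Function.Injective slQuaternion := by
  intro s t h
  have key : ∀ s t : SpecialLinearGroup (Fin 2) (ZMod 3), slChar s = slChar t →
      slChar (s * slI⁻¹) = slChar (t * slI⁻¹) → slChar (s * slJ⁻¹) = slChar (t * slJ⁻¹) →
      slChar (s * (slI * slJ)⁻¹) = slChar (t * (slI * slJ)⁻¹) → s = t := by
    decide +kernel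
  have hr : ∀ a b : ℤ, (a : ℚ) / 2 = b / 2 → a = b := fun a b h => by
    exact_mod_cast (div_left_inj' two_ne_zero).1 h
  exact key s t (hr _ _ (congrArg (·.re) h)) (hr _ _ (congrArg (·.imI) h))
    (hr _ _ (congrArg (·.imJ) h)) (hr _ _ (congrArg (·.imK) h))

theorem slQuaternion_slI : slQuaternion slI = ⟨0, 1, 0, 0⟩ := by
  change (⟨slChar slI / 2, slChar (slI * slI⁻¹) / 2, slChar (slI * slJ⁻¹) / 2,
    slChar (slI * (slI * slJ)⁻¹) / 2⟩ : ℍ[ℚ]) = _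
  rw [show slChar slI = 0 by decide +kernel, show slChar (slI * slI⁻¹) = 2 by decide +kernel,
    show slChar (slI * slJ⁻¹) = 0 by decide +kernel,
    show slChar (slI * (slI * slJ)⁻¹) = 0 by decide +kernel]
  ext <;> simp

theorem slQuaternion_slJ : slQuaternion slJ = ⟨0, 0, 1, 0⟩ := by
  change (⟨slChar slJ / 2, slChar (slJ * slI⁻¹) / 2, slChar (slJ * slJ⁻¹) / 2,
    slChar (slJ * (slI * slJ)⁻¹) / 2⟩ : ℍ[ℚ]) = _
  rw [show slChar slJ = 0 by decide +kernel, show slChar (slJ * slI⁻¹) = 0 by decide +kernel,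
    show slChar (slJ * slJ⁻¹) = 2 by decide +kernel,
    show slChar (slJ * (slI * slJ)⁻¹) = 0 by decide +kernel]
  ext <;> simp

theorem slQuaternion_slW : slQuaternion slW = ⟨-1 / 2, -1 / 2, -1 / 2, -1 / 2⟩ := by
  change (⟨slChar slW / 2, slChar (slW * slI⁻¹) / 2, slChar (slW * slJ⁻¹) / 2,
    slChar (slW * (slI * slJ)⁻¹) / 2⟩ : ℍ[ℚ]) = _
  rw [show slChar slW = -1 by decide +kernel, show slChar (slW * slI⁻¹) = -1 by decide +kernel,
    show slChar (slW * slJ⁻¹) = -1 by decide +kernel,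
    show slChar (slW * (slI * slJ)⁻¹) = -1 by decide +kernel]
  ext <;> simp

theorem exists_pow_mul_pow_mul_pow (s : SpecialLinearGroup (Fin 2) (ZMod 3)) :
    ∃ (a : Fin 4) (b : Fin 2) (c : Fin 3),
      s = slI ^ (a : ℕ) * slJ ^ (b : ℕ) * slW ^ (c : ℕ) := by
  revert s
  decide +kernel

theorem nat_card_sl : Nat.card (SpecialLinearGroup (Fin 2) (ZMod 3)) = 24 := by
  rw [Nat.card_eq_fintype_card]
  decide +kernel

theorem sl_pow_four_or_pow_six (s : SpecialLinearGroup (Fin 2) (ZMod 3)) :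
    s ^ 4 = 1 ∨ s ^ 6 = 1 := by
  revert s
  decide +kernel

end SpecialLinear
section DivisionRingSubgroup

variable {D : Type*} [DivisionRing D] {G : Type*} [Group G] {f : G →* D}

open scoped IsMulCommutative in
theorem exists_pow_eq_of_commute [Finite G] (hf : Function.Injective f) {a b : G}
    (hab : Commute a b) (hb : b ^ orderOf a = 1) : ∃ m : ℕ, b = a ^ m := by
  have hcomm : ∀ x ∈ ({f a, f b} : Set D), ∀ y ∈ ({f a, f b} : Set D), x * y = y * x := by
    have h : f a * f b = f b * f a := by rw [← map_mul, ← map_mul, hab.eq]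
    rintro x (rfl | rfl) y (rfl | rfl) <;> simp [h]
  have := Subring.isMulCommutative_closure hcomm
  let A : Subring.closure {f a, f b} := ⟨f a, Subring.subset_closure (by simp)⟩
  let B : Subring.closure {f a, f b} := ⟨f b, Subring.subset_closure (by simp)⟩
  have hA : IsPrimitiveRoot A (orderOf a) := by
    rw [IsPrimitiveRoot.iff_orderOf]
    have h : Function.Injective (Subring.closure {f a, f b}).subtype := Subtype.val_injective
    rw [← orderOf_injective (Subring.closure {f a, f b}).subtype.toMonoidHom h A]
    exact orderOf_injective f hf a
  have hB : B ^ orderOf a = 1 := by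
    apply Subtype.ext
    change f b ^ orderOf a = 1
    rw [← map_pow, hb, map_one]
  have : NeZero (orderOf a) := ⟨(orderOf_pos a).ne'⟩
  obtain ⟨i, -, hi⟩ := hA.eq_pow_of_pow_eq_one hB
  refine ⟨i, hf ?_⟩
  rw [map_pow]
  exact (congrArg Subtype.val hi).symm

theorem map_eq_neg_one_of_sq (hf : Function.Injective f) {a : G} (ha : a ^ 2 = 1) (h1 : a ≠ 1) :
    f a = -1 := by
  have h : f a * f a = 1 := by rw [← map_mul, ← sq, ha, map_one]
  rcases mul_self_eq_one_iff.1 h with h | h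
  · exact absurd (hf (h.trans (map_one f).symm)) h1
  · exact h

theorem eq_of_sq_eq_one (hf : Function.Injective f) {a b : G} (ha : a ^ 2 = 1) (ha1 : a ≠ 1)
    (hb : b ^ 2 = 1) (hb1 : b ≠ 1) : a = b :=
  hf ((map_eq_neg_one_of_sq hf ha ha1).trans (map_eq_neg_one_of_sq hf hb hb1).symm)

theorem commute_of_sq_eq_one (hf : Function.Injective f) {a : G} (ha : a ^ 2 = 1) (b : G) :
    Commute a b := by
  by_cases h1 : a = 1
  · rw [h1]; exact Commute.one_left b
  · apply hf
    rw [map_mul, map_mul, map_eq_neg_one_of_sq hf ha h1]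
    simp

theorem sum_map_pow_eq_zero (hf : Function.Injective f) {w : G} {n : ℕ} (hw : w ^ n = 1)
    (h1 : w ≠ 1) : ∑ i ∈ Finset.range n, f w ^ i = 0 := by
  have h := mul_geom_sum (f w) n
  rw [← map_pow, hw, map_one, sub_self] at h
  rcases mul_eq_zero.1 h with h | h
  · exact absurd (hf ((sub_eq_zero.1 h).trans (map_one f).symm)) h1
  · exact h

variable [CharZero D]

/-- An element of prime order normalizing a finite cyclic subgroup of a division ring of
characteristic zero centralizes it. -/
theorem commute_of_conj_mem_zpowers (hf : Function.Injective f) {q : ℕ} (hq : q.Prime) {b g : G}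
    (hg : IsOfFinOrder g) (hb : b ^ q = 1) (hbg : b * g * b⁻¹ ∈ Subgroup.zpowers g) :
    Commute b g := by
  by_contra hcomm
  have hb1 : b ≠ 1 := by rintro rfl; exact hcomm (Commute.one_left g)
  set n := orderOf g
  have hn : 0 < n := hg.orderOf_pos
  have hgn : g ^ n = 1 := pow_orderOf_eq_one g
  have hmem : ∀ m : ℕ, b ^ m * g * (b ^ m)⁻¹ ∈ Subgroup.zpowers g := by
    intro m
    induction m with
    | zero => simp
    | succ m ih =>
      obtain ⟨c, hc⟩ := ih
      rw [pow_succ', mul_inv_rev]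
      have : b * b ^ m * g * ((b ^ m)⁻¹ * b⁻¹) = (b * g * b⁻¹) ^ c := by
        rw [conj_zpow]
        rw [show g ^ c = b ^ m * g * (b ^ m)⁻¹ from hc]
        group
      rw [this]
      exact Subgroup.zpow_mem _ hbg c
  have hnc : ∀ m ∈ Finset.range q, m ≠ 0 → ¬ Commute (b ^ m) g := by
    intro m hm hm0 h
    have hcop : Nat.Coprime m q :=
      (hq.coprime_iff_not_dvd.2 (Nat.not_dvd_of_pos_of_lt (Nat.pos_of_ne_zero hm0)
        (Finset.mem_range.1 hm))).symm
    have h2 : Commute (b ^ q) g := by rw [hb]; exact Commute.one_left g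
    have h3 : b ∈ Subgroup.centralizer {g} := by
      have e : b = (b ^ m) ^ (Nat.gcdA m q) * (b ^ q) ^ (Nat.gcdB m q) := by
        rw [← zpow_natCast, ← zpow_natCast, ← zpow_mul, ← zpow_mul, ← zpow_add,
          ← Nat.gcd_eq_gcd_ab, hcop]
        simp
      rw [e]
      refine mul_mem (Subgroup.zpow_mem _ ?_ _) (Subgroup.zpow_mem _ ?_ _) <;>
        rw [Subgroup.mem_centralizer_singleton_iff]
      exacts [h.eq, h2.eq]
    exact hcomm (Subgroup.mem_centralizer_singleton_iff.1 h3)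
  have hterm : ∀ m ∈ Finset.range q, m ≠ 0 →
      ∑ i ∈ Finset.range n, f (g ^ i * b ^ m * (g ^ i)⁻¹) = 0 := by
    intro m hm hm0
    set v := b ^ m * g * (b ^ m)⁻¹ with hv
    obtain ⟨c, hc⟩ := hmem m
    have hgv : Commute g v⁻¹ := by
      rw [← hv] at hc
      rw [← hc]
      exact ((Commute.refl g).zpow_right c).inv_right
    set w := g * v⁻¹ with hw
    have hw1 : w ≠ 1 := by
      intro h
      apply hnc m hm hm0
      have : v = g := (mul_inv_eq_one.1 h).symm
      exact mul_inv_eq_iff_eq_mul.1 this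
    have hwn : w ^ n = 1 := by
      rw [hw, hgv.mul_pow, hgn, inv_pow, hv, conj_pow, hgn]
      simp
    have hwi : ∀ i : ℕ, g ^ i * b ^ m * (g ^ i)⁻¹ = w ^ i * b ^ m := by
      intro i
      rw [hw, hgv.mul_pow, inv_pow, hv, conj_pow]
      group
    simp only [hwi, map_mul, map_pow f w]
    rw [← Finset.sum_mul, sum_map_pow_eq_zero hf hwn hw1, zero_mul]
  have h0 : ∑ i ∈ Finset.range n, ∑ m ∈ Finset.range q, f (g ^ i * b ^ m * (g ^ i)⁻¹) = 0 := by
    refine Finset.sum_eq_zero fun i _ => ?_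
    simp only [map_mul, ← Finset.mul_sum, ← Finset.sum_mul, map_pow f b]
    rw [sum_map_pow_eq_zero hf hb hb1]
    simp
  rw [Finset.sum_comm, ← Finset.add_sum_erase _ _ (Finset.mem_range.2 hq.pos),
    Finset.sum_eq_zero (s := (Finset.range q).erase 0)
      (fun m hm => hterm m (Finset.mem_of_mem_erase hm) (Finset.ne_of_mem_erase hm))] at h0
  simp only [pow_zero, mul_one, mul_inv_cancel, map_one, Finset.sum_const, Finset.card_range,
    nsmul_eq_mul, add_zero] at h0
  exact hn.ne' (by exact_mod_cast h0)

end DivisionRingSubgroup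
section Orders

variable {D : Type*} [DivisionRing D] {G : Type*} [Group G] {f : G →* D}

theorem pow_conj_eq_mul_pow {t x w : G} (h : t * x * t⁻¹ = x * w) (hw : Commute t w) (m : ℕ) :
    t ^ m * x * (t ^ m)⁻¹ = x * w ^ m := by
  induction m with
  | zero => simp
  | succ m ih =>
    calc t ^ (m + 1) * x * (t ^ (m + 1))⁻¹ = t * (t ^ m * x * (t ^ m)⁻¹) * t⁻¹ := by
          rw [pow_succ']; group
      _ = (t * x * t⁻¹) * (t * w ^ m * t⁻¹) := by rw [ih]; group
      _ = x * w ^ (m + 1) := by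
          rw [h, (hw.pow_right m).eq, mul_inv_cancel_right, pow_succ', mul_assoc]

theorem mul_pow_eq_of_conj {u y c : G} (h : y * u * y⁻¹ = u * c) (hy : Commute y c)
    (hu : Commute u c) (n : ℕ) : (u * y) ^ n = u ^ n * y ^ n * c ^ n.choose 2 := by
  induction n with
  | zero => simp
  | succ n ih =>
    have h1 : y ^ n * u = u * c ^ n * y ^ n :=
      eq_mul_of_mul_inv_eq (pow_conj_eq_mul_pow h hy n)
    have h2 : (n + 1).choose 2 = n + n.choose 2 := by
      rw [Nat.choose_succ_succ', Nat.choose_one_right]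
    have h3 : Commute (c ^ n.choose 2) (u * y) := (hu.symm.mul_right hy.symm).pow_left _
    rw [pow_succ, ih, mul_assoc, h3.eq, h2]
    calc u ^ n * y ^ n * (u * y * c ^ n.choose 2) =
        u ^ n * (y ^ n * u) * y * c ^ n.choose 2 := by group
      _ = u ^ n * (u * (c ^ n * y ^ (n + 1))) * c ^ n.choose 2 := by
        rw [h1]; simp only [mul_assoc, pow_succ]
      _ = u ^ (n + 1) * y ^ (n + 1) * c ^ (n + n.choose 2) := by
        rw [((hy.symm.pow_left n).pow_right (n + 1)).eq, pow_add c]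
        simp only [mul_assoc, pow_succ u]

theorem exists_max_orderOf [Finite G] {p : ℕ} (hp : p.Prime) {x₀ : G} {a : ℕ}
    (h : orderOf x₀ = p ^ a) :
    ∃ (x : G) (s : ℕ), a ≤ s ∧ orderOf x = p ^ s ∧
      ∀ (y : G) (t : ℕ), y ^ p ^ t = 1 → y ^ orderOf x = 1 := by
  obtain ⟨x, ⟨s, hs⟩, hmax⟩ := Set.exists_max_image {y : G | ∃ t, orderOf y = p ^ t} orderOf
    (Set.toFinite _) ⟨x₀, a, h⟩
  refine ⟨x, s, ?_, hs, fun y t hy => ?_⟩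
  · have := hmax x₀ ⟨a, h⟩
    rw [h, hs] at this
    exact (Nat.pow_le_pow_iff_right hp.one_lt).1 this
  · obtain ⟨j, -, hj⟩ := (Nat.dvd_prime_pow hp).1 (orderOf_dvd_of_pow_eq_one hy)
    have := hmax y ⟨j, hj⟩
    rw [hj, hs] at this
    rw [← orderOf_dvd_iff_pow_eq_one, hj, hs]
    exact Nat.pow_dvd_pow p ((Nat.pow_le_pow_iff_right hp.one_lt).1 this)

theorem exists_not_dvd_pow_pow_eq_one [Finite G] {p : ℕ} (hp : p.Prime) (h : G) :
    ∃ m t : ℕ, ¬ p ∣ m ∧ (h ^ m) ^ p ^ t = 1 := by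
  obtain ⟨t, m, hm, he⟩ :=
    Nat.exists_eq_pow_mul_and_not_dvd (orderOf_pos h).ne' p hp.ne_one
  refine ⟨m, t, hm, ?_⟩
  rw [← pow_mul, mul_comm, ← he, pow_orderOf_eq_one]

theorem exists_two_part [Finite G] {h : G} : ∃ m t : ℕ, (h ^ m) ^ 2 ^ t = 1 ∧
    ∀ x : G, Commute (h ^ 2) x → h ^ m * x * (h ^ m)⁻¹ = h * x * h⁻¹ := by
  obtain ⟨m, t, hm, ht⟩ := exists_not_dvd_pow_pow_eq_one Nat.prime_two h
  refine ⟨m, t, ht, fun x hx => ?_⟩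
  obtain ⟨r, rfl⟩ : ∃ r, m = 2 * r + 1 := ⟨m / 2, by omega⟩
  have h1 := (hx.pow_left r).eq
  rw [← pow_mul] at h1
  calc h ^ (2 * r + 1) * x * (h ^ (2 * r + 1))⁻¹ =
      h * (h ^ (2 * r) * x) * (h ^ (2 * r + 1))⁻¹ := by rw [pow_succ']; group
    _ = h * x * h⁻¹ := by rw [h1, pow_succ]; group

variable [CharZero D] [Finite G] (hf : Function.Injective f)
  (hC : ∀ (g : G) (k : ℕ), k.Coprime (orderOf g) →
    ∃ h : G, h * g * h⁻¹ = g ^ k ∨ h * g * h⁻¹ = (g ^ k)⁻¹)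

include hf

theorem commute_of_squarefree {n : ℕ} (hn : Squarefree n) {g : G} :
    ∀ {t : G}, t ^ n = 1 → t * g * t⁻¹ ∈ Subgroup.zpowers g → Commute t g := by
  induction n using induction_on_primes with
  | zero => simp at hn
  | one => intro t ht _; rw [pow_one] at ht; rw [ht]; exact Commute.one_left g
  | prime_mul p n hp ih =>
    intro t ht htg
    have hmem : ∀ m : ℕ, t ^ m * g * (t ^ m)⁻¹ ∈ Subgroup.zpowers g := by
      intro m
      induction m with
      | zero => simp
      | succ m ih =>
        obtain ⟨c, hc⟩ := ih
        have : t ^ (m + 1) * g * (t ^ (m + 1))⁻¹ = (t * g * t⁻¹) ^ c := by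
          rw [conj_zpow, show g ^ c = t ^ m * g * (t ^ m)⁻¹ from hc, pow_succ']
          group
        rw [this]
        exact Subgroup.zpow_mem _ htg c
    have hcop : Nat.Coprime p n := Nat.coprime_of_squarefree_mul hn
    have h1 : Commute (t ^ p) g :=
      ih (hn.squarefree_of_dvd (Dvd.intro_left p rfl)) (by rw [← pow_mul, ht]) (hmem p)
    have h2 : Commute (t ^ n) g :=
      commute_of_conj_mem_zpowers hf hp (isOfFinOrder_of_finite g)
        (by rw [← pow_mul, mul_comm, ht]) (hmem n)
    have h3 : t ∈ Subgroup.centralizer {g} := by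
      have e : t = (t ^ p) ^ (Nat.gcdA p n) * (t ^ n) ^ (Nat.gcdB p n) := by
        rw [← zpow_natCast, ← zpow_natCast, ← zpow_mul, ← zpow_mul, ← zpow_add,
          ← Nat.gcd_eq_gcd_ab, hcop]
        simp
      rw [e]
      refine mul_mem (Subgroup.zpow_mem _ ?_ _) (Subgroup.zpow_mem _ ?_ _) <;>
        rw [Subgroup.mem_centralizer_singleton_iff]
      exacts [h1.eq, h2.eq]
    exact Subgroup.mem_centralizer_singleton_iff.1 h3

include hC

theorem orderOf_ne_sq {p : ℕ} (hp : p.Prime) (hp2 : p ≠ 2) (x₀ : G) : orderOf x₀ ≠ p ^ 2 := by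
  intro h0
  obtain ⟨x, s, hs, hx, hmax⟩ := exists_max_orderOf hp h0
  obtain ⟨s, rfl⟩ : ∃ r, s = r + 2 := ⟨s - 2, by omega⟩
  set z := x ^ p ^ (s + 1) with hz
  have hz1 : z ^ p = 1 := by rw [hz, ← pow_mul, ← pow_succ, ← hx, pow_orderOf_eq_one]
  have hzne : z ≠ 1 := by
    intro h
    have := Nat.le_of_dvd (Nat.pow_pos hp.pos) (orderOf_dvd_of_pow_eq_one h)
    rw [hx] at this
    exact absurd this (not_le.2 (Nat.pow_lt_pow_right hp.one_lt (by omega)))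
  have hxz : Commute x z := (Commute.refl x).pow_right _
  have hzp : z ^ p ^ (s + 1) = 1 := by rw [pow_succ', pow_mul, hz1, one_pow]
  obtain ⟨h, hh⟩ := hC x (1 + p ^ (s + 1)) (by
    rw [hx]
    refine Nat.Coprime.pow_right _ ?_
    rw [pow_succ]
    simp)
  rw [pow_add, pow_one, ← hz] at hh
  have ht : h ^ 2 * x * (h ^ 2)⁻¹ = x * z ^ 2 ∧ Commute (h ^ 2) z := by
    have e : ∀ y : G, h ^ 2 * y * (h ^ 2)⁻¹ = h * (h * y * h⁻¹) * h⁻¹ := by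
      intro y; rw [sq]; group
    rcases hh with hh | hh
    · have hhz : h * z * h⁻¹ = z := by
        nth_rewrite 1 [hz]
        rw [← conj_pow, hh, hxz.mul_pow, ← hz, hzp, mul_one]
      refine ⟨?_, ?_⟩
      · rw [e, hh, ← conj_mul, hh, hhz, sq, mul_assoc]
      · refine (mul_inv_eq_iff_eq_mul.1 ?_ : h ^ 2 * z = z * h ^ 2)
        rw [e, hhz, hhz]
    · have hhz : h * z * h⁻¹ = z⁻¹ := by
        nth_rewrite 1 [hz]
        rw [← conj_pow, hh, inv_pow, hxz.mul_pow, ← hz, hzp, mul_one]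
      refine ⟨?_, ?_⟩
      · rw [e, hh, ← conj_inv, ← conj_mul, hh, hhz, mul_inv_rev, inv_inv, hxz.mul_inv,
          mul_inv_rev, inv_inv, inv_inv, ← mul_assoc, ← sq, (hxz.pow_right 2).eq]
      · refine (mul_inv_eq_iff_eq_mul.1 ?_ : h ^ 2 * z = z * h ^ 2)
        rw [e, hhz, ← conj_inv, hhz, inv_inv]
  obtain ⟨htx, htz⟩ := ht
  obtain ⟨m, T, hm, hmT⟩ := exists_not_dvd_pow_pow_eq_one hp (h ^ 2)
  have hyx := pow_conj_eq_mul_pow htx (htz.pow_right 2) m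
  set y := (h ^ 2) ^ m
  set ω := (z ^ 2) ^ m with hω
  have hyω : Commute y ω := ((htz.pow_left m).pow_right 2).pow_right m
  have hxω : Commute x ω := (hxz.pow_right 2).pow_right m
  have hωp : ω ^ p = 1 := by
    rw [hω, ← pow_mul, ← pow_mul, ← mul_assoc, mul_comm, pow_mul, hz1, one_pow]
  have hωne : ω ≠ 1 := by
    intro h
    rw [hω, ← pow_mul] at h
    have h1 := orderOf_dvd_of_pow_eq_one h
    rw [orderOf_eq_prime (hp := ⟨hp⟩) hz1 hzne, hp.dvd_mul, Nat.prime_dvd_prime_iff_eq hp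
      Nat.prime_two] at h1
    tauto
  have hncomm : ¬ Commute y x := by
    intro h
    rw [h.eq, mul_inv_cancel_right] at hyx
    exact hωne (by simpa using hyx)
  have hyp : Commute (y ^ p) x := by
    have := pow_conj_eq_mul_pow hyx hyω p
    rw [hωp, mul_one] at this
    exact mul_inv_eq_iff_eq_mul.1 this
  obtain ⟨k, hk⟩ := exists_pow_eq_of_commute hf hyp.symm
    (hmax _ T (by rw [← pow_mul, mul_comm, pow_mul, hmT, one_pow]))
  by_cases hpk : p ∣ k
  · obtain ⟨l, rfl⟩ := hpk
    set u := (x ^ l)⁻¹ with hu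
    have huy : y * u * y⁻¹ = u * (ω ^ l)⁻¹ := by
      rw [hu, ← conj_inv, ← conj_pow, hyx, hxω.mul_pow, mul_inv_rev,
        ((hxω.pow_pow l l).inv_inv).eq]
    have hv : (u * y) ^ p = 1 := by
      rw [mul_pow_eq_of_conj huy (hyω.pow_right l).inv_right
        (hxω.pow_pow l l).inv_inv, hk, hu]
      obtain ⟨r, hr⟩ := hp.dvd_choose_self two_ne_zero (lt_of_le_of_ne hp.two_le (Ne.symm hp2))
      have hωl : (ω ^ l) ^ p = 1 := by rw [← pow_mul, mul_comm, pow_mul, hωp, one_pow]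
      rw [hr, pow_mul (ω ^ l)⁻¹, inv_pow (ω ^ l) p, hωl]
      simp [← pow_mul, mul_comm]
    apply hncomm
    have hvx : Commute (u * y) x := by
      refine commute_of_conj_mem_zpowers hf hp (isOfFinOrder_of_finite x) hv ?_
      have : u * y * x * (u * y)⁻¹ = x * ω := by
        have h1 : Commute u (x * ω) :=
          ((Commute.refl x).mul_right hxω).pow_left l |>.inv_left
        calc u * y * x * (u * y)⁻¹ = u * (y * x * y⁻¹) * u⁻¹ := by group
          _ = x * ω := by rw [hyx, h1.eq, mul_inv_cancel_right]
      rw [this, hω, hz, ← pow_mul, ← pow_mul, ← pow_succ']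
      exact Subgroup.npow_mem_zpowers _ _
    have hux : Commute u x := ((Commute.refl x).pow_left l).inv_left
    have := hux.inv_left.mul_left hvx
    rwa [inv_mul_cancel_left] at this
  · obtain ⟨r, hr⟩ := exists_pow_eq_self_of_coprime (x := x) (n := k) (by
      rw [hx]; exact ((hp.coprime_iff_not_dvd.2 hpk).symm).pow_right _)
    rw [← hk, ← pow_mul] at hr
    apply hncomm
    have := (Commute.refl y).pow_right (p * r)
    rwa [hr] at this

omit [CharZero D] in
theorem orderOf_ne_eight (x₀ : G) : orderOf x₀ ≠ 2 ^ 3 := by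
  intro h0
  obtain ⟨x, s, hs, hx, hmax⟩ := exists_max_orderOf Nat.prime_two h0
  obtain ⟨s, rfl⟩ : ∃ r, s = r + 3 := ⟨s - 3, by omega⟩
  have hx4 : x ^ 4 ≠ 1 := by
    intro h
    have h1 := Nat.le_of_dvd (by norm_num) (orderOf_dvd_of_pow_eq_one h)
    have h2 : 2 ^ 3 ≤ 2 ^ (s + 3) := Nat.pow_le_pow_right two_pos (by omega)
    omega
  set i := x ^ 2 ^ (s + 1) with hi
  set z := x ^ 2 ^ (s + 2) with hz
  have hiz : i ^ 2 = z := by rw [hi, hz, ← pow_mul, ← pow_succ]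
  have hz1 : z ^ 2 = 1 := by rw [hz, ← pow_mul, ← pow_succ, ← hx, pow_orderOf_eq_one]
  have hzne : z ≠ 1 := by
    intro h
    have := Nat.le_of_dvd (Nat.pow_pos two_pos) (orderOf_dvd_of_pow_eq_one h)
    rw [hx] at this
    exact absurd this (not_le.2 (Nat.pow_lt_pow_right one_lt_two (by omega)))
  have hzc : ∀ y, Commute z y := commute_of_sq_eq_one hf hz1
  have hzz : z⁻¹ = z := inv_eq_of_mul_eq_one_left (by rw [← sq, hz1])
  have hio : orderOf i = 2 ^ 2 :=
    orderOf_eq_prime_pow (by rwa [pow_one, hiz]) (by rw [sq 2, pow_mul, hiz, hz1])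
  obtain ⟨g, hg⟩ := hC x (1 + 2 ^ (s + 2)) (by
    rw [hx]
    refine Nat.Coprime.pow_right _ ?_
    rw [pow_succ]
    simp)
  rw [pow_add, pow_one, ← hz] at hg
  have hg2 : Commute (g ^ 2) x := by
    refine (mul_inv_eq_iff_eq_mul.1 ?_ : g ^ 2 * x = x * g ^ 2)
    have e : g ^ 2 * x * (g ^ 2)⁻¹ = g * (g * x * g⁻¹) * g⁻¹ := by rw [sq]; group
    have ez : g * z * g⁻¹ = z := by rw [(hzc g).eq.symm, mul_inv_cancel_right]
    rcases hg with hg | hg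
    · rw [e, hg, ← conj_mul, hg, ez, mul_assoc, ← sq, hz1, mul_one]
    · rw [e, hg, ← conj_inv, ← conj_mul, hg, ez, mul_inv_rev, inv_inv, (hzc x).eq.symm, hzz,
        ← mul_assoc, ← sq, hz1, one_mul]
  obtain ⟨m, t, ht, hm⟩ := exists_two_part (h := g)
  rw [← hm x hg2] at hg
  have hh2 : Commute ((g ^ m) ^ 2) x := by
    rw [← pow_mul, mul_comm, pow_mul]
    exact hg2.pow_left m
  generalize g ^ m = h at *
  obtain ⟨k, hk⟩ := exists_pow_eq_of_commute hf hh2.symm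
    (hmax (h ^ 2) t (by rw [← pow_mul, mul_comm, pow_mul, ht, one_pow]))
  rcases hg with hg | hg
  · have hn : ¬ Commute h x := by
      intro hc
      rw [hc.eq, mul_inv_cancel_right] at hg
      exact hzne (by simpa using hg)
    by_cases h2k : 2 ∣ k
    · obtain ⟨l, rfl⟩ := h2k
      have hjsq : ((x ^ l)⁻¹ * h) ^ 2 = (z ^ l)⁻¹ := by
        calc ((x ^ l)⁻¹ * h) ^ 2 = (x ^ l)⁻¹ * (h * x * h⁻¹)⁻¹ ^ l * h ^ 2 := by
              rw [sq, conj_inv, conj_pow, inv_pow, sq]; group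
          _ = (x ^ l)⁻¹ * (z ^ l)⁻¹ * (x ^ l)⁻¹ * h ^ 2 := by
              rw [hg, inv_pow, (hzc x).symm.mul_pow, mul_inv_rev]; group
          _ = (z ^ l)⁻¹ := by
              rw [hk, (((hzc x).symm.pow_pow l l).inv_inv).eq]; group
      have hji : Commute i ((x ^ l)⁻¹ * h) := by
        refine (((Commute.refl x).pow_pow _ l).inv_right).mul_right ?_
        have : h * i * h⁻¹ = i := by
          rw [hi, ← conj_pow, hg, (hzc x).symm.mul_pow, pow_succ' 2 s, pow_mul z, hz1]
          simp
        exact (mul_inv_eq_iff_eq_mul.1 this).symm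
      obtain ⟨n, hn'⟩ := exists_pow_eq_of_commute hf hji (by
        rw [hio, sq 2, pow_mul, hjsq, ← inv_pow, ← pow_mul, mul_comm, pow_mul, inv_pow, hz1]; simp)
      apply hn
      rw [inv_mul_eq_iff_eq_mul] at hn'
      rw [hn', hi]
      exact ((Commute.refl x).pow_left l).mul_left (((Commute.refl x).pow_left _).pow_left n)
    · obtain ⟨r, hr⟩ := exists_pow_eq_self_of_coprime (x := x) (n := k) (by
        rw [hx]; exact ((Nat.prime_two.coprime_iff_not_dvd.2 h2k).symm).pow_right _)
      rw [← hk, ← pow_mul] at hr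
      apply hn
      have := (Commute.refl h).pow_right (2 * r)
      rwa [hr] at this
  · have hn : ¬ Commute h x := by
      intro hc
      rw [hc.eq, mul_inv_cancel_right, eq_inv_iff_mul_eq_one, ← mul_assoc, ← sq,
        mul_eq_one_iff_eq_inv, hzz] at hg
      exact hx4 (by rw [pow_mul x 2 2, hg, hz1])
    have hxk : x ^ k * x ^ k = z ^ k := by
      have h1 : h * x ^ k * h⁻¹ = x ^ k := by rw [← hk]; group
      rw [← conj_pow, hg, inv_pow, (hzc x).symm.mul_pow, inv_eq_iff_mul_eq_one] at h1
      rw [mul_assoc, ((hzc x).pow_pow k k).eq, ← mul_assoc, mul_eq_one_iff_eq_inv, ← inv_pow,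
        hzz] at h1
      exact h1
    by_cases h2k : 2 ∣ k
    · obtain ⟨l, rfl⟩ := h2k
      have h4 : (h ^ 2) ^ 2 = 1 := by rw [hk, sq, hxk, pow_mul, hz1, one_pow]
      have h2 : h ^ 2 ≠ 1 := fun h2 => hn (commute_of_sq_eq_one hf h2 x)
      have hz2 : h ^ 2 = z := eq_of_sq_eq_one hf h4 h2 hz1 hzne
      have hhx : (h * x) ^ 2 = 1 := by
        calc (h * x) ^ 2 = (h * x * h⁻¹) * (h ^ 2) * x := by rw [sq, sq]; group
          _ = 1 := by rw [hg, hz2, mul_inv_rev, hzz, mul_assoc, (hzc x).eq, mul_assoc z,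
              inv_mul_cancel_left, ← sq, hz1]
      apply hn
      have := (commute_of_sq_eq_one hf hhx x).mul_left ((Commute.refl x).inv_left)
      rwa [mul_inv_cancel_right] at this
    · have hx4k : x ^ (4 * k) = 1 := by
        rw [show 4 * k = (k + k) * 2 by ring, pow_mul, pow_add, hxk, ← pow_mul, mul_comm,
          pow_mul, hz1, one_pow]
      obtain ⟨r, hr⟩ := exists_pow_eq_self_of_coprime (x := x) (n := k) (by
        rw [hx]; exact ((Nat.prime_two.coprime_iff_not_dvd.2 h2k).symm).pow_right _)
      apply hx4
      rw [← hr, ← pow_mul, ← pow_mul, mul_comm r, ← mul_assoc, mul_comm k, pow_mul, hx4k, one_pow]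

omit [CharZero D] in
theorem pow_four_eq_one {h : G} {t : ℕ} (ht : h ^ 2 ^ t = 1) : h ^ 4 = 1 := by
  obtain ⟨a, -, ha⟩ := (Nat.dvd_prime_pow Nat.prime_two).1 (orderOf_dvd_of_pow_eq_one ht)
  rcases Nat.lt_or_ge a 3 with h3 | h3
  · rw [← orderOf_dvd_iff_pow_eq_one, ha]
    exact Nat.pow_dvd_pow 2 (n := 2) (by omega)
  · exfalso
    refine orderOf_ne_eight hf hC (h ^ 2 ^ (a - 3)) ?_
    rw [orderOf_pow_of_dvd (by positivity) (by rw [ha]; exact Nat.pow_dvd_pow 2 (by omega)), ha,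
      Nat.pow_div (by omega) two_pos, Nat.sub_sub_self h3]

theorem squarefree_orderOf_sq (h : G) : Squarefree (orderOf (h ^ 2)) := by
  rw [Nat.squarefree_iff_prime_squarefree]
  rintro p hp ⟨d, hd⟩
  have hpos : 0 < d := Nat.pos_of_ne_zero fun h0 => (orderOf_pos (h ^ 2)).ne' (by simp [hd, h0])
  rcases eq_or_ne p 2 with rfl | hp2
  · have h1 : (h ^ d) ^ 2 ^ 3 = 1 := by
      rw [← pow_mul, show d * 2 ^ 3 = 2 * (2 * 2 * d) by ring, pow_mul, ← hd, pow_orderOf_eq_one]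
    have h2 := pow_four_eq_one hf hC h1
    rw [← pow_mul, show d * 4 = 2 * (2 * d) by ring, pow_mul, ← orderOf_dvd_iff_pow_eq_one,
      hd] at h2
    have := Nat.le_of_dvd (by positivity) h2
    omega
  · refine orderOf_ne_sq hf hC hp hp2 ((h ^ 2) ^ d) ?_
    rw [orderOf_pow_of_dvd hpos.ne' (Dvd.intro_left _ hd.symm), hd, Nat.mul_div_cancel _ hpos, sq]

theorem prime_orderOf_le_three {p : ℕ} (hp : p.Prime) {g : G} (hg : orderOf g = p) : p ≤ 3 := by
  by_contra! h3
  obtain ⟨h, hh⟩ := hC g 2 (by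
    rw [hg, Nat.coprime_primes Nat.prime_two hp]; omega)
  have e : h ^ 2 * g * (h ^ 2)⁻¹ = g ^ 4 := by
    have : h ^ 2 * g * (h ^ 2)⁻¹ = h * (h * g * h⁻¹) * h⁻¹ := by rw [sq]; group
    rw [this]
    rcases hh with hh | hh
    · rw [hh, ← conj_pow, hh, ← pow_mul]
    · rw [hh, ← conj_inv, ← conj_pow, hh, inv_pow, inv_inv, ← pow_mul]
  have hc := commute_of_squarefree hf (squarefree_orderOf_sq hf hC h) (pow_orderOf_eq_one _)
    (by rw [e]; exact Subgroup.npow_mem_zpowers g 4)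
  rw [hc.eq, mul_inv_cancel_right, pow_succ', left_eq_mul] at e
  have := Nat.le_of_dvd (by norm_num) (orderOf_dvd_of_pow_eq_one e)
  omega

end Orders

section Structure

theorem add_one_ne_zero_of_commute_anticommute {D : Type*} [DivisionRing D] [CharZero D]
    {i j ω : D} (hi : i * i = -1) (hj : j * j = -1) (hij : i * j = -(j * i)) (hωi : Commute ω i)
    (hωj : Commute ω j) : ω ^ 2 + ω + 1 ≠ 0 := by
  intro h
  have hω0 : ω ≠ 0 := by rintro rfl; simp at h
  have hi0 : i ≠ 0 := by rintro rfl; simp at hi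
  have hj0 : j ≠ 0 := by rintro rfl; simp at hj
  have hω3 : ω ^ 3 = 1 := by
    have : ω ^ 3 - 1 = (ω - 1) * (ω ^ 2 + ω + 1) := by noncomm_ring
    rw [h, mul_zero, sub_eq_zero] at this
    exact this
  have hu : (ω ^ 2 * i + ω * j) * (ω ^ 2 * i + ω * j) = 1 := by
    calc (ω ^ 2 * i + ω * j) * (ω ^ 2 * i + ω * j) =
        ω ^ 2 * (i * ω ^ 2) * i + ω ^ 2 * (i * ω) * j + ω * (j * ω ^ 2) * i
          + ω * (j * ω) * j := by noncomm_ring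
      _ = ω ^ 3 * (ω * (i * i) + (i * j + j * i)) + ω ^ 2 * (j * j) := by
        rw [← (hωi.pow_left 2).eq, ← hωi.eq, ← (hωj.pow_left 2).eq, ← hωj.eq]
        noncomm_ring
      _ = 1 := by
        rw [hω3, hi, hj, hij]
        have h' : ω ^ 2 = -(ω + 1) := by rw [eq_neg_iff_add_eq_zero, ← add_assoc, h]
        rw [h']
        noncomm_ring
  have hc : Commute (ω ^ 2 * i) j := by
    have h1 : Commute (ω ^ 2 * i + ω * j) j := by
      rcases mul_self_eq_one_iff.1 hu with hu | hu <;> rw [hu]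
      exacts [Commute.one_left j, (Commute.one_left j).neg_left]
    have := h1.sub_left (hωj.mul_left (Commute.refl j))
    rwa [add_sub_cancel_right] at this
  have hc' : Commute i j := by
    have := ((hωj.pow_left 2).inv_left₀).mul_left hc
    rwa [inv_mul_cancel_left₀ (pow_ne_zero 2 hω0)] at this
  have h2 := hij
  rw [← hc'.eq, eq_neg_iff_add_eq_zero, ← two_mul] at h2
  simp [hi0, hj0] at h2

variable {D : Type*} [DivisionRing D] {G : Type*} [Group G] {f : G →* D} [CharZero D] [Finite G]
  (hf : Function.Injective f)

omit [Finite G] in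
theorem sq_ne_one_of_orderOf_eq_four {x : G} (hx : orderOf x = 4) : x ^ 2 ≠ 1 := by
  intro h
  have := Nat.le_of_dvd two_pos (orderOf_dvd_of_pow_eq_one h)
  omega

include hf

omit [CharZero D] [Finite G] in
theorem sq_eq_sq_of_orderOf_eq_four {x y : G} (hx : orderOf x = 4) (hy : y ^ 4 = 1)
    (hy2 : y ^ 2 ≠ 1) : y ^ 2 = x ^ 2 :=
  eq_of_sq_eq_one hf (by rw [← pow_mul, hy]) hy2
    (by rw [← pow_mul]; exact orderOf_dvd_iff_pow_eq_one.1 hx.dvd)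
    (sq_ne_one_of_orderOf_eq_four hx)

omit [CharZero D] [Finite G] in
theorem map_mul_self_of_orderOf_eq_four {x : G} (hx : orderOf x = 4) : f x * f x = -1 := by
  rw [← map_mul, ← sq]
  exact map_eq_neg_one_of_sq hf (by rw [← pow_mul]; exact orderOf_dvd_iff_pow_eq_one.1 hx.dvd)
    (sq_ne_one_of_orderOf_eq_four hx)

omit [CharZero D] [Finite G] in
theorem map_mul_eq_neg_of_conj {x y : G} (hx : orderOf x = 4) (h : y * x * y⁻¹ = x⁻¹) :
    f x * f y = -(f y * f x) := by
  have h1 : y * x = x * x * (x * y) := by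
    rw [mul_inv_eq_iff_eq_mul.1 h, inv_mul_eq_iff_eq_mul, eq_comm]
    simp only [← mul_assoc]
    rw [mul_eq_right, ← pow_orderOf_eq_one x, hx]
    simp only [pow_succ, pow_zero, one_mul]
  rw [← map_mul f y, h1, map_mul, map_mul f x x, map_mul_self_of_orderOf_eq_four hf hx, map_mul]
  simp

omit [CharZero D] in
theorem conj_eq_inv_of_notMem_zpowers {x y : G} (hx : orderOf x = 4) (hy : y ^ 4 = 1)
    (hxy : (x * y) ^ 4 = 1) (h : y ∉ Subgroup.zpowers x) : y ^ 2 = x ^ 2 ∧ y * x * y⁻¹ = x⁻¹ := by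
  have hc : ¬ Commute x y := by
    intro hc
    obtain ⟨m, rfl⟩ := exists_pow_eq_of_commute hf hc (by rw [hx, hy])
    exact h (Subgroup.npow_mem_zpowers x m)
  have hy2 : y ^ 2 = x ^ 2 := sq_eq_sq_of_orderOf_eq_four hf hx hy
    fun h2 => hc (commute_of_sq_eq_one hf h2 x).symm
  have hxy2 : (x * y) ^ 2 = x ^ 2 := sq_eq_sq_of_orderOf_eq_four hf hx hxy fun h2 => by
    have := ((Commute.refl x).inv_left).mul_left (commute_of_sq_eq_one hf h2 x)
    rw [inv_mul_cancel_left] at this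
    exact hc this.symm
  refine ⟨hy2, ?_⟩
  have h1 : y * x * y = x := by
    rw [sq, sq, mul_assoc, mul_right_inj, ← mul_assoc] at hxy2
    exact hxy2
  have h4 : x ^ 2 * x ^ 2 = 1 := by rw [← pow_add]; exact orderOf_dvd_iff_pow_eq_one.1 hx.dvd
  rw [eq_inv_iff_mul_eq_one]
  have h5 : y⁻¹ = y * x ^ 2 := by rw [inv_eq_iff_mul_eq_one, ← mul_assoc, ← sq, hy2, h4]
  calc y * x * y⁻¹ * x = y * x * y * x ^ 2 * x := by rw [h5]; group
    _ = x ^ 2 * x ^ 2 := by rw [h1]; group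
    _ = 1 := h4

omit [CharZero D] in
theorem mem_zpowers_or_of_pow_four {K : Subgroup G} (hK : ∀ g ∈ K, g ^ 4 = 1) {x y : G}
    (hx : orderOf x = 4) (hxK : x ∈ K) (hyK : y ∈ K) (hy : y ∉ Subgroup.zpowers x) {w : G}
    (hw : w ∈ K) : w ∈ Subgroup.zpowers x ∨ y⁻¹ * w ∈ Subgroup.zpowers x := by
  by_cases hwx : w ∈ Subgroup.zpowers x
  · exact Or.inl hwx
  · right
    have h1 := (conj_eq_inv_of_notMem_zpowers hf hx (hK y hyK) (hK _ (mul_mem hxK hyK)) hy).2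
    have h2 := (conj_eq_inv_of_notMem_zpowers hf hx (hK w hw) (hK _ (mul_mem hxK hw)) hwx).2
    have h3 : Commute x (y⁻¹ * w) := by
      have : y⁻¹ * w * x * (y⁻¹ * w)⁻¹ = x := by
        calc y⁻¹ * w * x * (y⁻¹ * w)⁻¹ = y⁻¹ * (w * x * w⁻¹) * y := by group
          _ = y⁻¹ * (y * x * y⁻¹) * y := by rw [h1, h2]
          _ = x := by group
      exact (mul_inv_eq_iff_eq_mul.1 this).symm
    obtain ⟨m, hm⟩ := exists_pow_eq_of_commute hf h3 (by
      rw [hx]; exact hK _ (mul_mem (inv_mem hyK) hw))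
    rw [hm]
    exact Subgroup.npow_mem_zpowers x m

omit [CharZero D] [Finite G] in
theorem exists_orderOf_eq_four {K : Subgroup G} (hK : ∀ g ∈ K, g ^ 4 = 1)
    (hcard : 2 < Nat.card K) : ∃ x ∈ K, orderOf x = 4 := by
  by_contra! hn
  have h2 : ∀ x ∈ K, x ^ 2 = 1 := by
    intro x hx
    by_contra h2
    refine hn x hx ?_
    exact orderOf_eq_prime_pow (p := 2) (n := 1) (by simpa using h2) (hK x hx)
  have hf1 : ∀ x ∈ K, f x = 1 ∨ f x = -1 := by
    intro x hx
    apply mul_self_eq_one_iff.1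
    rw [← map_mul, ← sq, h2 x hx, map_one]
  have : (f '' (K : Set G)).ncard ≤ ({1, -1} : Set D).ncard :=
    Set.ncard_le_ncard (by rintro _ ⟨x, hx, rfl⟩; exact hf1 x hx) (Set.toFinite _)
  rw [Set.ncard_image_of_injective _ hf, ← Nat.card_coe_set_eq] at this
  have h3 : ({1, -1} : Set D).ncard ≤ 2 := Set.ncard_insert_le _ _ |>.trans (by simp)
  exact absurd (this.trans h3) (not_le.2 hcard)

omit [CharZero D] in
theorem card_le_eight {K : Subgroup G} (hK : ∀ g ∈ K, g ^ 4 = 1) : Nat.card K ≤ 8 := by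
  by_contra! h8
  obtain ⟨x, hxK, hx⟩ := exists_orderOf_eq_four hf hK (by omega)
  have hcx : (Subgroup.zpowers x : Set G).ncard = 4 := by
    rw [← Nat.card_coe_set_eq, ← hx]
    exact Nat.card_zpowers x
  have hle {S : Set G} (hS : (K : Set G) ⊆ S) : Nat.card K ≤ S.ncard := by
    rw [← SetLike.coe_sort_coe, Nat.card_coe_set_eq]
    exact Set.ncard_le_ncard hS
  by_cases hKx : K ≤ Subgroup.zpowers x
  · have := hle hKx
    omega
  · obtain ⟨y, hyK, hy⟩ := SetLike.not_le_iff_exists.1 hKx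
    have hS : (K : Set G) ⊆ Subgroup.zpowers x ∪ (fun g => y * g) '' Subgroup.zpowers x := by
      intro w hw
      refine (mem_zpowers_or_of_pow_four hf hK hx hxK hyK hy hw).imp id fun h => ⟨_, h, ?_⟩
      exact mul_inv_cancel_left y w
    have h1 := (hle hS).trans (Set.ncard_union_le _ _)
    have h2 := Set.ncard_image_le (f := fun g => y * g)
      (Set.toFinite (Subgroup.zpowers x : Set G))
    omega

variable (hC : ∀ (g : G) (k : ℕ), k.Coprime (orderOf g) →
    ∃ h : G, h * g * h⁻¹ = g ^ k ∨ h * g * h⁻¹ = (g ^ k)⁻¹)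

include hC

theorem not_commute_of_orderOf {i ω : G} (hi : orderOf i = 4) (hω : orderOf ω = 3) :
    ¬ Commute i ω := by
  intro hc
  have hi4 : i ^ 4 = 1 := by rw [← hi, pow_orderOf_eq_one]
  have hω3 : ω ^ 3 = 1 := by rw [← hω, pow_orderOf_eq_one]
  have ho : orderOf (i * ω) = 12 := by
    rw [hc.orderOf_mul_eq_mul_orderOf_of_coprime (by rw [hi, hω]; norm_num), hi, hω]
  have hpi : (i * ω) ^ 9 = i := by
    rw [hc.mul_pow, show 9 = 4 * 2 + 1 by rfl, pow_succ, pow_mul, hi4,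
      show 4 * 2 + 1 = 3 * 3 by rfl, pow_mul, hω3]
    simp
  have hpω : (i * ω) ^ 4 = ω := by
    rw [hc.mul_pow, hi4, pow_succ, hω3]
    simp
  obtain ⟨g, hg⟩ := hC (i * ω) 5 (by rw [ho]; norm_num)
  have key : (g * i * g⁻¹ = i ∧ g * ω * g⁻¹ = ω ^ 2) ∨ (g * i * g⁻¹ = i⁻¹ ∧ g * ω * g⁻¹ = ω) := by
    have h1 : (i * ω) ^ 45 = i := by
      rw [show 45 = 9 * (4 * 1 + 1) by rfl, pow_mul, hpi, pow_succ, pow_mul, hi4]; simp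
    have h2 : (i * ω) ^ 20 = ω ^ 2 := by
      rw [show 20 = 4 * (3 * 1 + 2) by rfl, pow_mul, hpω, pow_add, pow_mul, hω3]; simp
    rcases hg with hg | hg
    · left
      constructor
      · nth_rewrite 1 [← hpi]
        rw [← conj_pow, hg, ← pow_mul, h1]
      · nth_rewrite 1 [← hpω]
        rw [← conj_pow, hg, ← pow_mul, h2]
    · right
      constructor
      · nth_rewrite 1 [← hpi]
        rw [← conj_pow, hg, inv_pow, ← pow_mul, h1]
      · nth_rewrite 1 [← hpω]
        rw [← conj_pow, hg, inv_pow, ← pow_mul, h2, inv_eq_iff_mul_eq_one, ← pow_succ, hω3]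
  have e : ∀ y : G, g ^ 2 * y * (g ^ 2)⁻¹ = g * (g * y * g⁻¹) * g⁻¹ := by
    intro y; rw [sq]; group
  have hg2 : Commute (g ^ 2) i ∧ Commute (g ^ 2) ω := by
    constructor
    · refine (mul_inv_eq_iff_eq_mul.1 ?_ : g ^ 2 * i = i * g ^ 2)
      rcases key with ⟨h1, -⟩ | ⟨h1, -⟩
      · rw [e, h1, h1]
      · rw [e, h1, ← conj_inv, h1, inv_inv]
    · refine (mul_inv_eq_iff_eq_mul.1 ?_ : g ^ 2 * ω = ω * g ^ 2)
      rcases key with ⟨-, h1⟩ | ⟨-, h1⟩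
      · rw [e, h1, ← conj_pow, h1, ← pow_mul, pow_succ, hω3, one_mul]
      · rw [e, h1, h1]
  obtain ⟨m, t, ht, hm⟩ := exists_two_part (h := g)
  rw [← hm i hg2.1, ← hm ω hg2.2] at key
  have h4 := pow_four_eq_one hf hC ht
  generalize g ^ m = h at *
  rcases key with ⟨h1, h2⟩ | ⟨h1, h2⟩
  · obtain ⟨n, rfl⟩ := exists_pow_eq_of_commute hf (a := i) (b := h)
      (mul_inv_eq_iff_eq_mul.1 h1).symm (by rw [hi, h4])
    rw [(hc.pow_left n).eq, mul_inv_cancel_right, sq, left_eq_mul] at h2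
    rw [h2, orderOf_one] at hω
    omega
  · have hh : h ^ 2 ≠ 1 := by
      intro h3
      rw [(commute_of_sq_eq_one hf h3 i).eq, mul_inv_cancel_right, eq_inv_iff_mul_eq_one,
        ← sq] at h1
      exact sq_ne_one_of_orderOf_eq_four hi h1
    have hh4 : orderOf h = 4 :=
      orderOf_eq_prime_pow (p := 2) (n := 1) (by simpa using hh) h4
    refine add_one_ne_zero_of_commute_anticommute (ω := f ω)
      (map_mul_self_of_orderOf_eq_four hf hi) (map_mul_self_of_orderOf_eq_four hf hh4)
      (map_mul_eq_neg_of_conj hf hi h1) (Commute.map hc.symm f)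
      (Commute.map (mul_inv_eq_iff_eq_mul.1 h2).symm f) ?_
    have := sum_map_pow_eq_zero hf hω3 (by rintro rfl; simp at hω)
    rw [← this]
    simp only [Finset.sum_range_succ, Finset.sum_range_zero, pow_zero, pow_one]
    abel

theorem not_nine_dvd_card : ¬ 3 ^ 2 ∣ Nat.card G := by
  intro h
  have : Fact (Nat.Prime 3) := ⟨Nat.prime_three⟩
  obtain ⟨K, hK⟩ := Sylow.exists_subgroup_card_pow_prime 3 h
  have hcomm : ∀ a b : K, a * b = b * a :=
    (IsPGroup.isMulCommutative_of_card_eq_prime_sq hK).is_comm.comm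
  have h3 : ∀ a ∈ K, a ^ 3 = 1 := by
    intro a ha
    have hd : orderOf a ∣ 3 ^ 2 := hK ▸ Subgroup.orderOf_dvd_natCard K ha
    obtain ⟨j, hj, hj'⟩ := (Nat.dvd_prime_pow Nat.prime_three).1 hd
    have := orderOf_ne_sq hf hC Nat.prime_three (by norm_num) a
    rw [← orderOf_dvd_iff_pow_eq_one, hj']
    interval_cases j
    · simp
    · simp
    · exact absurd hj' this
  obtain ⟨a, ha, ha1⟩ : ∃ a ∈ K, a ≠ 1 := by
    by_contra! hn
    rw [(Subgroup.eq_bot_iff_forall K).2 hn] at hK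
    simp at hK
  have ho : orderOf a = 3 := orderOf_eq_prime (h3 a ha) ha1
  have hle : K ≤ Subgroup.zpowers a := by
    intro b hb
    obtain ⟨m, rfl⟩ := exists_pow_eq_of_commute hf (a := a) (b := b)
      (congrArg Subtype.val (hcomm ⟨a, ha⟩ ⟨b, hb⟩)) (by rw [ho, h3 b hb])
    exact Subgroup.npow_mem_zpowers a m
  have := Subgroup.card_le_of_le hle
  rw [hK, Nat.card_zpowers, ho] at this
  omega

theorem card_dvd_twenty_four : Nat.card G ∣ 24 := by
  rw [Nat.dvd_iff_prime_pow_dvd_dvd]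
  intro p k hp hk
  have : Fact p.Prime := ⟨hp⟩
  rcases Nat.eq_zero_or_pos k with rfl | hk0
  · simp
  obtain ⟨g, hg⟩ := exists_prime_orderOf_dvd_card' p ((dvd_pow_self p hk0.ne').trans hk)
  have h3 := prime_orderOf_le_three hf hC hp hg
  have h2 := hp.two_le
  interval_cases p
  · refine (pow_dvd_pow 2 (n := 3) ?_).trans (by norm_num)
    by_contra! hk3
    obtain ⟨K, hK⟩ := Sylow.exists_subgroup_card_pow_prime 2 ((pow_dvd_pow 2 hk3).trans hk)
    have := card_le_eight hf (K := K) fun g hg =>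
      pow_four_eq_one hf hC (t := 4) (by
        rw [← orderOf_dvd_iff_pow_eq_one]
        exact hK ▸ Subgroup.orderOf_dvd_natCard K hg)
    rw [hK] at this
    norm_num at this
  · refine (pow_dvd_pow 3 (n := 1) ?_).trans (by norm_num)
    by_contra! hk2
    exact not_nine_dvd_card hf hC ((pow_dvd_pow 3 hk2).trans hk)

end Structure

section Quaternion

theorem exists_injective_quaternionGroup {G : Type*} [Group G] {n : ℕ} {a y : G}
    (ha : orderOf a = 2 * n) (hy : y ^ 2 = a ^ n) (hya : y * a * y⁻¹ = a⁻¹)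
    (h : y ∉ Subgroup.zpowers a) : ∃ F : QuaternionGroup n →* G, Function.Injective F := by
  let e : ZMod (2 * n) →+ Additive G := ZMod.lift (2 * n)
    ⟨zmultiplesHom (Additive G) (Additive.ofMul a), by
      rw [zmultiplesHom_apply, natCast_zsmul, ← ofMul_pow, ← ha, pow_orderOf_eq_one, ofMul_one]⟩
  let φ : ZMod (2 * n) → G := fun i => (e i).toMul
  have hφ (k : ℤ) : φ k = a ^ k := by simp [φ, e]
  have hadd (i j : ZMod (2 * n)) : φ (i + j) = φ i * φ j := by simp [φ]
  have hneg (i : ZMod (2 * n)) : φ (-i) = (φ i)⁻¹ := by simp [φ]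
  have hn : φ (n : ZMod (2 * n)) = y ^ 2 := by
    rw [hy, ← zpow_natCast, ← hφ]; simp
  have hconj (i : ZMod (2 * n)) : φ i * y = y * (φ i)⁻¹ := by
    obtain ⟨k, rfl⟩ := ZMod.intCast_surjective i
    have h1 : y * a ^ k * y⁻¹ = (a ^ k)⁻¹ := by rw [← conj_zpow, hya, inv_zpow]
    rw [hφ, ← h1]
    have h2 : y * a⁻¹ * y⁻¹ = a := by rw [← conj_inv, hya, inv_inv]
    have h3 : y * (a ^ k)⁻¹ * y⁻¹ = a ^ k := by rw [← inv_zpow, ← conj_zpow, h2]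
    nth_rewrite 1 [← h3]
    rw [inv_mul_cancel_right, h1]
  have hinj (i : ZMod (2 * n)) (hi : φ i = 1) : i = 0 := by
    obtain ⟨k, rfl⟩ := ZMod.intCast_surjective i
    rw [hφ, ← orderOf_dvd_iff_zpow_eq_one, ha] at hi
    exact (ZMod.intCast_zmod_eq_zero_iff_dvd _ _).2 hi
  let F : QuaternionGroup n →* G := MonoidHom.mk' (fun
    | .a i => φ i
    | .xa i => y * φ i) (by
      rintro (i | i) (j | j)
      · simp [hadd]
      · rw [QuaternionGroup.a_mul_xa]
        simp only [sub_eq_neg_add, hadd, hneg]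
        rw [← mul_assoc, ← hconj, mul_assoc]
      · simp [hadd, mul_assoc]
      · rw [QuaternionGroup.xa_mul_xa, add_sub_assoc]
        simp only [sub_eq_neg_add, hadd, hneg, hn]
        rw [mul_assoc, ← mul_assoc (φ i), hconj, sq]
        simp only [mul_assoc])
  refine ⟨F, (injective_iff_map_eq_one F).2 ?_⟩
  rintro (i | i) hi
  · rw [hinj i hi]; rfl
  · refine absurd ?_ h
    obtain ⟨k, rfl⟩ := ZMod.intCast_surjective i
    have h1 : y * φ k = 1 := hi
    rw [mul_eq_one_iff_eq_inv.1 h1, hφ]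
    exact inv_mem (Subgroup.zpow_mem_zpowers a k)

theorem nonempty_mulEquiv_quaternionGroup {G : Type*} [Group G] {n : ℕ} [NeZero n]
    {a y : G} (ha : orderOf a = 2 * n) (hy : y ^ 2 = a ^ n) (hya : y * a * y⁻¹ = a⁻¹)
    (h : y ∉ Subgroup.zpowers a) (hcard : Nat.card G = 4 * n) :
    Nonempty (G ≃* QuaternionGroup n) := by
  obtain ⟨F, hF⟩ := exists_injective_quaternionGroup ha hy hya h
  have : Finite G := Nat.finite_of_card_ne_zero (by rw [hcard]; simp [NeZero.ne n])
  have hb : Function.Bijective F := by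
    rw [Nat.bijective_iff_injective_and_card]
    exact ⟨hF, by rw [hcard, Nat.card_eq_fintype_card, QuaternionGroup.card]⟩
  exact ⟨(MulEquiv.ofBijective F hb).symm⟩

end Quaternion

section Binary

theorem two_mul_eq_neg_of_conj {D : Type*} [DivisionRing D] [CharZero D] {I J W : D}
    (hI : I * I = -1) (hJ : J * J = -1) (hIJ : I * J = -(J * I)) (hWI : W * I = J * W)
    (hWJ : W * J = I * J * W) (hW : W ^ 3 = 1) : 2 * W = -(1 + I + J + I * J) := by
  have hJI : J * I = -(I * J) := by rw [hIJ, neg_neg]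
  have hI' (x : D) : I * (I * x) = -x := by rw [← mul_assoc, hI, neg_one_mul]
  have hJ' (x : D) : J * (J * x) = -x := by rw [← mul_assoc, hJ, neg_one_mul]
  have hJI' (x : D) : J * (I * x) = -(I * (J * x)) := by
    rw [← mul_assoc, hJI, neg_mul, mul_assoc]
  have hWI' (x : D) : W * (I * x) = J * (W * x) := by rw [← mul_assoc, hWI, mul_assoc]
  have hWJ' : W * J = I * (J * W) := by rw [hWJ, mul_assoc]
  have two : (2 : D) = 1 + 1 := one_add_one_eq_two.symm
  have four : (4 : D) = 1 + 1 + 1 + 1 := by norm_num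
  have eight : (8 : D) = 1 + 1 + 1 + 1 + 1 + 1 + 1 + 1 := by norm_num
  set p := I + J + I * J - 1 with hp
  have hpW : Commute p W := by
    change p * W = W * p
    simp only [hp, add_mul, mul_add, sub_mul, mul_sub, mul_assoc, hWI, hWI', hWJ', hJI', hJ',
      mul_one, one_mul, mul_neg]
    abel
  have hp2 : p * p = -(2 * p) - 4 := by
    rw [four, two]
    simp only [hp, add_mul, mul_add, sub_mul, mul_sub, mul_assoc, hI, hJ, hI', hJI, hJI',
      mul_one, one_mul, mul_neg]
    abel
  have hp3 : p ^ 3 = 8 := by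
    have : p ^ 3 = p * (p * p) := by noncomm_ring
    rw [this, hp2, mul_sub, mul_neg, ← mul_assoc, mul_two, add_mul, hp2, four, eight]
    noncomm_ring
  have hpI : Commute (p * W) I := by
    have h : p * J = I * p := by
      simp only [hp, add_mul, mul_add, sub_mul, mul_sub, mul_assoc, hI, hJ, hI', mul_one, one_mul,
        mul_neg]
      abel
    change p * W * I = I * (p * W)
    rw [mul_assoc, hWI, ← mul_assoc, h, mul_assoc]
  have hpJ : Commute (p * W) J := by
    have h : p * (I * J) = J * p := by
      simp only [hp, add_mul, mul_add, sub_mul, mul_sub, mul_assoc, hI, hJ, hI', hJI, hJI',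
        mul_one, one_mul, mul_neg]
      abel
    change p * W * J = J * (p * W)
    rw [mul_assoc, hWJ, ← mul_assoc, h, mul_assoc]
  have h2 (x : D) : Commute (2 : D)⁻¹ x := (Commute.ofNat_left 2 x).inv_left₀
  set c := 2⁻¹ * (p * W) with hc
  have hc3 : c ^ 3 = 1 := by
    rw [hc, (h2 _).mul_pow, hpW.mul_pow, hp3, hW]
    norm_num
  have hc1 : c = 1 := by
    by_contra hne
    have h : (c - 1) * (c ^ 2 + c + 1) = 0 := by
      have : (c - 1) * (c ^ 2 + c + 1) = c ^ 3 - 1 := by noncomm_ring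
      rw [this, hc3, sub_self]
    exact add_one_ne_zero_of_commute_anticommute hI hJ hIJ ((h2 I).mul_left hpI)
      ((h2 J).mul_left hpJ) ((mul_eq_zero.1 h).resolve_left (sub_ne_zero.2 hne))
  have hpW2 : p * W = 2 := by
    rw [hc, inv_mul_eq_one₀ two_ne_zero] at hc1
    exact hc1.symm
  have h8 : 4 * (2 * W) = 4 * -(1 + I + J + I * J) := by
    calc 4 * (2 * W) = p ^ 3 * W := by rw [hp3, eight, four]; noncomm_ring
      _ = p * p * (p * W) := by noncomm_ring
      _ = 4 * -(1 + I + J + I * J) := by rw [hpW2, hp2, hp, four]; noncomm_ring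
  exact mul_left_cancel₀ (by norm_num) h8

theorem exists_slHom {D : Type*} [DivisionRing D] [CharZero D] {I J W : D}
    (hI : I * I = -1) (hJ : J * J = -1) (hIJ : I * J = -(J * I))
    (hW : 2 * W = -(1 + I + J + I * J)) :
    ∃ ψ : Matrix.SpecialLinearGroup (Fin 2) (ZMod 3) →* D, Function.Injective ψ ∧
      ψ slI = I ∧ ψ slJ = J ∧ ψ slW = W := by
  let q : QuaternionAlgebra.Basis D (-1 : ℚ) 0 (-1) :=
    { i := I
      j := J
      k := I * J
      i_mul_i := by simp [hI]
      j_mul_j := by simp [hJ]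
      i_mul_j := rfl
      j_mul_i := by simp [hIJ] }
  let L : Quaternion ℚ →ₐ[ℚ] D := q.liftHom
  have hL (x : Quaternion ℚ) :
      L x = algebraMap ℚ D x.re + x.imI • I + x.imJ • J + x.imK • (I * J) := rfl
  refine ⟨(L : Quaternion ℚ →* D).comp slQuaternion,
    L.toRingHom.injective.comp slQuaternion_injective, ?_, ?_, ?_⟩
  · change L (slQuaternion slI) = I
    rw [hL, slQuaternion_slI]
    simp
  · change L (slQuaternion slJ) = J
    rw [hL, slQuaternion_slJ]
    simp
  · change L (slQuaternion slW) = W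
    apply mul_left_cancel₀ (two_ne_zero (α := D))
    rw [hW, hL, slQuaternion_slW, Algebra.algebraMap_eq_smul_one, ← smul_add, ← smul_add,
      ← smul_add, mul_smul_comm, two_mul, ← two_smul ℚ, smul_smul]
    norm_num
    abel

end Binary

section Classification

variable {D : Type*} [DivisionRing D] {G : Type*} [Group G] {f : G →* D} [CharZero D] [Finite G]

theorem nonempty_mulEquiv_zmod {G : Type*} [Group G] [IsCyclic G] {n : ℕ}
    (h : Nat.card G = n) : Nonempty (G ≃* Multiplicative (ZMod n)) :=
  ⟨mulEquivOfCyclicCardEq (by rw [h]; exact (Nat.card_zmod n).symm)⟩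

omit [CharZero D] in
theorem pow_four_eq_one_of_card (hf : Function.Injective f)
    (hC : ∀ (g : G) (k : ℕ), k.Coprime (orderOf g) →
      ∃ h : G, h * g * h⁻¹ = g ^ k ∨ h * g * h⁻¹ = (g ^ k)⁻¹)
    {K : Subgroup G} {t : ℕ} (hK : Nat.card K ∣ 2 ^ t) (g : G) (hg : g ∈ K) : g ^ 4 = 1 := by
  refine pow_four_eq_one hf hC (t := t) ?_
  rw [← orderOf_dvd_iff_pow_eq_one]
  exact (Subgroup.orderOf_dvd_natCard K hg).trans hK

omit [CharZero D] in
theorem isCyclic_of_card_eq_six (hf : Function.Injective f) (h : Nat.card G = 6) :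
    IsCyclic G := by
  have : Fact (Nat.Prime 2) := ⟨Nat.prime_two⟩
  have : Fact (Nat.Prime 3) := ⟨Nat.prime_three⟩
  obtain ⟨z, hz⟩ := exists_prime_orderOf_dvd_card' (G := G) 2 (by rw [h]; norm_num)
  obtain ⟨ω, hω⟩ := exists_prime_orderOf_dvd_card' (G := G) 3 (by rw [h]; norm_num)
  have hc := commute_of_sq_eq_one hf (by rw [← hz, pow_orderOf_eq_one]) ω
  refine isCyclic_of_orderOf_eq_card (z * ω) ?_
  rw [hc.orderOf_mul_eq_mul_orderOf_of_coprime (by rw [hz, hω]; norm_num), hz, hω, h]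

omit [CharZero D] in
theorem nonempty_mulEquiv_quaternionGroup_two (hf : Function.Injective f)
    (hG : ∀ g : G, g ^ 4 = 1) (h : Nat.card G = 8) : Nonempty (G ≃* QuaternionGroup 2) := by
  obtain ⟨x, -, hx⟩ := exists_orderOf_eq_four hf (K := ⊤) (fun g _ => hG g)
    (by rw [Subgroup.card_top, h]; norm_num)
  obtain ⟨y, hy⟩ : ∃ y, y ∉ Subgroup.zpowers x := by
    by_contra! hn
    have := isCyclic_of_orderOf_eq_card x
    have h1 := Nat.card_zpowers x
    rw [(Subgroup.eq_top_iff' _).2 hn, Subgroup.card_top] at h1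
    omega
  obtain ⟨h1, h2⟩ := conj_eq_inv_of_notMem_zpowers hf hx (hG y) (hG _) hy
  exact nonempty_mulEquiv_quaternionGroup hx h1 h2 hy h

theorem nonempty_mulEquiv_quaternionGroup_three (hf : Function.Injective f)
    (hC : ∀ (g : G) (k : ℕ), k.Coprime (orderOf g) →
      ∃ h : G, h * g * h⁻¹ = g ^ k ∨ h * g * h⁻¹ = (g ^ k)⁻¹)
    (h : Nat.card G = 12) : Nonempty (G ≃* QuaternionGroup 3) := by
  have : Fact (Nat.Prime 2) := ⟨Nat.prime_two⟩
  have : Fact (Nat.Prime 3) := ⟨Nat.prime_three⟩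
  obtain ⟨K, hK⟩ := Sylow.exists_subgroup_card_pow_prime (G := G) 2 (n := 2) (by rw [h]; norm_num)
  obtain ⟨i, -, hi⟩ := exists_orderOf_eq_four hf
    (pow_four_eq_one_of_card hf hC hK.dvd) (by rw [hK]; norm_num)
  obtain ⟨ω, hω⟩ := exists_prime_orderOf_dvd_card' (G := G) 3 (by rw [h]; norm_num)
  have hiω := not_commute_of_orderOf hf hC hi hω
  have hi4 : i ^ 4 = 1 := by rw [← hi, pow_orderOf_eq_one]
  have hω3 : ω ^ 3 = 1 := by rw [← hω, pow_orderOf_eq_one]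
  have hz : orderOf (i ^ 2) = 2 :=
    orderOf_eq_prime (by rw [← pow_mul, hi4]) (sq_ne_one_of_orderOf_eq_four hi)
  have hzω : Commute (i ^ 2) ω := commute_of_sq_eq_one hf (by rw [← pow_mul, hi4]) ω
  have ha : orderOf (i ^ 2 * ω) = 2 * 3 := by
    rw [hzω.orderOf_mul_eq_mul_orderOf_of_coprime (by rw [hz, hω]; norm_num), hz, hω]
  have haω : (i ^ 2 * ω) ^ 4 = ω := by
    rw [hzω.mul_pow, ← pow_mul, show 2 * 4 = 4 * 2 by rfl, pow_mul, hi4, pow_succ ω, hω3]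
    simp
  have hn : (Subgroup.zpowers (i ^ 2 * ω)).Normal := by
    apply Subgroup.normal_of_index_eq_two
    have := Subgroup.card_mul_index (Subgroup.zpowers (i ^ 2 * ω))
    rw [Nat.card_zpowers, ha, h] at this
    omega
  have hωa : ω ∈ Subgroup.zpowers (i ^ 2 * ω) := by
    have := Subgroup.npow_mem_zpowers (i ^ 2 * ω) 4
    rwa [haω] at this
  have hconj : i * ω * i⁻¹ = ω⁻¹ := by
    have h1 : Commute ω (i * ω * i⁻¹) := by
      have : IsMulCommutative (Subgroup.zpowers (i ^ 2 * ω)) := inferInstance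
      exact congrArg Subtype.val (this.is_comm.comm ⟨ω, hωa⟩ ⟨_, hn.conj_mem ω hωa i⟩)
    obtain ⟨m, hm⟩ := exists_pow_eq_of_commute hf h1 (by rw [hω, conj_pow, hω3]; simp)
    have hm' : ω ^ m = ω ^ (m % 3) := by rw [← hω, pow_mod_orderOf]
    have hm3 : m % 3 < 3 := Nat.mod_lt _ (by norm_num)
    rw [hm'] at hm
    interval_cases m % 3
    · rw [pow_zero, conj_eq_one_iff] at hm
      rw [hm, orderOf_one] at hω
      omega
    · rw [pow_one] at hm
      exact absurd (mul_inv_eq_iff_eq_mul.1 hm) hiω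
    · rw [hm, eq_inv_iff_mul_eq_one, ← pow_succ, hω3]
  refine nonempty_mulEquiv_quaternionGroup ha (y := i) ?_ ?_ ?_ h
  · rw [hzω.mul_pow, hω3, ← pow_mul, show 2 * 3 = 4 + 2 by rfl, pow_add, hi4]
    simp
  · have h2 : i * i ^ 2 * i⁻¹ = (i ^ 2)⁻¹ := by
      rw [eq_inv_iff_mul_eq_one, ← hi4]; group
    rw [← conj_mul, h2, hconj, hzω.inv_inv.eq, mul_inv_rev]
  · intro hmem
    have : IsMulCommutative (Subgroup.zpowers (i ^ 2 * ω)) := inferInstance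
    exact hiω (congrArg Subtype.val (this.is_comm.comm ⟨i, hmem⟩ ⟨ω, hωa⟩))

theorem exists_normal_four_le_card (h : Nat.card G = 24) :
    ∃ (N : Subgroup G) (_ : N.Normal), Nat.card N ∣ 8 ∧ 4 ≤ Nat.card N := by
  have : Fact (Nat.Prime 2) := ⟨Nat.prime_two⟩
  obtain ⟨P, hP⟩ := Sylow.exists_subgroup_card_pow_prime (G := G) 2 (n := 3) (by rw [h]; norm_num)
  refine ⟨P.normalCore, inferInstance, ?_, ?_⟩
  · exact (Subgroup.card_dvd_of_le P.normalCore_le).trans (by rw [hP]; norm_num)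
  · have h1 : P.index = 3 := by
      have := P.card_mul_index
      rw [hP, h] at this
      omega
    have h2 : P.normalCore.index ∣ 6 := by
      rw [P.normalCore_eq_ker, Subgroup.index_ker]
      refine (Subgroup.card_subgroup_dvd_card _).trans ?_
      rw [Nat.card_perm, ← Subgroup.index_eq_card, h1]
      rfl
    have h3 := P.normalCore.card_mul_index
    have h4 := Nat.le_of_dvd (by norm_num) h2
    rw [h] at h3
    by_contra! h5
    nlinarith

theorem nonempty_mulEquiv_specialLinearGroup_of_conj (hf : Function.Injective f) {i j ω : G}
    (hi : orderOf i = 4) (hj : orderOf j = 4) (hji : j * i * j⁻¹ = i⁻¹) (hω : ω ^ 3 = 1)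
    (hωi : ω * i * ω⁻¹ = j) (hωj : ω * j * ω⁻¹ = i * j) (h : Nat.card G = 24) :
    Nonempty (G ≃* Matrix.SpecialLinearGroup (Fin 2) (ZMod 3)) := by
  have hI := map_mul_self_of_orderOf_eq_four hf hi
  have hJ := map_mul_self_of_orderOf_eq_four hf hj
  have hIJ := map_mul_eq_neg_of_conj hf hi hji
  obtain ⟨ψ, hψ, hψI, hψJ, hψW⟩ := exists_slHom hI hJ hIJ
    (two_mul_eq_neg_of_conj (W := f ω) hI hJ hIJ
      (by rw [← map_mul, ← map_mul, mul_inv_eq_iff_eq_mul.1 hωi])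
      (by rw [← map_mul, ← map_mul, ← map_mul, mul_inv_eq_iff_eq_mul.1 hωj])
      (by rw [← map_pow, hω, map_one]))
  have hg (s) : ∃ g, f g = ψ s := by
    obtain ⟨a, b, c, rfl⟩ := exists_pow_mul_pow_mul_pow s
    exact ⟨i ^ (a : ℕ) * j ^ (b : ℕ) * ω ^ (c : ℕ), by simp [hψI, hψJ, hψW]⟩
  choose g hg using hg
  let F : Matrix.SpecialLinearGroup (Fin 2) (ZMod 3) →* G :=
    MonoidHom.mk' g fun s t => hf (by rw [map_mul, hg, hg, hg, map_mul])
  have hF : Function.Injective F := fun s t hst =>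
    hψ (by rw [← hg, ← hg]; exact congrArg f hst)
  have hb : Function.Bijective F := by
    rw [Nat.bijective_iff_injective_and_card]
    exact ⟨hF, by rw [h, nat_card_sl]⟩
  exact ⟨(MulEquiv.ofBijective F hb).symm⟩

theorem nonempty_mulEquiv_specialLinearGroup (hf : Function.Injective f)
    (hC : ∀ (g : G) (k : ℕ), k.Coprime (orderOf g) →
      ∃ h : G, h * g * h⁻¹ = g ^ k ∨ h * g * h⁻¹ = (g ^ k)⁻¹)
    (h : Nat.card G = 24) :
    Nonempty (G ≃* Matrix.SpecialLinearGroup (Fin 2) (ZMod 3)) := by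
  have : Fact (Nat.Prime 3) := ⟨Nat.prime_three⟩
  obtain ⟨N, hN, hN8, hN4⟩ := exists_normal_four_le_card h
  have hN4' := pow_four_eq_one_of_card hf hC (t := 3) hN8
  obtain ⟨i, hiN, hi⟩ := exists_orderOf_eq_four hf hN4' (by omega)
  obtain ⟨ω, hω⟩ := exists_prime_orderOf_dvd_card' (G := G) 3 (by rw [h]; norm_num)
  have hω3 : ω ^ 3 = 1 := by rw [← hω, pow_orderOf_eq_one]
  have hmem {x : G} (hx : orderOf x = 4) : ω * x * ω⁻¹ ∉ Subgroup.zpowers x := fun hmem =>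
    not_commute_of_orderOf hf hC hx hω
      (commute_of_conj_mem_zpowers hf Nat.prime_three (isOfFinOrder_of_finite x) hω3 hmem).symm
  have hord {x : G} (hx : orderOf x = 4) : orderOf (ω * x * ω⁻¹) = 4 := by
    rw [← hx]
    exact (MulAut.conj ω).orderOf_eq x
  obtain ⟨j, hj⟩ : ∃ j, ω * i * ω⁻¹ = j := ⟨_, rfl⟩
  obtain ⟨k, hk⟩ : ∃ k, ω * j * ω⁻¹ = k := ⟨_, rfl⟩
  have hjN : j ∈ N := hj ▸ hN.conj_mem i hiN ω
  have hkN : k ∈ N := hk ▸ hN.conj_mem j hjN ω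
  have hj4 : orderOf j = 4 := hj ▸ hord hi
  have hji : j ∉ Subgroup.zpowers i := hj ▸ hmem hi
  have hkj : k ∉ Subgroup.zpowers j := hk ▸ hmem hj4
  have hki : k ∉ Subgroup.zpowers i := by
    rintro ⟨m, hm : i ^ m = k⟩
    have h1 : j ^ m = i := by
      rw [← hj, conj_zpow, hm, ← hk, ← hj]
      calc ω * (ω * (ω * i * ω⁻¹) * ω⁻¹) * ω⁻¹ = ω ^ 3 * i * (ω ^ 3)⁻¹ := by
            rw [pow_succ, pow_two]; group
        _ = i := by rw [hω3]; simp
    have h2 : ω⁻¹ * j * ω⁻¹⁻¹ ∈ Subgroup.zpowers j :=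
      ⟨m, show j ^ m = _ by rw [h1, ← hj]; group⟩
    have h3 := commute_of_conj_mem_zpowers hf Nat.prime_three (isOfFinOrder_of_finite j)
      (by rw [inv_pow, hω3, inv_one]) h2
    exact not_commute_of_orderOf hf hC hj4 hω (Commute.inv_left_iff.1 h3).symm
  obtain ⟨hj2, hjij⟩ := conj_eq_inv_of_notMem_zpowers hf hi (hN4' j hjN)
    (hN4' _ (mul_mem hiN hjN)) hji
  have hi4 : i ^ 4 = 1 := by rw [← hi, pow_orderOf_eq_one]
  have hji' : j * i = i⁻¹ * j := mul_inv_eq_iff_eq_mul.1 hjij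
  have hji'' : j * i⁻¹ = i * j := by
    rw [← mul_inv_eq_iff_eq_mul, ← conj_inv, hjij, inv_inv]
  obtain ⟨m, hm⟩ : ∃ m : Fin 4, j⁻¹ * k = i ^ (m : ℕ) := by
    have := (mem_zpowers_or_of_pow_four hf hN4' hi hiN hjN hji hkN).resolve_left hki
    rw [← mem_powers_iff_mem_zpowers, Submonoid.mem_powers_iff] at this
    obtain ⟨m, hm⟩ := this
    refine ⟨⟨m % 4, Nat.mod_lt _ (by norm_num)⟩, ?_⟩
    rw [← hm, ← pow_mod_orderOf, hi]
  rw [inv_mul_eq_iff_eq_mul] at hm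
  fin_cases m
  · refine absurd ?_ hkj
    simp only [pow_zero, mul_one] at hm
    exact hm ▸ Subgroup.mem_zpowers j
  · have hm : k = i⁻¹ * j := by rw [← hji', hm]; simp
    refine nonempty_mulEquiv_specialLinearGroup_of_conj hf (i := i⁻¹) (j := j⁻¹) (ω := ω)
      (by simpa) (by simpa) ?_ hω3 ?_ ?_ h
    · have : j⁻¹ * i⁻¹ * j⁻¹⁻¹ = j⁻¹ * (i⁻¹ * j) := by group
      rw [this, ← hji']
      group
    · rw [← conj_inv, hj]
    · rw [← conj_inv, hk, hm, mul_inv_rev, inv_inv]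
      rw [← inv_inj]
      simp only [mul_inv_rev, inv_inv]
      exact hji'.symm
  · refine absurd ?_ hkj
    rw [hm]
    change j * i ^ 2 ∈ _
    rw [← hj2]
    exact mul_mem (Subgroup.mem_zpowers j) (Subgroup.npow_mem_zpowers j 2)
  · refine nonempty_mulEquiv_specialLinearGroup_of_conj hf hi hj4 hjij hω3 hj ?_ h
    rw [hk, hm, ← hji'', mul_right_inj, eq_inv_iff_mul_eq_one, ← pow_succ]
    exact hi4

theorem nonempty_mulEquiv_of_conj_eq_pow (hf : Function.Injective f)
    (hC : ∀ (g : G) (k : ℕ), k.Coprime (orderOf g) →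
      ∃ h : G, h * g * h⁻¹ = g ^ k ∨ h * g * h⁻¹ = (g ^ k)⁻¹) :
    Nonempty (G ≃* Multiplicative (ZMod 1)) ∨
     Nonempty (G ≃* Multiplicative (ZMod 2)) ∨
     Nonempty (G ≃* Multiplicative (ZMod 3)) ∨
     Nonempty (G ≃* Multiplicative (ZMod 4)) ∨
     Nonempty (G ≃* Multiplicative (ZMod 6)) ∨
     Nonempty (G ≃* QuaternionGroup 3) ∨
     Nonempty (G ≃* QuaternionGroup 2) ∨
     Nonempty (G ≃* Matrix.SpecialLinearGroup (Fin 2) (ZMod 3)) := by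
  have h2 : Fact (Nat.Prime 2) := ⟨Nat.prime_two⟩
  have h3 : Fact (Nat.Prime 3) := ⟨Nat.prime_three⟩
  have hG (t : ℕ) (ht : Nat.card G ∣ 2 ^ t) (g : G) : g ^ 4 = 1 :=
    pow_four_eq_one_of_card hf hC (K := ⊤) (t := t) (by rwa [Subgroup.card_top]) g trivial
  have hd := card_dvd_twenty_four hf hC
  have hle := Nat.le_of_dvd (by norm_num) hd
  generalize hn : Nat.card G = n at *
  interval_cases n <;> first | (norm_num at hd; done) | skip
  · have := (Nat.card_eq_one_iff_unique.1 hn).1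
    exact Or.inl (nonempty_mulEquiv_zmod hn)
  · have := isCyclic_of_prime_card hn
    exact Or.inr (Or.inl (nonempty_mulEquiv_zmod hn))
  · have := isCyclic_of_prime_card hn
    exact Or.inr (Or.inr (Or.inl (nonempty_mulEquiv_zmod hn)))
  · obtain ⟨x, -, hx⟩ := exists_orderOf_eq_four hf (K := ⊤)
      (fun g _ => hG 2 (by norm_num) g) (by rw [Subgroup.card_top, hn]; norm_num)
    have := isCyclic_of_orderOf_eq_card x (hx.trans hn.symm)
    exact Or.inr (Or.inr (Or.inr (Or.inl (nonempty_mulEquiv_zmod hn))))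
  · have := isCyclic_of_card_eq_six hf hn
    exact Or.inr (Or.inr (Or.inr (Or.inr (Or.inl (nonempty_mulEquiv_zmod hn)))))
  · have := nonempty_mulEquiv_quaternionGroup_two hf (hG 3 (by norm_num)) hn
    tauto
  · have := nonempty_mulEquiv_quaternionGroup_three hf hC hn
    tauto
  · have := nonempty_mulEquiv_specialLinearGroup hf hC hn
    tauto

end Classification

section Converse

/-- `G` embeds in the unit group of a finite-dimensional division `ℚ`-algebra. -/
def EmbedsInDivisionAlgebra (G : Type*) [Group G] : Prop :=
  ∃ (D : Type) (_ : DivisionRing D) (_ : Algebra ℚ D) (_ : FiniteDimensional ℚ D)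
    (f : G →* Dˣ), Function.Injective f

theorem EmbedsInDivisionAlgebra.of_injective {G H : Type*} [Group G] [Group H]
    (h : EmbedsInDivisionAlgebra H) {φ : G →* H} (hφ : Function.Injective φ) :
    EmbedsInDivisionAlgebra G := by
  obtain ⟨D, i1, i2, i3, f, hf⟩ := h
  exact ⟨D, i1, i2, i3, f.comp φ, hf.comp hφ⟩

theorem embedsInDivisionAlgebra_specialLinearGroup :
    EmbedsInDivisionAlgebra (Matrix.SpecialLinearGroup (Fin 2) (ZMod 3)) :=
  ⟨Quaternion ℚ, inferInstance, inferInstance, inferInstance, slQuaternion.toHomUnits,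
    fun _ _ h => slQuaternion_injective (congrArg Units.val h)⟩

theorem notMem_zpowers_of_not_commute {G : Type*} [Group G] {x y : G} (h : ¬ Commute x y) :
    y ∉ Subgroup.zpowers x := by
  rintro ⟨m, rfl⟩
  exact h ((Commute.refl x).zpow_right m)

theorem embedsInDivisionAlgebra_quaternionGroup_two :
    EmbedsInDivisionAlgebra (QuaternionGroup 2) := by
  have hI : orderOf slI = 2 * 2 :=
    orderOf_eq_prime_pow (p := 2) (n := 1) (by decide +kernel) (by decide +kernel)
  obtain ⟨F, hF⟩ := exists_injective_quaternionGroup (a := slI) (y := slJ) hI (by decide +kernel)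
    (by decide +kernel) (notMem_zpowers_of_not_commute fun h => absurd h.eq (by decide +kernel))
  exact embedsInDivisionAlgebra_specialLinearGroup.of_injective hF

theorem exists_injective_quaternionGroup_three_units {K : Type*} [Field K] [LinearOrder K]
    [IsStrictOrderedRing K] {r : K} (hr : r * r = 3) :
    ∃ F : QuaternionGroup 3 →* (Quaternion K)ˣ, Function.Injective F := by
  obtain ⟨a, a0, a1, a2, a3⟩ : ∃ a : Quaternion K,
      a.re = 1 / 2 ∧ a.imI = r / 2 ∧ a.imJ = 0 ∧ a.imK = 0 :=
    ⟨⟨1 / 2, r / 2, 0, 0⟩, rfl, rfl, rfl, rfl⟩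
  obtain ⟨y, y0, y1, y2, y3⟩ : ∃ y : Quaternion K,
      y.re = 0 ∧ y.imI = 0 ∧ y.imJ = 1 ∧ y.imK = 0 :=
    ⟨⟨0, 0, 1, 0⟩, rfl, rfl, rfl, rfl⟩
  have hr0 : r ≠ 0 := by rintro h; simp [h] at hr
  have ha2 : a * a = a - 1 := by
    apply Quaternion.ext
    · simp only [Quaternion.re_mul, Quaternion.re_sub, Quaternion.re_one, a0, a1, a2, a3]
      linear_combination (-1 / 4) * hr
    all_goals simp [a0, a1, a2, a3, Quaternion.imI_one, Quaternion.imJ_one, Quaternion.imK_one]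
    ring
  have ha3 : a * (a * a) = -1 := by
    rw [ha2, mul_sub, ha2]
    noncomm_ring
  have hy2 : y * y = -1 := by
    apply Quaternion.ext <;> simp [y0, y1, y2, y3, Quaternion.re_one, Quaternion.imI_one,
      Quaternion.imJ_one, Quaternion.imK_one]
  have hya : a * y * a = y := by
    apply Quaternion.ext
    · simp [a0, a1, a2, a3, y0, y1, y2, y3]
    · simp [a0, a1, a2, a3, y0, y1, y2, y3]
    · simp only [Quaternion.imJ_mul, Quaternion.re_mul, Quaternion.imI_mul, Quaternion.imK_mul,
        a0, a1, a2, a3, y0, y1, y2, y3]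
      linear_combination (1 / 4) * hr
    · simp [a0, a1, a2, a3, y0, y1, y2, y3]
      ring
  have hc : a * y ≠ y * a := by
    intro h
    have h' := congrArg (fun q : Quaternion K => q.imK) h
    simp only [Quaternion.imK_mul, a0, a1, a2, a3, y0, y1, y2, y3] at h'
    exact hr0 (by linear_combination h')
  have ha0 : a ≠ 0 := left_ne_zero_of_mul (ha3 ▸ neg_ne_zero.2 one_ne_zero)
  have hy0 : y ≠ 0 := left_ne_zero_of_mul (hy2 ▸ neg_ne_zero.2 one_ne_zero)
  let A := Units.mk0 a ha0
  let Y := Units.mk0 y hy0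
  have hA3 : A ^ 3 = -1 := Units.ext (by rw [pow_succ', sq]; exact ha3)
  have hA : orderOf A = 2 * 3 := by
    refine orderOf_eq_of_pow_and_pow_div_prime (by norm_num) ?_ fun p hp hdvd => ?_
    · rw [mul_comm, pow_mul, hA3, neg_one_sq]
    · rcases hp.dvd_mul.1 hdvd with h | h <;>
        rw [Nat.prime_dvd_prime_iff_eq hp (by norm_num)] at h <;> subst h
      · rw [show 2 * 3 / 2 = 3 by rfl, hA3]
        intro h
        have h' := congrArg (fun q => (Units.val q).re) h
        simp only [Units.val_neg, Units.val_one, Quaternion.re_neg, Quaternion.re_one] at h'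
        norm_num at h'
      · intro h
        have h1 : a * a = 1 := by rw [← sq]; exact congrArg Units.val h
        rw [ha2] at h1
        have h' := congrArg (fun q : Quaternion K => q.re) h1
        simp only [Quaternion.re_sub, Quaternion.re_one, a0] at h'
        norm_num at h'
  exact exists_injective_quaternionGroup (a := A) (y := Y) hA
    (by rw [hA3]; exact Units.ext (by simp [Y, sq, hy2]))
    (by
      rw [mul_inv_eq_iff_eq_mul, eq_inv_mul_iff_mul_eq, ← mul_assoc]
      exact Units.ext hya)
    (notMem_zpowers_of_not_commute fun h => hc (congrArg Units.val h.eq))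

theorem embedsInDivisionAlgebra_quaternionGroup_three :
    EmbedsInDivisionAlgebra (QuaternionGroup 3) := by
  let K := IntermediateField.adjoin ℚ {√(3 : ℝ)}
  have hintg : IsIntegral ℚ (√(3 : ℝ)) :=
    ⟨Polynomial.X ^ 2 - 3, Polynomial.monic_X_pow_sub_C (3 : ℚ) two_ne_zero, by simp⟩
  have : FiniteDimensional ℚ K := IntermediateField.adjoin.finiteDimensional hintg
  have : FiniteDimensional ℚ (Quaternion K) := FiniteDimensional.trans ℚ K (Quaternion K)
  let r : K := ⟨√3, IntermediateField.mem_adjoin_simple_self ℚ _⟩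
  have hr : r * r = 3 := Subtype.ext (by simp [r]; rfl)
  obtain ⟨F, hF⟩ := exists_injective_quaternionGroup_three_units hr
  exact ⟨Quaternion K, inferInstance, inferInstance, inferInstance, F, hF⟩

theorem embedsInDivisionAlgebra_zmod {n : ℕ} {x : QuaternionGroup 3} (hx : orderOf x = n) :
    EmbedsInDivisionAlgebra (Multiplicative (ZMod n)) := by
  have e := mulEquivOfCyclicCardEq (G := Multiplicative (ZMod n)) (G' := Subgroup.zpowers x)
    (by rw [Nat.card_zpowers, hx]; exact Nat.card_zmod n)
  exact embedsInDivisionAlgebra_quaternionGroup_three.of_injective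
    (φ := (Subgroup.zpowers x).subtype.comp e.toMonoidHom)
    ((Subgroup.subtype_injective _).comp e.injective)

end Converse

/-- A finite group `G` is a cut group admitting an injective homomorphism
into the unit group of a finite-dimensional division `ℚ`-algebra if and only if `G` is
isomorphic to one of: `1`, `C₂`, `C₃`, `C₄`, `C₆`, the dicyclic group of order 12, `Q₈`,
or `SL(2,3)`. -/
theorem cut_subgroups_of_division_algebras (G : Type*) [Group G] [Finite G] :
    (Finite (↥(Subring.center (MonoidAlgebra ℤ G)))ˣ ∧
      ∃ (D : Type) (_ : DivisionRing D) (_ : Algebra ℚ D) (_ : FiniteDimensional ℚ D)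
        (f : G →* Dˣ), Function.Injective f) ↔
    (Nonempty (G ≃* Multiplicative (ZMod 1)) ∨
     Nonempty (G ≃* Multiplicative (ZMod 2)) ∨
     Nonempty (G ≃* Multiplicative (ZMod 3)) ∨
     Nonempty (G ≃* Multiplicative (ZMod 4)) ∨
     Nonempty (G ≃* Multiplicative (ZMod 6)) ∨
     Nonempty (G ≃* QuaternionGroup 3) ∨
     Nonempty (G ≃* QuaternionGroup 2) ∨
     Nonempty (G ≃* Matrix.SpecialLinearGroup (Fin 2) (ZMod 3))) := by
  constructor
  · rintro ⟨hG, D, _, _, _, f, hf⟩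
    have : CharZero D := algebraRat.charZero D
    exact nonempty_mulEquiv_of_conj_eq_pow (f := (Units.coeHom D).comp f)
      (Units.val_injective.comp hf) fun g _ hk => exists_conj_eq_pow_of_finite_units hG g hk
  · have key {H : Type} [Group H] (hH : ∀ h : H, h ^ 4 = 1 ∨ h ^ 6 = 1)
        (hD : EmbedsInDivisionAlgebra H) (e : G ≃* H) :
        Finite (↥(Subring.center (MonoidAlgebra ℤ G)))ˣ ∧ EmbedsInDivisionAlgebra G :=
      ⟨finite_units_center_of_pow_eq_one fun g => (hH (e g)).imp
          (fun h => e.injective (by rw [map_pow, h, map_one]))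
          (fun h => e.injective (by rw [map_pow, h, map_one])),
        hD.of_injective (φ := e.toMonoidHom) e.injective⟩
    rintro (⟨⟨e⟩⟩ | ⟨⟨e⟩⟩ | ⟨⟨e⟩⟩ | ⟨⟨e⟩⟩ | ⟨⟨e⟩⟩ | ⟨⟨e⟩⟩ | ⟨⟨e⟩⟩ | ⟨⟨e⟩⟩)
    · exact key (by decide) (embedsInDivisionAlgebra_zmod (x := 1) orderOf_one) e
    · exact key (by decide) (embedsInDivisionAlgebra_zmod (x := .a 3)
        (by rw [QuaternionGroup.orderOf_a]; rfl)) e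
    · exact key (by decide) (embedsInDivisionAlgebra_zmod (x := .a 2)
        (by rw [QuaternionGroup.orderOf_a]; rfl)) e
    · exact key (by decide) (embedsInDivisionAlgebra_zmod (x := .xa 0)
        (QuaternionGroup.orderOf_xa 0)) e
    · exact key (by decide) (embedsInDivisionAlgebra_zmod (x := .a 1)
        (by rw [QuaternionGroup.orderOf_a]; rfl)) e
    · exact key (by decide) embedsInDivisionAlgebra_quaternionGroup_three e
    · exact key (by decide) embedsInDivisionAlgebra_quaternionGroup_two e
    · exact key sl_pow_four_or_pow_six embedsInDivisionAlgebra_specialLinearGroup e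
end
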